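/- arXiv:1206.1269 — 2 statements merged into one kernel-verified Lean document; each statement's English description precedes it below -/
import Mathlib

section
/- Every quasi-line graph G with χ(G) ≥ Δ(G) ≥ 9 contains a clique on Δ(G) vertices. -/
/-- Degree via the cardinality of the neighbor set. -/
noncomputable def deg {α : Type*} (G : SimpleGraph α) (v : α) : ℕ :=
  (G.neighborSet v).ncard

/-- Maximum degree. -/
noncomputable def maxDeg {α : Type*} (G : SimpleGraph α) : ℕ :=
  sSup (Set.range (deg G))

/-- A graph is quasi-line if every neighborhood is covered by two cliques. -/
def QuasiLine {V : Type*} (G : SimpleGraph V) : Prop :=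
  ∀ v : V, ∃ C1 C2 : Set V, G.IsClique C1 ∧ G.IsClique C2 ∧
    G.neighborSet v ⊆ C1 ∪ C2

namespace QuasiLineColoring

open Finset
open scoped Classical

variable {V : Type*} {G : SimpleGraph V} {k : ℕ}

/-- `φ` is a proper coloring of the subgraph induced on `A`; its values off `A` are irrelevant. -/
def ProperOn (G : SimpleGraph V) (φ : V → Fin k) (A : Finset V) : Prop :=
  ∀ u ∈ A, ∀ v ∈ A, G.Adj u v → φ u ≠ φ v

lemma ProperOn.mono {φ : V → Fin k} {A B : Finset V} (h : ProperOn G φ B) (hAB : A ⊆ B) :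
    ProperOn G φ A :=
  fun u hu v hv => h u (hAB hu) v (hAB hv)

lemma ProperOn.update {φ : V → Fin k} {B : Finset V} (h : ProperOn G φ B) {v : V} {c : Fin k}
    (hc : ∀ u ∈ B, G.Adj v u → φ u ≠ c) : ProperOn G (Function.update φ v c) (insert v B) := by
  intro x hx y hy hxy
  have hne := hxy.ne
  rw [mem_insert] at hx hy
  by_cases hxv : x = v
  · subst hxv
    rw [Function.update_self, Function.update_of_ne hne.symm]
    exact (hc y (by grind) hxy).symm
  · rw [Function.update_of_ne hxv]
    by_cases hyv : y = v
    · subst hyv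
      rw [Function.update_self]
      exact hc x (by grind) hxy.symm
    · rw [Function.update_of_ne hyv]
      exact h x (by grind) y (by grind) hxy

/-- A clique of maximum cardinality. -/
def MaxClique (G : SimpleGraph V) (Q : Finset V) : Prop :=
  G.IsClique (Q : Set V) ∧ ∀ Q' : Finset V, G.IsClique (Q' : Set V) → #Q' ≤ #Q

variable [Fintype V]

/-- The colors not used by `φ` on the neighbors of `v` outside the uncolored set `A`. -/
noncomputable def avail (G : SimpleGraph V) (φ : V → Fin k) (A : Finset V) (v : V) :
    Finset (Fin k) :=
  univ \ (G.neighborFinset v \ A).image φ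

/-- A vertex-critical non-`k`-colorable graph with maximum degree at most `k + 1`, no clique on
`k + 1` vertices, and all neighborhoods covered by two cliques. -/
structure Critical (G : SimpleGraph V) (k : ℕ) : Prop where
  exists_properOn : ∀ A : Finset V, A ≠ univ → ∃ φ : V → Fin k, ProperOn G φ A
  not_properOn : ∀ φ : V → Fin k, ¬ ProperOn G φ univ
  degree_le : ∀ v, #(G.neighborFinset v) ≤ k + 1
  card_clique_le : ∀ Q : Finset V, G.IsClique (Q : Set V) → #Q ≤ k
  exists_cliques : ∀ v, ∃ C₁ C₂ : Finset V, G.IsClique (C₁ : Set V) ∧ G.IsClique (C₂ : Set V) ∧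
    G.neighborFinset v = C₁ ∪ C₂
  eight_le : 8 ≤ k

lemma mem_avail {φ : V → Fin k} {A : Finset V} {v : V} {c : Fin k} :
    c ∈ avail G φ A v ↔ ∀ u, G.Adj v u → u ∉ A → φ u ≠ c := by
  simp only [avail, mem_sdiff, mem_univ, true_and, mem_image, SimpleGraph.mem_neighborFinset]
  grind

lemma not_mem_avail {φ : V → Fin k} {A : Finset V} {v : V} {c : Fin k} :
    c ∉ avail G φ A v ↔ ∃ u, G.Adj v u ∧ u ∉ A ∧ φ u = c := by
  rw [mem_avail]; push Not; rfl

lemma card_avail (φ : V → Fin k) (A : Finset V) (v : V) :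
    #(avail G φ A v) + #((G.neighborFinset v \ A).image φ) = k := by
  rw [avail, card_sdiff_of_subset (subset_univ _), card_univ, Fintype.card_fin]
  have := card_le_univ ((G.neighborFinset v \ A).image φ)
  rw [Fintype.card_fin] at this
  omega

lemma le_card_avail (φ : V → Fin k) (A : Finset V) (v : V) :
    k + #(G.neighborFinset v ∩ A) ≤ #(avail G φ A v) + #(G.neighborFinset v) := by
  have h₁ := card_avail (G := G) φ A v
  have h₂ : #((G.neighborFinset v \ A).image φ) ≤ _ := card_image_le
  have h₃ := card_sdiff_add_card_inter (G.neighborFinset v) A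
  omega

/-- Greedy extension: every vertex of `T` has more than `deg v - k` neighbors that do not cost a
color, being either uncolored to the end or colored like another neighbor. -/
lemma ProperOn.extend {φ : V → Fin k} {B T : Finset V} (h : ProperOn G φ B) (hd : Disjoint B T)
    (hT : ∀ v ∈ T, ∃ D ⊆ G.neighborFinset v, #(G.neighborFinset v) < k + #D ∧
      ∀ d ∈ D, (d ∉ B ∧ d ∉ T) ∨ (d ∈ B ∧ ∃ d' ∈ B, G.Adj v d' ∧ d' ∉ D ∧ φ d' = φ d)) :
    ∃ φ' : V → Fin k, ProperOn G φ' (B ∪ T) ∧ ∀ u ∈ B, φ' u = φ u := by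
  suffices H : ∀ T' ⊆ T, ∃ φ' : V → Fin k, ProperOn G φ' (B ∪ T') ∧ ∀ u ∈ B, φ' u = φ u from
    H T subset_rfl
  intro T'
  induction T' using Finset.induction_on with
  | empty => exact fun _ => ⟨φ, by simpa using h, fun _ _ => rfl⟩
  | insert v T' hv ih =>
    intro hsub
    obtain ⟨φ', hφ', hag⟩ := ih (fun x hx => hsub (mem_insert_of_mem hx))
    have hvT : v ∈ T := hsub (mem_insert_self _ _)
    obtain ⟨D, hDN, hcard, hD⟩ := hT v hvT
    have himg : (G.neighborFinset v ∩ (B ∪ T')).image φ' ⊆ (G.neighborFinset v \ D).image φ' := by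
      intro c hc
      obtain ⟨u, hu, rfl⟩ := mem_image.1 hc
      rw [mem_inter, mem_union] at hu
      by_cases huD : u ∈ D
      · rcases hD u huD with ⟨h₁, h₂⟩ | ⟨h₁, d', hd'B, hadj, hd'D, heq⟩
        · exact absurd hu.2 (by have := @hsub u; grind)
        · refine mem_image.2 ⟨d', ?_, by rw [hag _ hd'B, hag _ h₁, heq]⟩
          rw [mem_sdiff, SimpleGraph.mem_neighborFinset]
          exact ⟨hadj, hd'D⟩
      · exact mem_image_of_mem _ (mem_sdiff.2 ⟨hu.1, huD⟩)
    have hlt : #((G.neighborFinset v ∩ (B ∪ T')).image φ') < #(univ : Finset (Fin k)) := by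
      have h₁ := card_le_card himg
      have h₂ : #((G.neighborFinset v \ D).image φ') ≤ _ := card_image_le
      rw [card_sdiff_of_subset hDN] at h₂
      have h₃ := card_le_card hDN
      rw [card_univ, Fintype.card_fin]
      omega
    obtain ⟨c, -, hc⟩ := exists_mem_notMem_of_card_lt_card hlt
    refine ⟨Function.update φ' v c, ?_, fun u hu => ?_⟩
    · rw [union_insert]
      refine hφ'.update fun u hu hadj heq => hc (mem_image.2 ⟨u, ?_, heq⟩)
      rw [mem_inter, SimpleGraph.mem_neighborFinset]
      exact ⟨hadj, hu⟩
    · rw [Function.update_of_ne, hag u hu]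
      rintro rfl
      exact disjoint_left.1 hd hu hvT

lemma Critical.le_degree (hG : Critical G k) (v : V) : k ≤ #(G.neighborFinset v) := by
  by_contra hlt
  obtain ⟨φ, hφ⟩ := hG.exists_properOn (univ \ {v}) (by simp)
  obtain ⟨φ', hφ', -⟩ := hφ.extend (T := {v}) (by simp)
    (fun u hu => ⟨∅, by simp, by rw [mem_singleton.1 hu]; simpa using hlt, by simp⟩)
  exact hG.not_properOn φ' (by simpa using hφ')

lemma Critical.claw_free (hG : Critical G k) {v a b c : V} (ha : G.Adj v a)
    (hb : G.Adj v b) (hc : G.Adj v c) (hab : a ≠ b) (hac : a ≠ c) (hbc : b ≠ c) :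
    G.Adj a b ∨ G.Adj a c ∨ G.Adj b c := by
  obtain ⟨C₁, C₂, h₁, h₂, hN⟩ := hG.exists_cliques v
  have key : ∀ x, G.Adj v x → x ∈ C₁ ∨ x ∈ C₂ := fun x hx => by
    rw [← mem_union, ← hN, SimpleGraph.mem_neighborFinset]; exact hx
  have i₁ : ∀ x y, x ∈ C₁ → y ∈ C₁ → x ≠ y → G.Adj x y := fun x y hx hy => h₁ hx hy
  have i₂ : ∀ x y, x ∈ C₂ → y ∈ C₂ → x ≠ y → G.Adj x y := fun x y hx hy => h₂ hx hy
  have := key a ha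
  have := key b hb
  have := key c hc
  grind

lemma Critical.nonempty (hG : Critical G k) : Nonempty V := by
  by_contra h
  rw [not_nonempty_iff] at h
  exact hG.not_properOn (fun v => h.elim v) (fun u => h.elim u)

lemma exists_maxClique (G : SimpleGraph V) : ∃ Q, MaxClique G Q := by
  obtain ⟨Q, hQ, hmax⟩ := (univ.filter fun Q : Finset V => G.IsClique (Q : Set V)).exists_max_image
    card ⟨∅, by simp⟩
  exact ⟨Q, (mem_filter.1 hQ).2, fun Q' hQ' => hmax Q' (by simpa using hQ')⟩

lemma Critical.degree_le_of_maxClique (hG : Critical G k) {Q : Finset V} (hQ : MaxClique G Q)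
    (v : V) : #(G.neighborFinset v) + 2 ≤ 2 * #Q := by
  obtain ⟨C₁, C₂, h₁, h₂, hN⟩ := hG.exists_cliques v
  have key : ∀ C : Finset V, G.IsClique (C : Set V) → C ⊆ G.neighborFinset v → #C + 1 ≤ #Q := by
    intro C hC hCN
    have hv : v ∉ C := fun h => by simpa using hCN h
    rw [← card_insert_of_notMem hv]
    refine hQ.2 _ ?_
    rw [coe_insert]
    exact hC.insert fun b hb _ => by simpa using hCN hb
  have := key C₁ h₁ (hN ▸ subset_union_left)
  have := key C₂ h₂ (hN ▸ subset_union_right)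
  have := card_union_le C₁ C₂
  rw [hN]
  omega

lemma Critical.five_le_card (hG : Critical G k) {Q : Finset V} (hQ : MaxClique G Q) : 5 ≤ #Q := by
  obtain ⟨v⟩ := hG.nonempty
  have := hG.degree_le_of_maxClique hQ v
  have := hG.le_degree v
  have := hG.eight_le
  omega

/-- A proper coloring off `K` violates Hall's condition on `K`. -/
lemma Critical.exists_hall_violator (hG : Critical G k) {K : Finset V} {φ : V → Fin k}
    (hφ : ProperOn G φ (univ \ K)) :
    ∃ S ⊆ K, #(S.biUnion (avail G φ K)) < #S := by
  by_contra! hcon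
  obtain ⟨f, hinj, hf⟩ := (all_card_le_biUnion_card_iff_exists_injective
    (fun v : {x // x ∈ K} => avail G φ K v)).1 (fun s => by
      have h := hcon (s.map (Function.Embedding.subtype _))
        (fun x hx => by obtain ⟨y, -, rfl⟩ := mem_map.1 hx; exact y.2)
      rw [card_map] at h
      refine h.trans (card_le_card fun c hc => ?_)
      simpa using hc)
  refine hG.not_properOn (fun v => if h : v ∈ K then f ⟨v, h⟩ else φ v) ?_
  intro x _ y _ hxy
  have hne := hxy.ne
  by_cases hx : x ∈ K <;> by_cases hy : y ∈ K <;>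
    simp only [hx, hy, dif_pos, dif_neg, not_false_eq_true]
  · intro h
    exact hne (congrArg Subtype.val (hinj h))
  · exact (mem_avail.1 (hf ⟨x, hx⟩) y hxy hy).symm
  · exact mem_avail.1 (hf ⟨y, hy⟩) x hxy.symm hx
  · exact hφ x (by simpa using hx) y (by simpa using hy) hxy

section TwoMaxCliques

/-- Coloring two nonadjacent vertices complete to `K` leaves a Hall violator on `K`. -/
lemma Critical.exists_hall_violator_sdiff (hG : Critical G k) {K : Finset V} {r p : V}
    (hadj : ¬ G.Adj r p) {φ : V → Fin k}
    (hφ : ProperOn G φ (univ \ insert r (insert p K))) {c d : Fin k}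
    (hc : c ∈ avail G φ (insert r (insert p K)) r)
    (hd : d ∈ avail G φ (insert r (insert p K)) p) :
    ∃ S ⊆ K, #(S.biUnion fun v => avail G φ (insert r (insert p K)) v \ {c, d}) < #S := by
  have h₁ : ProperOn G (Function.update φ r c) (insert r (univ \ insert r (insert p K))) :=
    hφ.update fun u hu hru => mem_avail.1 hc u hru (by simpa using hu)
  have h₂ := h₁.update (v := p) (c := d) fun u hu hpu => by
    have hur : u ≠ r := by rintro rfl; exact hadj hpu.symm
    rw [Function.update_of_ne hur]
    exact mem_avail.1 hd u hpu (by simpa [hur] using hu)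
  obtain ⟨S, hSK, hS⟩ := hG.exists_hall_violator (K := K)
    (h₂.mono (fun x hx => by simp only [mem_sdiff, mem_univ, mem_insert] at hx ⊢; tauto))
  refine ⟨S, hSK, (card_le_card ?_).trans_lt hS⟩
  refine biUnion_mono fun v hv e he => ?_
  simp only [mem_sdiff, mem_avail, mem_insert, mem_singleton, not_or] at he ⊢
  intro u hvu huK
  by_cases hup : u = p
  · subst hup; rw [Function.update_self]; exact fun h => he.2.2 h.symm
  rw [Function.update_of_ne hup]
  by_cases hur : u = r
  · subst hur; rw [Function.update_self]; exact fun h => he.2.1 h.symm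
  rw [Function.update_of_ne hur]
  exact he.1 u hvu (by tauto)

lemma Critical.card_biUnion_avail_le (hG : Critical G k) {K : Finset V} {r p : V}
    (hK : G.IsClique (K : Set V)) (hrK : ∀ v ∈ K, G.Adj r v) (hpK : ∀ v ∈ K, G.Adj p v)
    (hrp : r ≠ p) (hadj : ¬ G.Adj r p) (hcard : 4 ≤ #K) {φ : V → Fin k}
    (hφ : ProperOn G φ (univ \ insert r (insert p K))) :
    (∀ v ∈ K, #K ≤ #(avail G φ (insert r (insert p K)) v)) ∧
    #(K.biUnion (avail G φ (insert r (insert p K)))) ≤ #K := by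
  have hrK' : r ∉ K := fun h => G.irrefl (hrK r h)
  have hpK' : p ∉ K := fun h => G.irrefl (hpK p h)
  have hviol := fun c d => hG.exists_hall_violator_sdiff (c := c) (d := d) hadj hφ
  set A := insert r (insert p K) with hA
  set L := avail G φ A with hL
  have hLK : ∀ v ∈ K, #K ≤ #(L v) := by
    intro v hv
    have h₁ : k + #(G.neighborFinset v ∩ A) ≤ #(L v) + #(G.neighborFinset v) :=
      le_card_avail φ A v
    have h₂ : insert r (insert p (K.erase v)) ⊆ G.neighborFinset v ∩ A := by
      intro x hx
      simp only [mem_insert, mem_erase, mem_inter, SimpleGraph.mem_neighborFinset, hA] at hx ⊢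
      rcases hx with rfl | rfl | ⟨hx, hxK⟩
      · exact ⟨(hrK v hv).symm, by simp⟩
      · exact ⟨(hpK v hv).symm, by simp⟩
      · exact ⟨hK hv hxK hx.symm, by simp [hxK]⟩
    have h₃ := card_le_card h₂
    rw [card_insert_of_notMem (by simp [hrp, hrK']), card_insert_of_notMem (by simp [hpK']),
      card_erase_of_mem hv] at h₃
    have := hG.degree_le v
    omega
  have hLr : ∀ s, s = r ∨ s = p → #K ≤ #(L s) + 1 := by
    intro s hs
    have h₁ : k + #(G.neighborFinset s ∩ A) ≤ #(L s) + #(G.neighborFinset s) :=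
      le_card_avail φ A s
    have h₂ : K ⊆ G.neighborFinset s ∩ A := by
      intro x hx
      simp only [mem_insert, mem_inter, SimpleGraph.mem_neighborFinset, hA]
      rcases hs with rfl | rfl
      · exact ⟨hrK x hx, by simp [hx]⟩
      · exact ⟨hpK x hx, by simp [hx]⟩
    have h₃ := card_le_card h₂
    have := hG.degree_le s
    omega
  refine ⟨hLK, ?_⟩
  by_contra! hU
  set U := K.biUnion L with hUdef
  have hsub : ∀ v ∈ K, L v ⊆ U := fun v hv => subset_biUnion_of_mem L hv
  have hdiff : ∀ c d, (K.biUnion fun v => L v \ {c, d}) = U \ {c, d} := by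
    intro c d; ext x; simp only [hUdef, mem_biUnion, mem_sdiff]; grind
  have hnice : ∀ c ∈ L r, ∀ d ∈ L p, (∃ e, ∀ x ∈ U, x = c ∨ x = d → x = e) → False := by
    rintro c hc d hd ⟨e, he⟩
    have herase : ∀ W ⊆ U, W.erase e ⊆ W \ {c, d} := by
      intro W hW x hx
      have := @hW x
      have := he x
      simp only [mem_erase, mem_sdiff, mem_insert, mem_singleton] at hx ⊢
      grind
    obtain ⟨S, hSK, hS⟩ := hviol c d hc hd
    obtain ⟨v, hv⟩ : S.Nonempty := card_pos.1 (by omega)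
    have h₁ := card_le_card (subset_biUnion_of_mem (fun v => L v \ {c, d}) hv)
    have h₂ := card_le_card (herase _ (hsub v (hSK hv)))
    have h₃ := pred_card_le_card_erase (a := e) (s := L v)
    have h₄ := hLK v (hSK hv)
    have h₅ := card_le_card hSK
    have hSeq : S = K := eq_of_subset_of_card_le hSK (by grind)
    rw [hSeq, hdiff] at hS
    have h₆ := card_le_card (herase U subset_rfl)
    have h₇ := pred_card_le_card_erase (a := e) (s := U)
    omega
  have hdisj : Disjoint (L r) (L p) := disjoint_left.2 fun c hc hd =>
    hnice c hc c hd ⟨c, by simp⟩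
  have hr := hLr r (Or.inl rfl)
  have hp := hLr p (Or.inr rfl)
  obtain ⟨c₀, hc₀⟩ : (L r).Nonempty := card_pos.1 (by omega)
  obtain ⟨d₀, hd₀⟩ : (L p).Nonempty := card_pos.1 (by omega)
  have hrU : L r ⊆ U := fun c hc => by
    by_contra h
    exact hnice c hc d₀ hd₀ ⟨d₀, fun x hx hxx => by grind⟩
  have hpU : L p ⊆ U := fun d hd => by
    by_contra h
    exact hnice c₀ hc₀ d hd ⟨c₀, fun x hx hxx => by grind⟩
  have hun := card_union_of_disjoint hdisj
  have hunU := card_le_card (union_subset hrU hpU)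
  have huniform : ∀ c ∈ L r, ∀ d ∈ L p, ∃ S ⊆ K, #K ≤ #S + 1 ∧ ∃ L₀ : Finset (Fin k),
      #L₀ ≤ #K ∧ c ∈ L₀ ∧ d ∈ L₀ ∧ ∀ v ∈ S, L v = L₀ := by
    intro c hc d hd
    obtain ⟨S, hSK, hS⟩ := hviol c d hc hd
    have hpair : ∀ W : Finset (Fin k), #W ≤ #(W \ {c, d}) + 2 := fun W => by
      have h₁ := le_card_sdiff {c, d} W
      have h₂ := card_le_two (a := c) (b := d)
      omega
    set W := S.biUnion fun v => L v \ {c, d} with hW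
    have hWv : ∀ v ∈ S, L v \ {c, d} ⊆ W :=
      fun v hv => subset_biUnion_of_mem (fun v => L v \ {c, d}) hv
    obtain ⟨v₀, hv₀⟩ : S.Nonempty := card_pos.1 (by omega)
    have hcardle : ∀ v ∈ S, #K ≤ #(L v \ {c, d}) + 2 := fun v hv =>
      (hLK v (hSK hv)).trans (hpair _)
    have h₁ := card_le_card hSK
    have hne : S ≠ K := by
      rintro rfl
      rw [hW, hdiff] at hS
      have := hpair U
      omega
    have hlt : #S < #K := card_lt_card (hSK.ssubset_of_ne hne)
    have hmem : ∀ v ∈ S, L v = insert c (insert d W) := by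
      intro v hv
      have e₁ : L v \ {c, d} = W :=
        eq_of_subset_of_card_le (hWv v hv) (by have := hcardle v hv; omega)
      have e₂ : L v ⊆ insert c (insert d W) := by
        intro x hx
        rw [← e₁]
        simp only [mem_insert, mem_sdiff, mem_singleton]
        tauto
      refine eq_of_subset_of_card_le e₂ ?_
      have e₃ := card_insert_le c (insert d W)
      have e₄ := card_insert_le d W
      have := hLK v (hSK hv)
      omega
    have hc0 := hcardle v₀ hv₀
    have hc1 := card_le_card (hWv v₀ hv₀)
    refine ⟨S, hSK, by omega, insert c (insert d W), ?_, by simp, by simp, hmem⟩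
    have e₃ := card_insert_le c (insert d W)
    have e₄ := card_insert_le d W
    omega
  obtain ⟨S, hSK, hS, L₀, hL₀, -, -, hSL⟩ := huniform c₀ hc₀ d₀ hd₀
  obtain ⟨e, he, heL⟩ := exists_mem_notMem_of_card_lt_card (s := L₀) (t := L r ∪ L p) (by omega)
  obtain ⟨S', hS'K, hS', L₁, -, hL₁, hSL'⟩ : ∃ S ⊆ K, #K ≤ #S + 1 ∧ ∃ L₀ : Finset (Fin k),
      #L₀ ≤ #K ∧ e ∈ L₀ ∧ ∀ v ∈ S, L v = L₀ := by
    rcases mem_union.1 he with he | he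
    · obtain ⟨S, h₁, h₂, L₀, h₃, h₄, -, h₅⟩ := huniform e he d₀ hd₀
      exact ⟨S, h₁, h₂, L₀, h₃, h₄, h₅⟩
    · obtain ⟨S, h₁, h₂, L₀, h₃, -, h₄, h₅⟩ := huniform c₀ hc₀ e he
      exact ⟨S, h₁, h₂, L₀, h₃, h₄, h₅⟩
  obtain ⟨v, hv⟩ : (S ∩ S').Nonempty := card_pos.1 (by
    have h₁ := card_union_add_card_inter S S'
    have h₂ := card_le_card (union_subset hSK hS'K)
    omega)
  rw [mem_inter] at hv
  exact heL (by rw [← hSL v hv.1, hSL' v hv.2]; exact hL₁)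

/-- Two maximum cliques of a critical graph do not differ in exactly one vertex. -/
lemma Critical.card_trace_add_two_le (hG : Critical G k) {Q : Finset V} (hQ : MaxClique G Q)
    {p : V} (hp : p ∉ Q) : #(G.neighborFinset p ∩ Q) + 2 ≤ #Q := by
  by_contra! hlt
  have hq := hG.five_le_card hQ
  set K := G.neighborFinset p ∩ Q with hKdef
  have hKQ : K ⊆ Q := inter_subset_right
  have hclique : ∀ s ∉ K, ∀ C ⊆ K, (∀ v ∈ C, G.Adj s v) →
      G.IsClique ((insert s C : Finset V) : Set V) := by
    intro s hs C hC h
    rw [coe_insert]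
    exact (hQ.1.subset (by exact_mod_cast hC.trans hKQ)).insert fun b hb _ => h b hb
  have hpK : ∀ v ∈ K, G.Adj p v := fun v hv => by
    simpa using (mem_inter.1 hv).1
  have hpK' : p ∉ K := fun h => hp (hKQ h)
  have hcK : #K + 1 = #Q := by
    have h₁ := hQ.2 _ (hclique p hpK' K subset_rfl hpK)
    rw [card_insert_of_notMem hpK'] at h₁
    omega
  obtain ⟨r, hrQ, hrK⟩ := exists_mem_notMem_of_card_lt_card (s := K) (t := Q) (by omega)
  have hrp : r ≠ p := by rintro rfl; exact hp hrQ
  have hadj : ¬ G.Adj r p := fun h => hrK (mem_inter.2 ⟨by simpa using h.symm, hrQ⟩)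
  have hrK' : ∀ v ∈ K, G.Adj r v := fun v hv =>
    hQ.1 hrQ (hKQ hv) (by rintro rfl; exact hrK hv)
  have hKc : G.IsClique (K : Set V) := hQ.1.subset (by exact_mod_cast hKQ)
  have hlem := fun φ hφ => hG.card_biUnion_avail_le (φ := φ) hKc hrK' hpK hrp hadj (by omega) hφ
  set A := insert r (insert p K) with hA
  have hcA : #A = #K + 2 := by
    rw [hA, card_insert_of_notMem (by simp [hrp, hrK]), card_insert_of_notMem hpK']
  have hKA : K ⊆ A := fun x hx => by simp [hA, hx]
  have heq : ∀ φ : V → Fin k, ProperOn G φ (univ \ A) → ∀ v ∈ K,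
      avail G φ A v = K.biUnion (avail G φ A) ∧ #(avail G φ A v) = #K := by
    intro φ hφ v hv
    obtain ⟨h₁, h₂⟩ := hlem φ hφ
    have h₃ := subset_biUnion_of_mem (avail G φ A) hv
    have h₄ := card_le_card h₃
    have h₅ := h₁ v hv
    exact ⟨eq_of_subset_of_card_le h₃ (by omega), by omega⟩
  obtain ⟨φ, hφ⟩ := hG.exists_properOn (univ \ A) (fun h => by
    have : r ∈ univ \ A := by rw [h]; exact mem_univ r
    simp [hA] at this)
  have hkq := hG.card_clique_le Q hQ.1
  have h8 := hG.eight_le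
  have hNA : ∀ v ∈ K, #(G.neighborFinset v \ A) + #K ≤ k := by
    intro v hv
    have h₂ : A.erase v ⊆ G.neighborFinset v ∩ A := by
      intro x hx
      simp only [mem_erase, mem_inter, SimpleGraph.mem_neighborFinset] at hx ⊢
      refine ⟨?_, hx.2⟩
      have := hx.2
      simp only [hA, mem_insert] at this
      rcases this with rfl | rfl | h
      · exact (hrK' v hv).symm
      · exact (hpK v hv).symm
      · exact hKc hv h hx.1.symm
    have h₃ := card_le_card h₂
    rw [card_erase_of_mem (hKA hv)] at h₃
    have h₄ := card_sdiff_add_card_inter (G.neighborFinset v) A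
    have := hG.degree_le v
    omega
  have himg : ∀ v ∈ K, #((G.neighborFinset v \ A).image φ) + #K = k := by
    intro v hv
    have := card_avail (G := G) φ A v
    have := (heq φ hφ v hv).2
    omega
  have hinj : ∀ v ∈ K, Set.InjOn φ (G.neighborFinset v \ A : Finset V) := by
    intro v hv
    refine card_image_iff.1 (le_antisymm card_image_le ?_)
    have := himg v hv
    have := hNA v hv
    omega
  have hclaw : ∀ v ∈ K, ∀ a ∉ A, G.Adj v a → G.Adj a r ∨ G.Adj a p := by
    intro v hv a ha hva
    simp only [hA, mem_insert, not_or] at ha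
    rcases hG.claw_free (hrK' v hv).symm (hpK v hv).symm hva hrp (Ne.symm ha.1) (Ne.symm ha.2.1)
      with h | h | h
    · exact absurd h hadj
    · exact Or.inl h.symm
    · exact Or.inr h.symm
  have hpriv : ∀ u ∈ K, ∀ v ∈ K, u ≠ v → ∀ a ∉ A, G.Adj u a → G.Adj v a → False := by
    intro u hu v hv huv a ha hua hva
    have ha' := ha
    simp only [hA, mem_insert, not_or] at ha'
    obtain ⟨s, hs, hsA, hsa⟩ : ∃ s, (s = r ∨ s = p) ∧ s ∈ A ∧ G.Adj a s := by
      rcases hclaw u hu a ha hua with h | h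
      · exact ⟨r, Or.inl rfl, by simp [hA], h⟩
      · exact ⟨p, Or.inr rfl, by simp [hA], h⟩
    have hsK : s ∉ K := by rcases hs with rfl | rfl <;> assumption
    have hsK' : ∀ v ∈ K, G.Adj s v := by rcases hs with rfl | rfl <;> assumption
    have h₁ : ({s, u, v} : Finset V) ⊆ G.neighborFinset a ∩ A := by
      intro x hx
      simp only [mem_insert, mem_singleton] at hx
      rw [mem_inter, SimpleGraph.mem_neighborFinset]
      rcases hx with rfl | rfl | rfl
      · exact ⟨hsa, hsA⟩
      · exact ⟨hua.symm, hKA hu⟩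
      · exact ⟨hva.symm, hKA hv⟩
    have h₂ := card_le_card h₁
    rw [card_eq_three.2 ⟨s, u, v, by rintro rfl; exact hsK hu, by rintro rfl; exact hsK hv, huv,
      rfl⟩] at h₂
    have h₃ := le_card_avail (G := G) φ A a
    have h₄ := hG.degree_le a
    obtain ⟨γ, hγ, hγa⟩ : ∃ γ ∈ avail G φ A a, γ ≠ φ a :=
      exists_mem_ne (by omega) (φ a)
    have hφ' : ProperOn G (Function.update φ a γ) (univ \ A) :=
      (hφ.update (v := a) (c := γ) fun x hx hax => mem_avail.1 hγ x hax (by simpa using hx)).mono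
        (subset_insert _ _)
    have hu' : φ a ∈ avail G (Function.update φ a γ) A u := by
      rw [mem_avail]
      intro x hux hxA
      by_cases hxa : x = a
      · subst hxa; rwa [Function.update_self]
      · rw [Function.update_of_ne hxa]
        intro h
        exact hxa (hinj u hu (by simp [hux, hxA]) (by simp [hua, ha]) h)
    have hall : ∀ w ∈ K, G.Adj a w := by
      intro w hw
      have h₅ : φ a ∉ avail G φ A w := by
        rw [(heq φ hφ w hw).1, ← (heq φ hφ u hu).1, not_mem_avail]
        exact ⟨a, hua, ha, rfl⟩
      have h₆ : φ a ∈ avail G (Function.update φ a γ) A w := by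
        rw [(heq _ hφ' w hw).1, ← (heq _ hφ' u hu).1]
        exact hu'
      obtain ⟨x, hwx, hxA, hxc⟩ := not_mem_avail.1 h₅
      have h₇ := mem_avail.1 h₆ x hwx hxA
      by_cases hxa : x = a
      · subst hxa; exact hwx.symm
      · rw [Function.update_of_ne hxa] at h₇
        exact absurd hxc h₇
    have hbig : G.IsClique ((insert a (insert s K) : Finset V) : Set V) := by
      rw [coe_insert]
      refine (hclique s hsK K subset_rfl hsK').insert fun b hb _ => ?_
      rcases mem_insert.1 (mem_coe.1 hb) with rfl | hb
      · exact hsa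
      · exact hall b hb
    have h₈ := hQ.2 _ hbig
    rw [card_insert_of_notMem (by
        rw [mem_insert]; rintro (rfl | h)
        · exact G.irrefl hsa
        · exact ha'.2.2 h), card_insert_of_notMem hsK] at h₈
    omega
  have hO : K.biUnion (fun v => G.neighborFinset v \ A) ⊆
      (G.neighborFinset r \ K) ∪ (G.neighborFinset p \ K) := by
    intro a ha
    simp only [mem_biUnion, mem_sdiff, SimpleGraph.mem_neighborFinset, mem_union] at ha ⊢
    obtain ⟨v, hv, hva, haA⟩ := ha
    have haK : a ∉ K := fun h => haA (hKA h)
    rcases hclaw v hv a haA hva with h | h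
    · exact Or.inl ⟨h.symm, haK⟩
    · exact Or.inr ⟨h.symm, haK⟩
  have hOcard := card_biUnion (s := K) (t := fun v => G.neighborFinset v \ A)
    (fun u hu v hv huv => disjoint_left.2 fun a hau hav => by
      simp only [mem_sdiff, SimpleGraph.mem_neighborFinset] at hau hav
      exact hpriv u hu v hv huv a hau.2 hau.1 hav.1)
  have hsum : #K * (k - #K) ≤ ∑ v ∈ K, #(G.neighborFinset v \ A) := by
    rw [← smul_eq_mul]
    refine card_nsmul_le_sum _ _ _ fun v hv => ?_
    have := himg v hv
    have h : #((G.neighborFinset v \ A).image φ) ≤ _ := card_image_le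
    omega
  have houter : ∀ s, (∀ v ∈ K, G.Adj s v) → #(G.neighborFinset s \ K) + #K ≤ k + 1 := by
    intro s hs
    rw [card_sdiff_add_card_eq_card (fun v hv => by simpa using hs v hv)]
    exact hG.degree_le s
  have h₁ := houter r hrK'
  have h₂ := houter p hpK
  have h₃ := (card_le_card hO).trans (card_union_le _ _)
  obtain ⟨j, hj⟩ : ∃ j, k = #K + j := ⟨k - #K, by omega⟩
  have hj' : k - #K = j := by omega
  rw [hj'] at hsum
  have h₄ : #K * j ≤ 2 * j + 2 := by omega
  nlinarith

end TwoMaxCliques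


section NonadjacentOuterNeighbors

/-- `p` and `y` are nonadjacent neighbors of `w` outside the maximum clique `Q ∋ w`, and `C₁ ∋ p`
and `C₂ ∋ y` are cliques covering the neighborhood of `w`. -/
structure BadPair (G : SimpleGraph V) (Q : Finset V) (w p y : V) (C₁ C₂ : Finset V) : Prop where
  maxClique : MaxClique G Q
  mem : w ∈ Q
  left_notMem : p ∉ Q
  right_notMem : y ∉ Q
  ne : p ≠ y
  not_adj : ¬ G.Adj p y
  clique_left : G.IsClique (C₁ : Set V)
  clique_right : G.IsClique (C₂ : Set V)
  neighborFinset_eq : G.neighborFinset w = C₁ ∪ C₂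
  left_mem : p ∈ C₁
  right_mem : y ∈ C₂

variable {Q C₁ C₂ : Finset V} {w p y : V}

lemma BadPair.symm (h : BadPair G Q w p y C₁ C₂) : BadPair G Q w y p C₂ C₁ where
  maxClique := h.maxClique
  mem := h.mem
  left_notMem := h.right_notMem
  right_notMem := h.left_notMem
  ne := h.ne.symm
  not_adj := fun ha => h.not_adj ha.symm
  clique_left := h.clique_right
  clique_right := h.clique_left
  neighborFinset_eq := by rw [h.neighborFinset_eq, union_comm]
  left_mem := h.right_mem
  right_mem := h.left_mem

lemma BadPair.adj_iff (h : BadPair G Q w p y C₁ C₂) {v : V} : G.Adj w v ↔ v ∈ C₁ ∨ v ∈ C₂ := by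
  rw [← mem_union, ← h.neighborFinset_eq, SimpleGraph.mem_neighborFinset]

lemma BadPair.mem_left_of_not_adj (h : BadPair G Q w p y C₁ C₂) {v : V} (hv : v ∈ Q)
    (hyv : ¬ G.Adj y v) : v ∈ C₁ := by
  have hvw : w ≠ v := by
    rintro rfl
    exact hyv (h.adj_iff.2 (Or.inr h.right_mem)).symm
  refine (h.adj_iff.1 (h.maxClique.1 h.mem hv hvw)).resolve_right fun hv₂ => hyv ?_
  exact h.clique_right h.right_mem hv₂ (by rintro rfl; exact h.right_notMem hv)

lemma BadPair.adj_of_not_adj (h : BadPair G Q w p y C₁ C₂) {v : V} (hv : v ∈ Q)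
    (hyv : ¬ G.Adj y v) : G.Adj p v :=
  h.clique_left h.left_mem (h.mem_left_of_not_adj hv hyv) (by rintro rfl; exact h.left_notMem hv)

lemma BadPair.two_le_card (h : BadPair G Q w p y C₁ C₂) (hG : Critical G k) :
    2 ≤ #(Q.filter fun v => ¬ G.Adj p v) := by
  have h₁ := hG.card_trace_add_two_le h.maxClique h.left_notMem
  have h₂ := card_filter_add_card_filter_not (s := Q) (fun v => G.Adj p v)
  have h₃ : G.neighborFinset p ∩ Q = Q.filter fun v => G.Adj p v := by
    ext v; simp [and_comm]
  rw [h₃] at h₁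
  omega

lemma BadPair.card_add_card_lt (h : BadPair G Q w p y C₁ C₂) :
    #(Q.filter fun v => ¬ G.Adj p v) + #(Q.filter fun v => ¬ G.Adj y v) < #Q := by
  rw [← card_union_of_disjoint (disjoint_left.2 fun v hv hv' => by
    rw [mem_filter] at hv hv'
    exact hv.2 (h.adj_of_not_adj hv.1 hv'.2))]
  refine card_lt_card ((ssubset_iff_of_subset (by grind)).2 ⟨w, h.mem, ?_⟩)
  have h₁ := (h.adj_iff.2 (Or.inl h.left_mem)).symm
  have h₂ := (h.adj_iff.2 (Or.inr h.right_mem)).symm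
  simp [h₁, h₂]

lemma BadPair.subset_closedNeighborhood (h : BadPair G Q w p y C₁ C₂) :
    Q ⊆ insert w (G.neighborFinset w) := by
  intro v hv
  rw [mem_insert, SimpleGraph.mem_neighborFinset]
  by_cases hvw : v = w
  · exact Or.inl hvw
  · exact Or.inr (h.maxClique.1 h.mem hv (Ne.symm hvw))

/-- Lower bound on the number of colors available to both of the nonadjacent vertices `p`, `r`. -/
lemma BadPair.le_card_inter_avail (h : BadPair G Q w p y C₁ C₂) (φ : V → Fin k) {r : V}
    (hr : r ∈ Q) (hpr : ¬ G.Adj p r) :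
    #(G.neighborFinset w) + #Q + k ≤
      #(avail G φ (insert w (G.neighborFinset w)) p ∩ avail G φ (insert w (G.neighborFinset w)) r) +
      #(Q.filter fun v => ¬ G.Adj p v) + #(G.neighborFinset p) + #(G.neighborFinset r) + 1 := by
  have hQA := h.subset_closedNeighborhood
  have hr₂ : r ∈ C₂ := h.symm.mem_left_of_not_adj hr hpr
  have hcA : #(insert w (G.neighborFinset w)) = #(G.neighborFinset w) + 1 :=
    card_insert_of_notMem (by simp)
  have hmemA : ∀ x, x ∈ insert w (G.neighborFinset w) ↔ x = w ∨ x ∈ C₁ ∨ x ∈ C₂ := by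
    intro x; rw [mem_insert, SimpleGraph.mem_neighborFinset, h.adj_iff]
  set A := insert w (G.neighborFinset w)
  have i₁ : ∀ x, x ∈ C₁ → x ≠ p → G.Adj p x := fun x hx hne => h.clique_left h.left_mem hx hne.symm
  have i₂ : ∀ x, x ∈ C₂ → x ≠ r → G.Adj r x := fun x hx hne => h.clique_right hr₂ hx hne.symm
  have i₃ : ∀ x, x ∈ Q → x ≠ r → G.Adj r x := fun x hx hne => h.maxClique.1 hr hx hne.symm
  have hw := h.mem
  have hunion : A ⊆ insert p (G.neighborFinset p ∩ A) ∪ insert r (G.neighborFinset r ∩ A) := by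
    intro x hx
    have := (hmemA x).1 hx
    simp only [mem_union, mem_insert, mem_inter, SimpleGraph.mem_neighborFinset]
    grind
  have hinter : (Q.filter fun v => G.Adj p v) ⊆
      insert p (G.neighborFinset p ∩ A) ∩ insert r (G.neighborFinset r ∩ A) := by
    intro x hx
    rw [mem_filter] at hx
    have := hQA hx.1
    have := i₃ x hx.1
    simp only [mem_insert, mem_inter, SimpleGraph.mem_neighborFinset]
    grind
  have h₁ := card_union_add_card_inter
    (insert p (G.neighborFinset p ∩ A)) (insert r (G.neighborFinset r ∩ A))
  have h₂ := card_le_card hunion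
  have h₃ := card_le_card hinter
  have h₄ := card_filter_add_card_filter_not (s := Q) (fun v => G.Adj p v)
  have h₅ := card_insert_le p (G.neighborFinset p ∩ A)
  have h₆ := card_insert_le r (G.neighborFinset r ∩ A)
  have h₇ := le_card_avail (G := G) φ A p
  have h₈ := le_card_avail (G := G) φ A r
  have h₉ := card_union_add_card_inter (avail G φ A p) (avail G φ A r)
  have h₁₀ := card_le_univ (avail G φ A p ∪ avail G φ A r)
  rw [Fintype.card_fin] at h₁₀
  omega

/-- A common available color of `p` and a nonneighbor `r ∈ Q` of `p` leads to a coloring when `w`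
has small degree. -/
lemma BadPair.false_of_common_color (h : BadPair G Q w p y C₁ C₂) (hG : Critical G k)
    (hdeg : #(G.neighborFinset w) ≤ k) {φ : V → Fin k}
    (hφ : ProperOn G φ (univ \ insert w (G.neighborFinset w))) {r : V}
    (hr : r ∈ Q) (hpr : ¬ G.Adj p r) {c : Fin k}
    (hcp : c ∈ avail G φ (insert w (G.neighborFinset w)) p)
    (hcr : c ∈ avail G φ (insert w (G.neighborFinset w)) r) : False := by
  have hQA := h.subset_closedNeighborhood
  have hwA : w ∈ insert w (G.neighborFinset w) := mem_insert_self _ _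
  have hmemA : ∀ x, x ∈ insert w (G.neighborFinset w) → x ≠ w → G.Adj w x := by
    intro x hx hne
    rw [mem_insert, SimpleGraph.mem_neighborFinset] at hx
    exact hx.resolve_left hne
  have hwp : G.Adj w p := h.adj_iff.2 (Or.inl h.left_mem)
  have hpA : p ∈ insert w (G.neighborFinset w) := by simp [hwp]
  set A := insert w (G.neighborFinset w)
  have hw := h.mem
  have hpQ := h.left_notMem
  have hQadj : ∀ u ∈ Q, ∀ v ∈ Q, u ≠ v → G.Adj u v := fun u hu v hv => h.maxClique.1 hu hv
  have hrw : r ≠ w := by rintro rfl; exact hpr hwp.symm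
  have hrp : r ≠ p := by rintro rfl; exact hpQ hr
  obtain ⟨p', hp'⟩ : (Q.filter fun v => ¬ G.Adj y v).Nonempty :=
    card_pos.1 (by have := h.symm.two_le_card hG; omega)
  obtain ⟨r₂, hr₂, hr₂r⟩ := exists_mem_ne (by have := h.two_le_card hG; omega) r
    (s := Q.filter fun v => ¬ G.Adj p v)
  rw [mem_filter] at hp' hr₂
  have hpp' := h.adj_of_not_adj hp'.1 hp'.2
  have hp'C := h.mem_left_of_not_adj hp'.1 hp'.2
  have hr₂C := h.symm.mem_left_of_not_adj hr₂.1 hr₂.2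
  have hp'w : p' ≠ w := by
    rintro rfl; exact hp'.2 (h.adj_iff.2 (Or.inr h.right_mem)).symm
  have hr₂w : r₂ ≠ w := by rintro rfl; exact hr₂.2 hwp.symm
  have hp'r : p' ≠ r := by rintro rfl; exact hpr hpp'
  have hstart : ProperOn G (Function.update (Function.update φ r c) p c)
      (insert p (insert r (univ \ A))) := by
    refine (hφ.update fun u hu hru => mem_avail.1 hcr u hru (by simpa using hu)).update ?_
    intro u hu hpu
    have hur : u ≠ r := by rintro rfl; exact hpr hpu
    rw [Function.update_of_ne hur]
    exact mem_avail.1 hcp u hpu (by simpa [hur] using hu)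
  obtain ⟨ψ, hψ, hψpr⟩ : ∃ ψ : V → Fin k, ProperOn G ψ (insert p (insert r (univ \ A))) ∧
      ψ r = ψ p := ⟨_, hstart, by simp [Function.update_of_ne hrp]⟩
  have hmemB : ∀ x, x ∈ insert p (insert r (univ \ A)) ↔ x = p ∨ x = r ∨ x ∉ A := by
    simp
  set B := insert p (insert r (univ \ A))
  have hpair : ∀ {v a b : V}, G.Adj v a → G.Adj v b → a ≠ b →
      ({a, b} : Finset V) ⊆ G.neighborFinset v ∧ #(G.neighborFinset v) < k + #{a, b} := by
    intro v a b hva hvb hab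
    refine ⟨by simp [insert_subset_iff, hva, hvb], ?_⟩
    have := hG.degree_le v
    rw [card_pair hab]; omega
  obtain ⟨φ₁, hφ₁, hag₁⟩ := hψ.extend (T := A.filter fun x => x ∉ Q ∧ x ≠ p)
    (disjoint_left.2 fun x hx hx' => by grind) (by
      intro v hv
      rw [mem_filter] at hv
      have hwv := hmemA v hv.1 (by grind)
      rcases h.adj_iff.1 hwv with hv₁ | hv₁
      · have hvp' : G.Adj v p' := h.clique_left hv₁ hp'C (by grind)
        exact ⟨{w, p'}, (hpair hwv.symm hvp' hp'w.symm).1, (hpair hwv.symm hvp' hp'w.symm).2,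
          by grind⟩
      · have hvp' : G.Adj v r₂ := h.clique_right hv₁ hr₂C (by grind)
        exact ⟨{w, r₂}, (hpair hwv.symm hvp' hr₂w.symm).1, (hpair hwv.symm hvp' hr₂w.symm).2,
          by grind⟩)
  have hmemB₁ : ∀ x, x ∈ B ∪ (A.filter fun x => x ∉ Q ∧ x ≠ p) ↔ x ∉ Q ∨ x = r := by
    intro x; have := @hQA x; grind
  set B₁ := B ∪ (A.filter fun x => x ∉ Q ∧ x ≠ p)
  obtain ⟨φ₂, hφ₂, hag₂⟩ := hφ₁.extend (T := Q.filter fun x => ¬ G.Adj p x ∧ x ≠ r)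
    (disjoint_left.2 fun x hx hx' => by grind) (by
      intro v hv
      rw [mem_filter] at hv
      have hvw := hQadj v hv.1 w hw (by rintro rfl; exact hv.2.1 hwp.symm)
      have hvp' := hQadj v hv.1 p' hp'.1 (by rintro rfl; exact hv.2.1 hpp')
      exact ⟨{w, p'}, (hpair hvw hvp' hp'w.symm).1, (hpair hvw hvp' hp'w.symm).2,
        by have := hwp.symm; grind⟩)
  have hmemB₂ : ∀ x, x ∈ B₁ ∪ (Q.filter fun x => ¬ G.Adj p x ∧ x ≠ r) ↔
      x ∉ Q ∨ ¬ G.Adj p x := by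
    intro x; grind
  set B₂ := B₁ ∪ (Q.filter fun x => ¬ G.Adj p x ∧ x ≠ r)
  have hφ₂pr : φ₂ r = φ₂ p := by
    rw [hag₂ r (by grind), hag₂ p (by grind), hag₁ r (by grind), hag₁ p (by grind), hψpr]
  obtain ⟨φ₃, hφ₃, hag₃⟩ := hφ₂.extend (T := Q.filter fun x => G.Adj p x ∧ x ≠ w)
    (disjoint_left.2 fun x hx hx' => by grind) (by
      intro v hv
      rw [mem_filter] at hv
      have hvw := hQadj v hv.1 w hw hv.2.2
      have hvr := hQadj v hv.1 r hr (by rintro rfl; exact hpr hv.2.1)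
      refine ⟨{w, p}, (hpair hvw hv.2.1.symm hwp.ne).1, (hpair hvw hv.2.1.symm hwp.ne).2, ?_⟩
      intro d hd
      rcases mem_insert.1 hd with rfl | hd
      · exact Or.inl (by have := hwp.symm; grind)
      · rw [mem_singleton.1 hd]
        exact Or.inr ⟨by grind, r, by grind, hvr, by simp [hrw, hrp], hφ₂pr⟩)
  have hmemB₃ : ∀ x, x ∈ B₂ ∪ (Q.filter fun x => G.Adj p x ∧ x ≠ w) ↔ x ≠ w := by
    intro x; have := hwp.symm; grind
  set B₃ := B₂ ∪ (Q.filter fun x => G.Adj p x ∧ x ≠ w)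
  obtain ⟨φ₄, hφ₄, -⟩ := hφ₃.extend (T := {w})
    (disjoint_left.2 fun x hx hx' => by grind) (by
      intro v hv
      rw [mem_singleton] at hv
      subst hv
      refine ⟨{p}, by simpa using hwp, by rw [card_singleton]; omega, ?_⟩
      intro d hd
      rw [mem_singleton] at hd
      subst hd
      refine Or.inr ⟨by grind, r, by grind, hQadj _ hw r hr hrw.symm, by simpa using hrp, ?_⟩
      rw [hag₃ r (by grind), hag₃ d (by grind), hφ₂pr])
  exact hG.not_properOn φ₄ (hφ₄.mono fun x _ => by grind)

/-- Two disjoint nonadjacent pairs with distinct common available colors lead to a coloring. -/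
lemma BadPair.false_of_two_common_colors (h : BadPair G Q w p y C₁ C₂) (hG : Critical G k)
    {φ : V → Fin k} (hφ : ProperOn G φ (univ \ insert w (G.neighborFinset w))) {r p' : V}
    (hr : r ∈ Q) (hpr : ¬ G.Adj p r) (hp' : p' ∈ Q) (hyp' : ¬ G.Adj y p') {c d : Fin k}
    (hcd : c ≠ d)
    (hcp : c ∈ avail G φ (insert w (G.neighborFinset w)) p)
    (hcr : c ∈ avail G φ (insert w (G.neighborFinset w)) r)
    (hdy : d ∈ avail G φ (insert w (G.neighborFinset w)) y)
    (hdp : d ∈ avail G φ (insert w (G.neighborFinset w)) p') : False := by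
  have hQA := h.subset_closedNeighborhood
  have hmemA : ∀ x, x ∈ insert w (G.neighborFinset w) → x ≠ w → G.Adj w x := by
    intro x hx hne
    rw [mem_insert, SimpleGraph.mem_neighborFinset] at hx
    exact hx.resolve_left hne
  have hwp : G.Adj w p := h.adj_iff.2 (Or.inl h.left_mem)
  have hwy : G.Adj w y := h.adj_iff.2 (Or.inr h.right_mem)
  have hpA : p ∈ insert w (G.neighborFinset w) := by simp [hwp]
  have hyA : y ∈ insert w (G.neighborFinset w) := by simp [hwy]
  set A := insert w (G.neighborFinset w)
  have hw := h.mem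
  have hpQ := h.left_notMem
  have hyQ := h.right_notMem
  have hpy := h.ne
  have hQadj : ∀ u ∈ Q, ∀ v ∈ Q, u ≠ v → G.Adj u v := fun u hu v hv => h.maxClique.1 hu hv
  have hrw : r ≠ w := by rintro rfl; exact hpr hwp.symm
  have hp'w : p' ≠ w := by rintro rfl; exact hyp' hwy.symm
  obtain ⟨p₂, hp₂, hp₂p'⟩ := exists_mem_ne (by have := h.symm.two_le_card hG; omega) p'
    (s := Q.filter fun v => ¬ G.Adj y v)
  obtain ⟨r₂, hr₂, hr₂r⟩ := exists_mem_ne (by have := h.two_le_card hG; omega) r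
    (s := Q.filter fun v => ¬ G.Adj p v)
  rw [mem_filter] at hp₂ hr₂
  have hpp' := h.adj_of_not_adj hp' hyp'
  have hpp₂ := h.adj_of_not_adj hp₂.1 hp₂.2
  have hyr := h.symm.adj_of_not_adj hr hpr
  have hyr₂ := h.symm.adj_of_not_adj hr₂.1 hr₂.2
  have hp₂C := h.mem_left_of_not_adj hp₂.1 hp₂.2
  have hr₂C := h.symm.mem_left_of_not_adj hr₂.1 hr₂.2
  have hp₂w : p₂ ≠ w := by rintro rfl; exact hp₂.2 hwy.symm
  have hr₂w : r₂ ≠ w := by rintro rfl; exact hr₂.2 hwp.symm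
  have hp'r : p' ≠ r := by rintro rfl; exact hpr hpp'
  have hp₂r : p₂ ≠ r := by rintro rfl; exact hpr hpp₂
  have hr₂p' : r₂ ≠ p' := by rintro rfl; exact hyp' hyr₂
  have hrp : r ≠ p := by rintro rfl; exact hpQ hr
  have hry : r ≠ y := by rintro rfl; exact hyQ hr
  have hp'p : p' ≠ p := by rintro rfl; exact hpQ hp'
  have hp'y : p' ≠ y := by rintro rfl; exact hyQ hp'
  obtain ⟨ψ, hψ, hψpr, hψyp⟩ : ∃ ψ : V → Fin k,
      ProperOn G ψ (insert y (insert p' (insert p (insert r (univ \ A))))) ∧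
      ψ r = ψ p ∧ ψ p' = ψ y := by
    refine ⟨Function.update
      (Function.update (Function.update (Function.update φ r c) p c) p' d) y d, ?_, ?_, ?_⟩
    · refine (((hφ.update fun u hu hru => mem_avail.1 hcr u hru (by simpa using hu)).update
        ?_).update ?_).update ?_
      · intro u hu hpu
        have hur : u ≠ r := by rintro rfl; exact hpr hpu
        rw [Function.update_of_ne hur]
        exact mem_avail.1 hcp u hpu (by simpa [hur] using hu)
      · intro u hu hpu
        by_cases hup : u = p
        · rw [hup, Function.update_self]; exact hcd
        rw [Function.update_of_ne hup]
        by_cases hur : u = r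
        · rw [hur, Function.update_self]; exact hcd
        rw [Function.update_of_ne hur]
        exact mem_avail.1 hdp u hpu (by simpa [hur, hup] using hu)
      · intro u hu hyu
        have hup' : u ≠ p' := by rintro rfl; exact hyp' hyu
        rw [Function.update_of_ne hup']
        by_cases hup : u = p
        · rw [hup, Function.update_self]; exact hcd
        rw [Function.update_of_ne hup]
        by_cases hur : u = r
        · rw [hur, Function.update_self]; exact hcd
        rw [Function.update_of_ne hur]
        exact mem_avail.1 hdy u hyu (by simpa [hur, hup, hup'] using hu)
    · rw [Function.update_of_ne hry, Function.update_of_ne hp'r.symm, Function.update_of_ne hrp,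
        Function.update_self, Function.update_of_ne hpy, Function.update_of_ne hp'p.symm,
        Function.update_self]
    · rw [Function.update_of_ne hp'y, Function.update_self, Function.update_self]
  have hmemB : ∀ x, x ∈ insert y (insert p' (insert p (insert r (univ \ A)))) ↔
      x = y ∨ x = p' ∨ x = p ∨ x = r ∨ x ∉ A := by
    simp
  set B := insert y (insert p' (insert p (insert r (univ \ A))))
  have hpair : ∀ {v a b : V}, G.Adj v a → G.Adj v b → a ≠ b →
      ({a, b} : Finset V) ⊆ G.neighborFinset v ∧ #(G.neighborFinset v) < k + #{a, b} := by
    intro v a b hva hvb hab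
    refine ⟨by simp [insert_subset_iff, hva, hvb], ?_⟩
    have := hG.degree_le v
    rw [card_pair hab]; omega
  obtain ⟨φ₁, hφ₁, hag₁⟩ := hψ.extend (T := A.filter fun x => x ∉ Q ∧ x ≠ p ∧ x ≠ y)
    (disjoint_left.2 fun x hx hx' => by grind) (by
      intro v hv
      rw [mem_filter] at hv
      have hwv := hmemA v hv.1 (by grind)
      rcases h.adj_iff.1 hwv with hv₁ | hv₁
      · have hvp₂ : G.Adj v p₂ := h.clique_left hv₁ hp₂C (by grind)
        exact ⟨{w, p₂}, (hpair hwv.symm hvp₂ hp₂w.symm).1, (hpair hwv.symm hvp₂ hp₂w.symm).2,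
          by grind⟩
      · have hvr₂ : G.Adj v r₂ := h.clique_right hv₁ hr₂C (by grind)
        exact ⟨{w, r₂}, (hpair hwv.symm hvr₂ hr₂w.symm).1, (hpair hwv.symm hvr₂ hr₂w.symm).2,
          by grind⟩)
  have hmemB₁ : ∀ x, x ∈ B ∪ (A.filter fun x => x ∉ Q ∧ x ≠ p ∧ x ≠ y) ↔
      x ∉ Q ∨ x = r ∨ x = p' := by
    intro x; have := @hQA x; grind
  set B₁ := B ∪ (A.filter fun x => x ∉ Q ∧ x ≠ p ∧ x ≠ y)
  have hφ₁pr : φ₁ r = φ₁ p := by rw [hag₁ r (by grind), hag₁ p (by grind), hψpr]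
  have hφ₁yp : φ₁ p' = φ₁ y := by rw [hag₁ p' (by grind), hag₁ y (by grind), hψyp]
  obtain ⟨φ₂, hφ₂, hag₂⟩ := hφ₁.extend (T := Q.filter fun x => x ≠ w ∧ x ≠ r ∧ x ≠ p')
    (disjoint_left.2 fun x hx hx' => by grind) (by
      intro v hv
      rw [mem_filter] at hv
      have hvw := hQadj v hv.1 w hw hv.2.1
      by_cases hpv : G.Adj p v
      · have hvr := hQadj v hv.1 r hr hv.2.2.1
        refine ⟨{w, p}, (hpair hvw hpv.symm hwp.ne).1, (hpair hvw hpv.symm hwp.ne).2, ?_⟩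
        intro d hd
        rcases mem_insert.1 hd with rfl | hd
        · exact Or.inl (by grind)
        · rw [mem_singleton.1 hd]
          exact Or.inr ⟨by grind, r, by grind, hvr, by simp [hrw, hrp], hφ₁pr⟩
      · have hyv := h.symm.adj_of_not_adj hv.1 hpv
        have hvp' := hQadj v hv.1 p' hp' hv.2.2.2
        refine ⟨{w, y}, (hpair hvw hyv.symm hwy.ne).1, (hpair hvw hyv.symm hwy.ne).2, ?_⟩
        intro d hd
        rcases mem_insert.1 hd with rfl | hd
        · exact Or.inl (by grind)
        · rw [mem_singleton.1 hd]
          exact Or.inr ⟨by grind, p', by grind, hvp', by simp [hp'w, hp'y], hφ₁yp⟩)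
  have hmemB₂ : ∀ x, x ∈ B₁ ∪ (Q.filter fun x => x ≠ w ∧ x ≠ r ∧ x ≠ p') ↔ x ≠ w := by
    intro x; grind
  set B₂ := B₁ ∪ (Q.filter fun x => x ≠ w ∧ x ≠ r ∧ x ≠ p')
  obtain ⟨φ₃, hφ₃, -⟩ := hφ₂.extend (T := {w})
    (disjoint_left.2 fun x hx hx' => by grind) (by
      intro v hv
      rw [mem_singleton] at hv
      subst hv
      refine ⟨{p, y}, (hpair hwp hwy hpy).1, (hpair hwp hwy hpy).2, ?_⟩
      intro d hd
      rcases mem_insert.1 hd with rfl | hd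
      · refine Or.inr ⟨by grind, r, by grind, hQadj _ hw r hr hrw.symm, by simp [hrp, hry], ?_⟩
        rw [hag₂ r (by grind), hag₂ d (by grind), hφ₁pr]
      · rw [mem_singleton] at hd
        subst hd
        refine Or.inr ⟨by grind, p', by grind, hQadj _ hw p' hp' hp'w.symm,
          by simp [hp'p, hp'y], ?_⟩
        rw [hag₂ p' (by grind), hag₂ d (by grind), hφ₁yp])
  exact hG.not_properOn φ₃ (hφ₃.mono fun x _ => by grind)

lemma BadPair.false (h : BadPair G Q w p y C₁ C₂) (hG : Critical G k) : False := by
  obtain ⟨φ, hφ⟩ := hG.exists_properOn (univ \ insert w (G.neighborFinset w)) (fun hA => by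
    have : w ∈ univ \ insert w (G.neighborFinset w) := by rw [hA]; exact mem_univ w
    simp at this)
  have hR := h.two_le_card hG
  have hP := h.symm.two_le_card hG
  have hPR := h.card_add_card_lt
  obtain ⟨r, hr⟩ : (Q.filter fun v => ¬ G.Adj p v).Nonempty := card_pos.1 (by omega)
  obtain ⟨p', hp'⟩ : (Q.filter fun v => ¬ G.Adj y v).Nonempty := card_pos.1 (by omega)
  rw [mem_filter] at hr hp'
  have h₁ := h.le_card_inter_avail φ hr.1 hr.2
  have h₂ := h.symm.le_card_inter_avail φ hp'.1 hp'.2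
  have hdeg := fun v => And.intro (hG.degree_le v) (hG.degree_le_of_maxClique h.maxClique v)
  have dw := hdeg w
  have dp := hdeg p
  have dy := hdeg y
  have dr := hdeg r
  have dp' := hdeg p'
  have h8 := hG.eight_le
  have hw := hG.le_degree w
  by_cases hwk : #(G.neighborFinset w) ≤ k
  · rcases Nat.eq_zero_or_pos
      #(avail G φ (insert w (G.neighborFinset w)) p ∩ avail G φ (insert w (G.neighborFinset w)) r)
      with h0 | hpos
    · obtain ⟨c, hc⟩ : (avail G φ (insert w (G.neighborFinset w)) y ∩
        avail G φ (insert w (G.neighborFinset w)) p').Nonempty := card_pos.1 (by omega)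
      rw [mem_inter] at hc
      exact h.symm.false_of_common_color hG hwk hφ hp'.1 hp'.2 hc.1 hc.2
    · obtain ⟨c, hc⟩ := card_pos.1 hpos
      rw [mem_inter] at hc
      exact h.false_of_common_color hG hwk hφ hr.1 hr.2 hc.1 hc.2
  · obtain ⟨c, hc, d, hd, hcd⟩ : ∃ c ∈ avail G φ (insert w (G.neighborFinset w)) p ∩
        avail G φ (insert w (G.neighborFinset w)) r,
        ∃ d ∈ avail G φ (insert w (G.neighborFinset w)) y ∩
        avail G φ (insert w (G.neighborFinset w)) p', c ≠ d := by
      by_cases hone : #(avail G φ (insert w (G.neighborFinset w)) p ∩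
          avail G φ (insert w (G.neighborFinset w)) r) ≤ 1
      · obtain ⟨c, hc⟩ : (avail G φ (insert w (G.neighborFinset w)) p ∩
          avail G φ (insert w (G.neighborFinset w)) r).Nonempty := card_pos.1 (by omega)
        obtain ⟨d, hd, hne⟩ := exists_mem_ne (s := avail G φ (insert w (G.neighborFinset w)) y ∩
          avail G φ (insert w (G.neighborFinset w)) p') (by omega) c
        exact ⟨c, hc, d, hd, hne.symm⟩
      · obtain ⟨d, hd⟩ : (avail G φ (insert w (G.neighborFinset w)) y ∩
          avail G φ (insert w (G.neighborFinset w)) p').Nonempty := card_pos.1 (by omega)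
        obtain ⟨c, hc, hne⟩ := exists_mem_ne (not_le.1 hone) d
        exact ⟨c, hc, d, hd, hne⟩
    rw [mem_inter] at hc hd
    exact h.false_of_two_common_colors hG hφ hr.1 hr.2 hp'.1 hp'.2 hcd hc.1 hc.2 hd.1 hd.2

end NonadjacentOuterNeighbors

/-- The neighbors outside a maximum clique of one of its vertices form a clique. -/
lemma Critical.adj_of_adj_of_notMem (hG : Critical G k) {Q : Finset V} (hQ : MaxClique G Q)
    {w x y : V} (hw : w ∈ Q) (hx : x ∉ Q) (hy : y ∉ Q) (hwx : G.Adj w x) (hwy : G.Adj w y)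
    (hxy : x ≠ y) : G.Adj x y := by
  by_contra hadj
  obtain ⟨C₁, C₂, h₁, h₂, hN⟩ := hG.exists_cliques w
  have key : ∀ v, G.Adj w v → v ∈ C₁ ∨ v ∈ C₂ := fun v hv => by
    rw [← mem_union, ← hN, SimpleGraph.mem_neighborFinset]; exact hv
  rcases key x hwx with hx₁ | hx₂
  · have hy₂ := (key y hwy).resolve_left fun hy₁ => hadj (h₁ hx₁ hy₁ hxy)
    exact BadPair.false ⟨hQ, hw, hx, hy, hxy, hadj, h₁, h₂, hN, hx₁, hy₂⟩ hG
  · have hy₁ := (key y hwy).resolve_right fun hy₂ => hadj (h₂ hx₂ hy₂ hxy)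
    exact BadPair.false ⟨hQ, hw, hx, hy, hxy, hadj, h₂, h₁, by rw [hN, union_comm], hx₂, hy₁⟩ hG

section Kempe

/-- In a graph of maximum degree at most two, a component has at most two ends. -/
lemma false_of_three_ends {H : SimpleGraph V} (hH : ∀ v, #(H.neighborFinset v) ≤ 2) {a b c : V}
    (hab : a ≠ b) (hac : a ≠ c) (hbc : b ≠ c) (ha : #(H.neighborFinset a) ≤ 1)
    (hb : #(H.neighborFinset b) ≤ 1) (hc : #(H.neighborFinset c) ≤ 1)
    (hrb : H.Reachable a b) (hrc : H.Reachable a c) : False := by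
  set C := H.connectedComponentMk a with hC
  have hbC : b ∈ C := SimpleGraph.ConnectedComponent.sound hrb.symm
  have hcC : c ∈ C := SimpleGraph.ConnectedComponent.sound hrc.symm
  have haC : a ∈ C := rfl
  have h₁ := C.connected_toSimpleGraph.card_vert_le_card_edgeSet_add_one
  have h₂ := C.toSimpleGraph.sum_degrees_eq_twice_card_edges
  have hle : ∀ v : C, C.toSimpleGraph.degree v ≤ #(H.neighborFinset v) := by
    intro v
    rw [← SimpleGraph.card_neighborFinset_eq_degree]
    refine card_le_card_of_injOn Subtype.val (fun u hu => ?_) Subtype.val_injective.injOn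
    have hu' : C.toSimpleGraph.Adj v u := by simpa using hu
    simpa using (SimpleGraph.ConnectedComponent.toSimpleGraph_adj C v.2 u.2).1 hu'
  set E : Finset C := {⟨a, haC⟩, ⟨b, hbC⟩, ⟨c, hcC⟩}
  have hE : #E = 3 := card_eq_three.2 ⟨_, _, _, by simpa using hab, by simpa using hac,
    by simpa using hbc, rfl⟩
  have h₃ : ∑ v : C, (C.toSimpleGraph.degree v + if v ∈ E then 1 else 0) ≤ ∑ _v : C, 2 := by
    refine sum_le_sum fun v _ => ?_
    have := hle v
    have := hH v
    split_ifs with hv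
    · simp only [E, mem_insert, mem_singleton] at hv
      rcases hv with rfl | rfl | rfl <;> dsimp only at * <;> omega
    · omega
  rw [sum_add_distrib, h₂, sum_const, card_univ, sum_ite_mem, univ_inter, sum_const, hE] at h₃
  rw [Nat.card_eq_fintype_card, Nat.card_eq_fintype_card, ← SimpleGraph.edgeFinset_card] at h₁
  simp only [smul_eq_mul] at h₃
  omega

/-- The subgraph off `Q` spanned by the colors `α` and `β`. -/
def kempeGraph (G : SimpleGraph V) (Q : Finset V) (φ : V → Fin k) (α β : Fin k) :
    SimpleGraph V where
  Adj x y := G.Adj x y ∧ x ∉ Q ∧ y ∉ Q ∧ (φ x = α ∨ φ x = β) ∧ (φ y = α ∨ φ y = β)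
  symm := ⟨fun _ _ h => ⟨h.1.symm, h.2.2.1, h.2.1, h.2.2.2.2, h.2.2.2.1⟩⟩
  loopless := ⟨fun _ h => G.irrefl h.1⟩

/-- Exchange the colors `α` and `β` on the component of `p` in the Kempe graph. -/
noncomputable def kempeSwap (G : SimpleGraph V) (Q : Finset V) (φ : V → Fin k) (α β : Fin k)
    (p x : V) : Fin k :=
  if (kempeGraph G Q φ α β).Reachable p x then Equiv.swap α β (φ x) else φ x

variable {Q : Finset V} {φ : V → Fin k} {α β : Fin k}

lemma ProperOn.kempeSwap (h : ProperOn G φ (univ \ Q)) (α β : Fin k) (p : V) :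
    ProperOn G (kempeSwap G Q φ α β p) (univ \ Q) := by
  have key : ∀ x ∈ univ \ Q, ∀ y ∈ univ \ Q, G.Adj x y →
      (kempeGraph G Q φ α β).Reachable p x → ¬ (kempeGraph G Q φ α β).Reachable p y →
      Equiv.swap α β (φ x) ≠ φ y := by
    intro x hx y hy hxy hpx hpy heq
    have hne := h x hx y hy hxy
    have hx' : φ x = α ∨ φ x = β := by
      by_contra hcon
      push Not at hcon
      rw [Equiv.swap_apply_of_ne_of_ne hcon.1 hcon.2] at heq
      exact hne heq
    have hy' : φ y = α ∨ φ y = β := by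
      rw [← heq]
      rcases hx' with hx' | hx' <;> rw [hx'] <;> simp
    have hadj : (kempeGraph G Q φ α β).Adj x y :=
      ⟨hxy, by simpa using hx, by simpa using hy, hx', hy'⟩
    exact hpy (hpx.trans hadj.reachable)
  intro x hx y hy hxy
  unfold QuasiLineColoring.kempeSwap
  split_ifs with h₁ h₂ h₂
  · exact (Equiv.swap α β).injective.ne (h x hx y hy hxy)
  · exact key x hx y hy hxy h₁ h₂
  · exact (key y hy x hx hxy.symm h₂ h₁).symm
  · exact h x hx y hy hxy

lemma kempeSwap_eq_iff {δ : Fin k} (hα : δ ≠ α) (hβ : δ ≠ β) (p x : V) :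
    kempeSwap G Q φ α β p x = δ ↔ φ x = δ := by
  unfold kempeSwap
  split_ifs
  · rw [← Equiv.eq_symm_apply, Equiv.symm_swap, Equiv.swap_apply_of_ne_of_ne hα hβ]
  · rfl

lemma ProperOn.eq_of_kempeGraph_adj (hφ : ProperOn G φ (univ \ Q)) {v a : V}
    (ha : (kempeGraph G Q φ α β).Adj v a) (hv : φ v = α) : φ a = β := by
  obtain ⟨h₁, h₂, h₃, -, h₄⟩ := ha
  have := hφ v (by simpa using h₂) a (by simpa using h₃) h₁
  grind

lemma Critical.card_kempeGraph_neighborFinset_le (hG : Critical G k)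
    (hφ : ProperOn G φ (univ \ Q)) (α β : Fin k) (v : V) :
    #((kempeGraph G Q φ α β).neighborFinset v) ≤ 2 := by
  by_contra! hlt
  obtain ⟨a, b, c, ha, hb, hc, hab, hac, hbc⟩ := two_lt_card_iff.1 hlt
  rw [SimpleGraph.mem_neighborFinset] at ha hb hc
  have hcol : ∀ x y, (kempeGraph G Q φ α β).Adj v x → (kempeGraph G Q φ α β).Adj v y →
      ¬ G.Adj x y := by
    intro x y hx hy hxy
    have h₁ := hφ v (by simpa using hx.2.1) x (by simpa using hx.2.2.1) hx.1
    have h₂ := hφ v (by simpa using hy.2.1) y (by simpa using hy.2.2.1) hy.1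
    have h₃ := hφ x (by simpa using hx.2.2.1) y (by simpa using hy.2.2.1) hxy
    have h₄ := hx.2.2.2
    have h₅ := hy.2.2.2
    grind
  rcases hG.claw_free ha.1 hb.1 hc.1 hab hac hbc with h | h | h
  · exact hcol a b ha hb h
  · exact hcol a c ha hc h
  · exact hcol b c hb hc h

lemma Critical.card_kempeGraph_neighborFinset_le_one (hG : Critical G k)
    (hφ : ProperOn G φ (univ \ Q)) {p w : V} (hw : w ∈ Q) (hwp : G.Adj w p) (hp : φ p = α)
    (hβ : β ∈ avail G φ Q w) : #((kempeGraph G Q φ α β).neighborFinset p) ≤ 1 := by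
  refine card_le_one.2 fun a ha b hb => ?_
  by_contra hab
  rw [SimpleGraph.mem_neighborFinset] at ha hb
  have hna : ∀ x, (kempeGraph G Q φ α β).Adj p x → w ≠ x ∧ ¬ G.Adj w x := fun x hx =>
    ⟨by rintro rfl; exact hx.2.2.1 hw,
      fun h => mem_avail.1 hβ x h hx.2.2.1 (hφ.eq_of_kempeGraph_adj hx hp)⟩
  rcases hG.claw_free hwp.symm ha.1 hb.1 (hna a ha).1 (hna b hb).1 hab with h | h | h
  · exact (hna a ha).2 h
  · exact (hna b hb).2 h
  · exact hφ a (by simpa using ha.2.2.1) b (by simpa using hb.2.2.1) h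
      ((hφ.eq_of_kempeGraph_adj ha hp).trans (hφ.eq_of_kempeGraph_adj hb hp).symm)

end Kempe

section Rigid

variable {Q : Finset V} {φ : V → Fin k}

/-- A coloring off the clique `Q` together with a Hall violator `S ⊆ Q` of nearly full size which
no exchange of a missing color `α` with a color `β` can destroy. -/
structure Rigid (G : SimpleGraph V) (Q : Finset V) (φ : V → Fin k) (S : Finset V) : Prop where
  properOn : ProperOn G φ (univ \ Q)
  subset : S ⊆ Q
  card_lt : #(S.biUnion (avail G φ Q)) < #S
  card_le : #Q ≤ #S + 1
  not_separable : ∀ α ∉ S.biUnion (avail G φ Q), ∀ β, ∀ w ∈ S, ∀ w' ∈ S, ∀ φ' : V → Fin k,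
    ProperOn G φ' (univ \ Q) →
    (∀ u ∈ Q, ∀ δ, δ ≠ α → δ ≠ β → (δ ∈ avail G φ' Q u ↔ δ ∈ avail G φ Q u)) →
    β ∈ avail G φ Q w → β ∈ avail G φ Q w' →
    α ∈ avail G φ' Q w → β ∈ avail G φ' Q w' → β ∈ avail G φ' Q w

lemma MaxClique.le_card_avail (hQ : MaxClique G Q) (φ : V → Fin k) {w : V} (hw : w ∈ Q) :
    k + #Q ≤ #(avail G φ Q w) + #(G.neighborFinset w) + 1 := by
  have h₁ := QuasiLineColoring.le_card_avail (G := G) φ Q w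
  have h₂ : Q.erase w ⊆ G.neighborFinset w ∩ Q := fun x hx => by
    rw [mem_erase] at hx
    rw [mem_inter, SimpleGraph.mem_neighborFinset]
    exact ⟨hQ.1 hw hx.2 hx.1.symm, hx.2⟩
  have h₃ := card_le_card h₂
  rw [card_erase_of_mem hw] at h₃
  have := card_pos.2 ⟨w, hw⟩
  omega

lemma Critical.card_le_card_avail_add_two (hG : Critical G k) (hQ : MaxClique G Q)
    (φ : V → Fin k) {w : V} (hw : w ∈ Q) : #Q ≤ #(avail G φ Q w) + 2 := by
  have := hQ.le_card_avail φ hw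
  have := hG.degree_le w
  omega

lemma Critical.exists_large_hall_violator (hG : Critical G k) (hQ : MaxClique G Q)
    (hφ : ProperOn G φ (univ \ Q)) :
    ∃ S ⊆ Q, #(S.biUnion (avail G φ Q)) < #S ∧ #Q ≤ #S + 1 := by
  obtain ⟨S, hSQ, hS⟩ := hG.exists_hall_violator hφ
  obtain ⟨v, hv⟩ : S.Nonempty := card_pos.1 (by omega)
  have h₁ := card_le_card (subset_biUnion_of_mem (avail G φ Q) hv)
  have h₂ := hG.card_le_card_avail_add_two hQ φ (hSQ hv)
  exact ⟨S, hSQ, hS, by omega⟩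

/-- When `Q` itself is not a Hall violator, the lists agree on all but one vertex of `Q`. -/
lemma Critical.exists_constant_lists (hG : Critical G k) (hQ : MaxClique G Q)
    (hφ : ProperOn G φ (univ \ Q)) (hU : #Q ≤ #(Q.biUnion (avail G φ Q))) :
    ∃ S ⊆ Q, #S + 1 = #Q ∧ #(S.biUnion (avail G φ Q)) < #S ∧
      ∀ v ∈ S, avail G φ Q v = S.biUnion (avail G φ Q) := by
  obtain ⟨S, hSQ, hS, hcard⟩ := hG.exists_large_hall_violator hQ hφ
  have hne : S ≠ Q := by rintro rfl; omega
  have hlt := card_lt_card (hSQ.ssubset_of_ne hne)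
  refine ⟨S, hSQ, by omega, hS, fun v hv => ?_⟩
  refine eq_of_subset_of_card_le (subset_biUnion_of_mem (avail G φ Q) hv) ?_
  have := hG.card_le_card_avail_add_two hQ φ (hSQ hv)
  omega

lemma Critical.exists_rigid (hG : Critical G k) (hQ : MaxClique G Q) :
    ∃ (φ : V → Fin k) (S : Finset V), Rigid G Q φ S := by
  have hq := hG.five_le_card hQ
  obtain ⟨φ₀, hφ₀⟩ := hG.exists_properOn (univ \ Q) (fun h => by
    obtain ⟨v, hv⟩ : Q.Nonempty := card_pos.1 (by omega)
    have : v ∈ univ \ Q := by rw [h]; exact mem_univ v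
    simp [hv] at this)
  obtain ⟨φ, hφ, hmax⟩ := (univ.filter fun φ : V → Fin k =>
    ProperOn G φ (univ \ Q)).exists_max_image (fun φ => #(Q.biUnion (avail G φ Q)))
    ⟨φ₀, by simpa using hφ₀⟩
  rw [mem_filter] at hφ
  replace hφ := hφ.2
  replace hmax : ∀ φ' : V → Fin k, ProperOn G φ' (univ \ Q) →
      #(Q.biUnion (avail G φ' Q)) ≤ #(Q.biUnion (avail G φ Q)) :=
    fun φ' h => hmax φ' (by simpa using h)
  by_cases hU : #(Q.biUnion (avail G φ Q)) < #Q
  · refine ⟨φ, Q, hφ, subset_rfl, hU, by omega, ?_⟩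
    intro α hα β w hw w' hw' φ' hφ' hδ hβw hβw' hαw hβ'w'
    exfalso
    have hsub : insert α (Q.biUnion (avail G φ Q)) ⊆ Q.biUnion (avail G φ' Q) := by
      intro δ hδU
      rw [mem_biUnion]
      by_cases hδα : δ = α
      · exact ⟨w, hw, hδα ▸ hαw⟩
      by_cases hδβ : δ = β
      · exact ⟨w', hw', hδβ ▸ hβ'w'⟩
      obtain ⟨u, hu, hδu⟩ := mem_biUnion.1 (mem_of_mem_insert_of_ne hδU hδα)
      exact ⟨u, hu, (hδ u hu δ hδα hδβ).2 hδu⟩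
    have h₁ := card_le_card hsub
    rw [card_insert_of_notMem hα] at h₁
    have := hmax φ' hφ'
    omega
  · obtain ⟨S, hSQ, hcard, hSU, hconst⟩ := hG.exists_constant_lists hQ hφ (by omega)
    refine ⟨φ, S, hφ, hSQ, hSU, by omega, ?_⟩
    intro α hα β w hw w' hw' φ' hφ' hδ hβw hβw' hαw hβ'w'
    by_contra hβ'w
    have hsub : Q.biUnion (avail G φ Q) ⊆ Q.biUnion (avail G φ' Q) := by
      intro δ hδU
      rw [mem_biUnion]
      by_cases hδα : δ = α
      · exact ⟨w, hSQ hw, hδα ▸ hαw⟩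
      by_cases hδβ : δ = β
      · exact ⟨w', hSQ hw', hδβ ▸ hβ'w'⟩
      obtain ⟨u, hu, hδu⟩ := mem_biUnion.1 hδU
      exact ⟨u, hu, (hδ u hu δ hδα hδβ).2 hδu⟩
    have h₁ := card_le_card hsub
    obtain ⟨S', hS'Q, hcard', hSU', hconst'⟩ := hG.exists_constant_lists hQ hφ' (by omega)
    have hne : ¬ S' ⊆ S := by
      intro h
      have hSS := eq_of_subset_of_card_le h (by omega)
      subst hSS
      rw [hconst' w' hw', ← hconst' w hw] at hβ'w'
      exact hβ'w hβ'w'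
    obtain ⟨z, hzS', hzS⟩ := not_subset.1 hne
    obtain ⟨u, hu⟩ : (S ∩ S').Nonempty := card_pos.1 (by
      have h₁ := card_union_add_card_inter S S'
      have h₂ := card_le_card (union_subset hSQ hS'Q)
      omega)
    rw [mem_inter] at hu
    have hQz : Q = insert z S := (eq_of_subset_of_card_le
      (insert_subset (hS'Q hzS') hSQ) (by rw [card_insert_of_notMem hzS]; omega)).symm
    have h₂ : Q.biUnion (avail G φ Q) =
        (avail G φ Q z \ S.biUnion (avail G φ Q)) ∪ S.biUnion (avail G φ Q) := by
      conv_lhs => rw [hQz, biUnion_insert]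
      rw [← hQz, sdiff_union_self_eq_union]
    have h₃ := card_union_le (avail G φ Q z \ S.biUnion (avail G φ Q)) (S.biUnion (avail G φ Q))
    rw [← h₂] at h₃
    obtain ⟨δ, hδz, hδα⟩ := exists_mem_ne
      (s := avail G φ Q z \ S.biUnion (avail G φ Q)) (by omega) α
    rw [mem_sdiff] at hδz
    have hδβ : δ ≠ β := by
      rintro rfl
      exact hδz.2 (mem_biUnion.2 ⟨w, hw, hβw⟩)
    have h₄ := (hδ z (hS'Q hzS') δ hδα hδβ).2 hδz.1
    rw [hconst' z hzS', ← hconst' u hu.2] at h₄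
    exact hδz.2 (mem_biUnion.2 ⟨u, hu.1, (hδ u (hSQ hu.1) δ hδα hδβ).1 h₄⟩)

variable {S : Finset V} {α β : Fin k}

lemma Critical.eq_of_color_eq (hG : Critical G k) (hQ : MaxClique G Q)
    (hφ : ProperOn G φ (univ \ Q)) {w x y : V} (hw : w ∈ Q) (hx : x ∉ Q) (hy : y ∉ Q)
    (hwx : G.Adj w x) (hwy : G.Adj w y) (h : φ x = φ y) : x = y := by
  by_contra hne
  exact hφ x (by simpa using hx) y (by simpa using hy)
    (hG.adj_of_adj_of_notMem hQ hw hx hy hwx hwy hne) h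

/-- Vertices of the missing color `α` attached to `S` lie on a common Kempe chain. -/
lemma Rigid.reachable (h : Rigid G Q φ S) (hG : Critical G k) (hQ : MaxClique G Q)
    (hα : α ∉ S.biUnion (avail G φ Q)) {w w' p p' : V} (hw : w ∈ S) (hw' : w' ∈ S)
    (hβ : β ∈ avail G φ Q w) (hβ' : β ∈ avail G φ Q w') (hp : p ∉ Q) (hp' : p' ∉ Q)
    (hwp : G.Adj w p) (hwp' : G.Adj w' p') (hpα : φ p = α) (hpα' : φ p' = α) :
    (kempeGraph G Q φ α β).Reachable p p' := by
  by_contra hreach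
  have hβα : β ≠ α := by
    rintro rfl
    exact hα (mem_biUnion.2 ⟨w, hw, hβ⟩)
  have hswapp : kempeSwap G Q φ α β p p = β := by
    simp [kempeSwap, hpα]
  have hQw := h.subset hw
  have hQw' := h.subset hw'
  refine absurd (h.not_separable α hα β w hw w' hw' (kempeSwap G Q φ α β p)
    (h.properOn.kempeSwap α β p) ?_ hβ hβ' ?_ ?_) ?_
  · intro u _ δ hδα hδβ
    simp only [mem_avail, ne_eq, kempeSwap_eq_iff hδα hδβ]
  · rw [mem_avail]
    intro u hwu hu hc
    have huβ := mem_avail.1 hβ u hwu hu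
    by_cases huα : φ u = α
    · have hup := hG.eq_of_color_eq hQ h.properOn hQw hu hp hwu hwp (huα.trans hpα.symm)
      rw [hup, hswapp] at hc
      exact hβα hc
    · unfold kempeSwap at hc
      rw [Equiv.swap_apply_of_ne_of_ne huα huβ, ite_self] at hc
      exact huα hc
  · rw [mem_avail]
    intro u hwu hu hc
    have huβ := mem_avail.1 hβ' u hwu hu
    by_cases huα : φ u = α
    · have hup := hG.eq_of_color_eq hQ h.properOn hQw' hu hp' hwu hwp' (huα.trans hpα'.symm)
      rw [hup, kempeSwap, if_neg hreach, hpα'] at hc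
      exact hβα hc.symm
    · unfold kempeSwap at hc
      rw [Equiv.swap_apply_of_ne_of_ne huα huβ, ite_self] at hc
      exact huβ hc
  · rw [not_mem_avail]
    exact ⟨p, hwp, hp, hswapp⟩

lemma Rigid.false_of_three_centers (h : Rigid G Q φ S) (hG : Critical G k) (hQ : MaxClique G Q)
    (hα : α ∉ S.biUnion (avail G φ Q)) {w₁ w₂ w₃ p₁ p₂ p₃ : V} (hw₁ : w₁ ∈ S) (hw₂ : w₂ ∈ S)
    (hw₃ : w₃ ∈ S) (hp₁ : p₁ ∉ Q) (hp₂ : p₂ ∉ Q) (hp₃ : p₃ ∉ Q) (hadj₁ : G.Adj w₁ p₁)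
    (hadj₂ : G.Adj w₂ p₂) (hadj₃ : G.Adj w₃ p₃) (hα₁ : φ p₁ = α) (hα₂ : φ p₂ = α)
    (hα₃ : φ p₃ = α) (h₁₂ : p₁ ≠ p₂) (h₁₃ : p₁ ≠ p₃) (h₂₃ : p₂ ≠ p₃) : False := by
  have hL := fun v (hv : v ∈ S) => hG.card_le_card_avail_add_two hQ φ (h.subset hv)
  have hsub := fun v (hv : v ∈ S) => subset_biUnion_of_mem (avail G φ Q) hv
  obtain ⟨β, hβ⟩ : (avail G φ Q w₁ ∩ avail G φ Q w₂ ∩ avail G φ Q w₃).Nonempty := card_pos.1 (by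
    have i₁ := card_union_add_card_inter (avail G φ Q w₁) (avail G φ Q w₂)
    have i₂ := card_union_add_card_inter (avail G φ Q w₁ ∩ avail G φ Q w₂) (avail G φ Q w₃)
    have i₃ := card_le_card (union_subset (hsub w₁ hw₁) (hsub w₂ hw₂))
    have i₄ := card_le_card (union_subset (inter_subset_left.trans (hsub w₁ hw₁)
      : avail G φ Q w₁ ∩ avail G φ Q w₂ ⊆ _) (hsub w₃ hw₃))
    have := hL w₁ hw₁
    have := hL w₂ hw₂
    have := hL w₃ hw₃
    have := h.card_lt
    have := card_le_card h.subset
    have := hG.five_le_card hQ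
    omega)
  simp only [mem_inter] at hβ
  exact false_of_three_ends (hG.card_kempeGraph_neighborFinset_le h.properOn α β) h₁₂ h₁₃ h₂₃
    (hG.card_kempeGraph_neighborFinset_le_one h.properOn (h.subset hw₁) hadj₁ hα₁ hβ.1.1)
    (hG.card_kempeGraph_neighborFinset_le_one h.properOn (h.subset hw₂) hadj₂ hα₂ hβ.1.2)
    (hG.card_kempeGraph_neighborFinset_le_one h.properOn (h.subset hw₃) hadj₃ hα₃ hβ.2)
    (h.reachable hG hQ hα hw₁ hw₂ hβ.1.1 hβ.1.2 hp₁ hp₂ hadj₁ hadj₂ hα₁ hα₂)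
    (h.reachable hG hQ hα hw₁ hw₃ hβ.1.1 hβ.2 hp₁ hp₃ hadj₁ hadj₃ hα₁ hα₃)

/-- A vertex off `Q` of color `α` adjacent to some but not all vertices of `S`. -/
structure Center (G : SimpleGraph V) (Q : Finset V) (φ : V → Fin k) (S : Finset V) (α : Fin k)
    (p : V) : Prop where
  notMem : p ∉ Q
  color : φ p = α
  exists_adj : ∃ w ∈ S, G.Adj w p
  exists_not_adj : ∃ w ∈ S, ¬ G.Adj w p

lemma Rigid.exists_centers (h : Rigid G Q φ S) (hG : Critical G k) (hQ : MaxClique G Q)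
    (hα : α ∉ S.biUnion (avail G φ Q)) : ∃ p₁ p₂, Center G Q φ S α p₁ ∧ Center G Q φ S α p₂ ∧
      ∀ w ∈ S, G.Adj w p₁ ∨ G.Adj w p₂ := by
  have hcol : ∀ w ∈ S, ∃ p, G.Adj w p ∧ p ∉ Q ∧ φ p = α := fun w hw =>
    not_mem_avail.1 fun hw' => hα (mem_biUnion.2 ⟨w, hw, hw'⟩)
  have hmiss : ∀ p ∉ Q, ∃ w ∈ S, ¬ G.Adj w p := by
    intro p hp
    by_contra! hcon
    have h₁ : S ⊆ G.neighborFinset p ∩ Q := fun w hw => by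
      rw [mem_inter, SimpleGraph.mem_neighborFinset]
      exact ⟨(hcon w hw).symm, h.subset hw⟩
    have h₂ := card_le_card h₁
    have h₃ := hG.card_trace_add_two_le hQ hp
    have h₄ := h.card_le
    omega
  obtain ⟨w₁, hw₁⟩ : S.Nonempty := card_pos.1 (by have := h.card_lt; omega)
  obtain ⟨p₁, hwp₁, hp₁, hα₁⟩ := hcol w₁ hw₁
  obtain ⟨w₂, hw₂, hw₂p₁⟩ := hmiss p₁ hp₁
  obtain ⟨p₂, hwp₂, hp₂, hα₂⟩ := hcol w₂ hw₂
  refine ⟨p₁, p₂, ⟨hp₁, hα₁, ⟨w₁, hw₁, hwp₁⟩, hmiss p₁ hp₁⟩,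
    ⟨hp₂, hα₂, ⟨w₂, hw₂, hwp₂⟩, hmiss p₂ hp₂⟩, fun w hw => ?_⟩
  by_contra! hcon
  obtain ⟨p₃, hwp₃, hp₃, hα₃⟩ := hcol w hw
  exact h.false_of_three_centers hG hQ hα hw₁ hw₂ hw hp₁ hp₂ hp₃ hwp₁ hwp₂ hwp₃ hα₁ hα₂ hα₃
    (by rintro rfl; exact hw₂p₁ hwp₂) (by rintro rfl; exact hcon.1 hwp₃)
    (by rintro rfl; exact hcon.2 hwp₃)

variable {p : V}

lemma Critical.mem_avail_of_mem_avail (hG : Critical G k) (hQ : MaxClique G Q) {γ : Fin k}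
    (hγ : γ ∈ avail G φ Q p) (hγα : γ ≠ φ p) (hp : p ∉ Q) {w : V} (hw : w ∈ Q)
    (hwp : G.Adj w p) : γ ∈ avail G φ Q w := by
  rw [mem_avail]
  intro u hwu hu hc
  have hup : p ≠ u := by rintro rfl; exact hγα hc.symm
  exact mem_avail.1 hγ u (hG.adj_of_adj_of_notMem hQ hw hp hu hwp hwu hup) hu hc

lemma Rigid.not_mem_avail_of_not_adj (h : Rigid G Q φ S) (hG : Critical G k) (hQ : MaxClique G Q)
    (hα : α ∉ S.biUnion (avail G φ Q)) (hp : Center G Q φ S α p) {γ : Fin k}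
    (hγ : γ ∈ avail G φ Q p) (hγα : γ ≠ α) {w : V} (hw : w ∈ S) (hwp : ¬ G.Adj w p) :
    γ ∉ avail G φ Q w := by
  intro hγw
  obtain ⟨w₁, hw₁, hw₁p⟩ := hp.exists_adj
  have hγw₁ := hG.mem_avail_of_mem_avail hQ hγ (by rwa [hp.color]) hp.notMem (h.subset hw₁) hw₁p
  obtain ⟨p', hwp', hp', hα'⟩ := not_mem_avail.1 fun hw' => hα (mem_biUnion.2 ⟨w, hw, hw'⟩)
  have hreach := h.reachable hG hQ hα hw₁ hw hγw₁ hγw hp.notMem hp' hw₁p hwp' hp.color hα'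
  have hne : p ≠ p' := by rintro rfl; exact hwp hwp'
  obtain ⟨x, hx⟩ : ∃ x, (kempeGraph G Q φ α γ).Adj p x := by
    obtain ⟨W⟩ := hreach
    cases W with
    | nil => exact absurd rfl hne
    | cons hadj _ => exact ⟨_, hadj⟩
  exact mem_avail.1 hγ x hx.1 hx.2.2.1 (h.properOn.eq_of_kempeGraph_adj hx hp.color)

lemma Center.mem_avail (hp : Center G Q φ S α p) (hφ : ProperOn G φ (univ \ Q)) :
    α ∈ avail G φ Q p := by
  rw [QuasiLineColoring.mem_avail]
  intro u hpu hu
  have := hφ p (by simpa using hp.notMem) u (by simpa using hu) hpu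
  rw [hp.color] at this
  exact this.symm

lemma Rigid.card_avail_add_card_avail_le (h : Rigid G Q φ S) (hG : Critical G k)
    (hQ : MaxClique G Q) (hα : α ∉ S.biUnion (avail G φ Q)) (hp : Center G Q φ S α p) :
    ∃ w ∈ Q, #(avail G φ Q p) + #(avail G φ Q w) ≤ #(S.biUnion (avail G φ Q)) + 1 := by
  obtain ⟨w₁, hw₁, hw₁p⟩ := hp.exists_adj
  obtain ⟨w, hw, hwp⟩ := hp.exists_not_adj
  refine ⟨w, h.subset hw, ?_⟩
  have hdisj : Disjoint ((avail G φ Q p).erase α) (avail G φ Q w) := disjoint_left.2 fun γ hγ => by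
    rw [mem_erase] at hγ
    exact h.not_mem_avail_of_not_adj hG hQ hα hp hγ.2 hγ.1 hw hwp
  have hsub : (avail G φ Q p).erase α ∪ avail G φ Q w ⊆ S.biUnion (avail G φ Q) := by
    refine union_subset (fun γ hγ => ?_) (subset_biUnion_of_mem (avail G φ Q) hw)
    rw [mem_erase] at hγ
    exact mem_biUnion.2 ⟨w₁, hw₁, hG.mem_avail_of_mem_avail hQ hγ.2 (by rw [hp.color]; exact hγ.1)
      hp.notMem (h.subset hw₁) hw₁p⟩
  have h₁ := card_le_card hsub
  rw [card_union_of_disjoint hdisj, card_erase_of_mem (hp.mem_avail h.properOn)] at h₁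
  omega

/-- The neighbors of a center `p` whose colors are missing at all of `N(p) ∩ Q` extend
`N(p) ∩ Q` to a clique. -/
lemma Critical.card_trace_add_card_le (hG : Critical G k) (hQ : MaxClique G Q)
    (hφ : ProperOn G φ (univ \ Q)) (hp : Center G Q φ S α p)
    (hinj : Set.InjOn φ (G.neighborFinset p \ Q : Finset V)) (hSQ : S ⊆ Q) {C : Finset (Fin k)}
    (hC : ∀ γ ∈ C, ∀ w ∈ Q, G.Adj w p → γ ∉ avail G φ Q w) :
    #(G.neighborFinset p ∩ Q) + #C ≤ #Q := by
  obtain ⟨w₁, hw₁, hw₁p⟩ := hp.exists_adj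
  replace hw₁ := hSQ hw₁
  set Y := (G.neighborFinset p \ Q).filter fun y => φ y ∈ C with hY
  have hmemY : ∀ y, y ∈ Y ↔ G.Adj p y ∧ y ∉ Q ∧ φ y ∈ C := by
    intro y; simp [hY, and_assoc]
  have hwit : ∀ γ ∈ C, γ ≠ α → ∀ w ∈ Q, G.Adj w p →
      ∃ u, G.Adj w u ∧ G.Adj p u ∧ u ∉ Q ∧ φ u = γ := by
    intro γ hγ hγα w hw hwp
    obtain ⟨u, hwu, hu, hc⟩ := not_mem_avail.1 (hC γ hγ w hw hwp)
    have hup : p ≠ u := by rintro rfl; exact hγα (hc.symm.trans hp.color)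
    exact ⟨u, hwu, hG.adj_of_adj_of_notMem hQ hw hp.notMem hu hwp hwu hup, hu, hc⟩
  have hcard : #C ≤ #Y + 1 := by
    have h₁ : C.erase α ⊆ Y.image φ := fun γ hγ => by
      rw [mem_erase] at hγ
      obtain ⟨u, -, hpu, hu, hc⟩ := hwit γ hγ.2 hγ.1 w₁ hw₁ hw₁p
      exact mem_image.2 ⟨u, (hmemY u).2 ⟨hpu, hu, hc ▸ hγ.2⟩, hc⟩
    have h₂ := card_le_card h₁
    have h₃ : #(Y.image φ) ≤ #Y := card_image_le
    have h₄ := pred_card_le_card_erase (a := α) (s := C)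
    omega
  have hYT : ∀ y ∈ Y, ∀ w ∈ Q, G.Adj w p → G.Adj w y := by
    intro y hy w hw hwp
    rw [hmemY] at hy
    have hyα : φ y ≠ α := by
      have := hφ p (by simpa using hp.notMem) y (by simpa using hy.2.1) hy.1
      rw [hp.color] at this
      exact this.symm
    obtain ⟨u, hwu, hpu, hu, hc⟩ := hwit (φ y) hy.2.2 hyα w hw hwp
    have : u = y := hinj (by simp [hpu, hu]) (by simp [hy.1, hy.2.1]) hc
    exact this ▸ hwu
  have hclique : G.IsClique ((insert p (Y ∪ (G.neighborFinset p ∩ Q)) : Finset V) : Set V) := by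
    rw [coe_insert]
    refine SimpleGraph.IsClique.insert ?_ fun b hb _ => ?_
    · intro x hx y hy hxy
      simp only [mem_coe, mem_union, mem_inter, SimpleGraph.mem_neighborFinset] at hx hy
      rcases hx with hx | hx <;> rcases hy with hy | hy
      · exact hG.adj_of_adj_of_notMem hQ hw₁ ((hmemY x).1 hx).2.1 ((hmemY y).1 hy).2.1
          (hYT x hx w₁ hw₁ hw₁p) (hYT y hy w₁ hw₁ hw₁p) hxy
      · exact (hYT x hx y hy.2 hy.1.symm).symm
      · exact hYT y hy x hx.2 hx.1.symm
      · exact hQ.1 hx.2 hy.2 hxy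
    · simp only [mem_coe, mem_union, mem_inter, SimpleGraph.mem_neighborFinset] at hb
      rcases hb with hb | hb
      · exact ((hmemY b).1 hb).1
      · exact hb.1
  have h₁ := hQ.2 _ hclique
  rw [card_insert_of_notMem (by simp [hmemY]), card_union_of_disjoint
    (disjoint_left.2 fun y hy hy' => ((hmemY y).1 hy).2.1 (mem_inter.1 hy').2)] at h₁
  omega

lemma Critical.false (hG : Critical G k) : False := by
  obtain ⟨Q, hQ⟩ := exists_maxClique G
  obtain ⟨φ, S, h⟩ := hG.exists_rigid hQ
  have hq := hG.five_le_card hQ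
  have hkq := hG.card_clique_le Q hQ.1
  have h8 := hG.eight_le
  have hU := h.card_lt
  have hSle := h.card_le
  have hSQ := card_le_card h.subset
  obtain ⟨α, -, hα⟩ := exists_mem_notMem_of_card_lt_card
    (s := S.biUnion (avail G φ Q)) (t := univ) (by rw [card_univ, Fintype.card_fin]; omega)
  obtain ⟨p₁, p₂, hp₁, hp₂, hcover⟩ := h.exists_centers hG hQ hα
  have hsub : S ⊆ (G.neighborFinset p₁ ∩ Q) ∪ (G.neighborFinset p₂ ∩ Q) := fun w hw => by
    simp only [mem_union, mem_inter, SimpleGraph.mem_neighborFinset]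
    have := h.subset hw
    rcases hcover w hw with h | h
    · exact Or.inl ⟨h.symm, this⟩
    · exact Or.inr ⟨h.symm, this⟩
  have hcard := card_le_card hsub
  have hunion := card_union_add_card_inter (G.neighborFinset p₁ ∩ Q) (G.neighborFinset p₂ ∩ Q)
  have hdeg := fun v => And.intro (hG.degree_le v) (hG.degree_le_of_maxClique hQ v)
  obtain ⟨w₁, hw₁, hle₁⟩ := h.card_avail_add_card_avail_le hG hQ hα hp₁
  obtain ⟨w₂, hw₂, hle₂⟩ := h.card_avail_add_card_avail_le hG hQ hα hp₂
  have hL₁ := hQ.le_card_avail φ hw₁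
  have hL₂ := hQ.le_card_avail φ hw₂
  have ht₁ := le_card_avail (G := G) φ Q p₁
  have ht₂ := le_card_avail (G := G) φ Q p₂
  have hd₁ := hdeg w₁
  have hd₂ := hdeg w₂
  have hdp₁ := hdeg p₁
  have hdp₂ := hdeg p₂
  have hQ6 : #Q = 6 := by omega
  have hS6 : #S = #Q := by omega
  have hSeq : S = Q := eq_of_subset_of_card_le h.subset (by omega)
  subst hSeq
  have hinter : G.neighborFinset p₁ ∩ S ∩ (G.neighborFinset p₂ ∩ S) = ∅ :=
    card_eq_zero.1 (by omega)
  have hinj : Set.InjOn φ (G.neighborFinset p₁ \ S : Finset V) := by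
    refine card_image_iff.1 (le_antisymm card_image_le ?_)
    have h₁ := card_avail (G := G) φ S p₁
    have h₂ := card_sdiff_add_card_inter (G.neighborFinset p₁) S
    omega
  obtain ⟨γ, hγ, hγα⟩ := exists_mem_ne (s := avail G φ S p₂) (by omega) α
  have hγU : γ ∈ S.biUnion (avail G φ S) := by
    obtain ⟨w, hw, hwp⟩ := hp₂.exists_adj
    exact mem_biUnion.2 ⟨w, hw, hG.mem_avail_of_mem_avail hQ hγ (by rwa [hp₂.color]) hp₂.notMem
      hw hwp⟩
  have hfin := hG.card_trace_add_card_le hQ h.properOn hp₁ hinj subset_rfl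
    (C := insert γ (univ \ S.biUnion (avail G φ S))) (by
      intro δ hδ w hw hwp
      rcases mem_insert.1 hδ with rfl | hδ
      · refine h.not_mem_avail_of_not_adj hG hQ hα hp₂ hγ hγα hw fun hwp₂ => ?_
        have : w ∈ G.neighborFinset p₁ ∩ S ∩ (G.neighborFinset p₂ ∩ S) := by
          simp [hw, hwp.symm, hwp₂.symm]
        rw [hinter] at this
        exact absurd this (notMem_empty w)
      · exact fun hδw => (mem_sdiff.1 hδ).2 (mem_biUnion.2 ⟨w, hw, hδw⟩))
  rw [card_insert_of_notMem (by simpa using hγU), card_sdiff_of_subset (subset_univ _), card_univ,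
    Fintype.card_fin] at hfin
  omega

end Rigid

lemma card_neighborFinset_comap_le_deg (G : SimpleGraph V) (W : Finset V) (v : W) :
    #((G.comap (Subtype.val : W → V)).neighborFinset v) ≤ deg G v := by
  have h : ((G.comap (Subtype.val : W → V)).neighborFinset v).map (Function.Embedding.subtype _) ⊆
      G.neighborFinset v := by
    intro x hx
    obtain ⟨y, hy, rfl⟩ := mem_map.1 hx
    simpa using hy
  have hdeg : deg G v = #(G.neighborFinset v) := by
    rw [deg, Set.ncard_eq_toFinset_card', SimpleGraph.neighborFinset]
  rw [hdeg, ← card_map (Function.Embedding.subtype _)]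
  exact card_le_card h

/-- A minimal non-`k`-colorable induced subgraph is critical. -/
lemma critical_comap (hql : QuasiLine G) (hdeg : ∀ v, deg G v ≤ k + 1)
    (hcl : ∀ Q : Finset V, G.IsClique (Q : Set V) → #Q ≤ k) (h8 : 8 ≤ k) {W : Finset V}
    (hW : ∀ φ : V → Fin k, ¬ ProperOn G φ W)
    (hmin : ∀ A ⊂ W, ∃ φ : V → Fin k, ProperOn G φ A) :
    Critical (G.comap (Subtype.val : W → V)) k where
  exists_properOn A hA := by
    obtain ⟨φ, hφ⟩ := hmin (A.map (Function.Embedding.subtype _)) (by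
      obtain ⟨v, hv⟩ : ∃ v, v ∉ A := by
        by_contra! hcon
        exact hA (eq_univ_iff_forall.2 hcon)
      refine (ssubset_iff_of_subset fun x hx => ?_).2 ⟨v, v.2, by simpa using hv⟩
      obtain ⟨y, -, rfl⟩ := mem_map.1 hx
      exact y.2)
    exact ⟨fun v => φ v, fun u hu v hv huv =>
      hφ u (mem_map_of_mem _ hu) v (mem_map_of_mem _ hv) huv⟩
  not_properOn φ hφ := by
    refine hW (fun v => if h : v ∈ W then φ ⟨v, h⟩ else ⟨0, by omega⟩) fun u hu v hv huv => ?_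
    simp only [hu, hv, dif_pos]
    exact hφ ⟨u, hu⟩ (mem_univ _) ⟨v, hv⟩ (mem_univ _) huv
  degree_le v := (card_neighborFinset_comap_le_deg G W v).trans (hdeg v)
  card_clique_le Q hQ := by
    rw [← card_map (Function.Embedding.subtype _)]
    refine hcl _ fun x hx y hy hxy => ?_
    obtain ⟨a, ha, rfl⟩ := mem_map.1 (mem_coe.1 hx)
    obtain ⟨b, hb, rfl⟩ := mem_map.1 (mem_coe.1 hy)
    exact hQ ha hb fun h => hxy (congrArg _ h)
  exists_cliques v := by
    obtain ⟨C₁, C₂, h₁, h₂, hN⟩ := hql v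
    refine ⟨((G.comap (Subtype.val : W → V)).neighborFinset v).filter fun u => u.1 ∈ C₁,
      ((G.comap (Subtype.val : W → V)).neighborFinset v).filter fun u => u.1 ∈ C₂, ?_, ?_, ?_⟩
    · intro x hx y hy hxy
      exact h₁ (mem_filter.1 hx).2 (mem_filter.1 hy).2 fun h => hxy (Subtype.ext h)
    · intro x hx y hy hxy
      exact h₂ (mem_filter.1 hx).2 (mem_filter.1 hy).2 fun h => hxy (Subtype.ext h)
    · rw [← filter_or]
      refine (filter_true_of_mem ?_).symm
      exact fun u hu => hN (by simpa using hu)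
  eight_le := h8

/-- A quasi-line graph with degrees at most `k + 1` and cliques of size at most `k` is
`k`-colorable. -/
lemma exists_properOn_univ (hql : QuasiLine G) (hdeg : ∀ v, deg G v ≤ k + 1)
    (hcl : ∀ Q : Finset V, G.IsClique (Q : Set V) → #Q ≤ k) (h8 : 8 ≤ k) :
    ∃ φ : V → Fin k, ProperOn G φ univ := by
  by_contra! hcon
  obtain ⟨W, hW, hmin⟩ := (univ.filter fun W : Finset V =>
    ∀ φ : V → Fin k, ¬ ProperOn G φ W).exists_min_image card ⟨univ, by simpa using hcon⟩
  rw [mem_filter] at hW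
  refine (critical_comap hql hdeg hcl h8 hW.2 fun A hA => ?_).false
  by_contra! hA'
  exact (card_lt_card hA).not_ge (hmin A (by simpa using hA'))

end QuasiLineColoring

/-- Every quasi-line graph with `χ ≥ Δ ≥ 9` contains a `K_Δ`. -/
theorem stmt8 {V : Type*} [Fintype V] (G : SimpleGraph V)
    (hql : QuasiLine G)
    (hχ : (maxDeg G : ℕ∞) ≤ G.chromaticNumber) (hΔ : 9 ≤ maxDeg G) :
    ∃ S : Finset V, G.IsNClique (maxDeg G) S := by
  by_contra! hcon
  obtain ⟨k, hk⟩ : ∃ k, maxDeg G = k + 1 := ⟨maxDeg G - 1, by omega⟩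
  have hdeg : ∀ v, deg G v ≤ k + 1 := fun v =>
    hk ▸ le_csSup (Set.finite_range (deg G)).bddAbove (Set.mem_range_self v)
  have hcl : ∀ Q : Finset V, G.IsClique (Q : Set V) → Q.card ≤ k := by
    intro Q hQ
    by_contra! hlt
    obtain ⟨S, hSQ, hS⟩ := Finset.exists_subset_card_eq (s := Q) (n := maxDeg G) (by omega)
    exact hcon S ⟨hQ.subset (by exact_mod_cast hSQ), hS⟩
  obtain ⟨φ, hφ⟩ := QuasiLineColoring.exists_properOn_univ hql hdeg hcl (by omega)
  have hcol : G.Colorable k := ⟨SimpleGraph.Coloring.mk φ fun {u v} huv =>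
    hφ u (Finset.mem_univ _) v (Finset.mem_univ _) huv⟩
  have h := hχ.trans hcol.chromaticNumber_le
  rw [hk, Nat.cast_le] at h
  omega
end

section
/- Every claw-free graph G with χ(G) ≥ Δ(G) ≥ 9 contains a clique on Δ(G) vertices. Equivalently, every claw-free graph with Δ(G) ≥ 9 satisfies χ(G) ≤ max{ω(G), Δ(G) − 1}. -/
/-- A graph is claw-free if it has no induced `K_{1,3}`: there is no vertex with
three pairwise distinct, pairwise nonadjacent neighbors. -/
def ClawFree {V : Type*} (G : SimpleGraph V) : Prop :=
  ∀ v a b c : V, G.Adj v a → G.Adj v b → G.Adj v c →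
    ¬G.Adj a b → ¬G.Adj a c → ¬G.Adj b c → a = b ∨ a = c ∨ b = c

namespace ClawFreeColoring

open Finset Classical

variable {V : Type*} {G : SimpleGraph V} {m : ℕ}

/-- `c` is a proper coloring of `G - y`; the value at `y` is irrelevant. -/
def Near (G : SimpleGraph V) (y : V) (c : V → Fin m) : Prop :=
  ∀ u w, u ≠ y → w ≠ y → G.Adj u w → c u ≠ c w

/-- `x` is a neighbor of `y`, and the only one with its color. -/
def Star (G : SimpleGraph V) (c : V → Fin m) (y x : V) : Prop :=
  G.Adj y x ∧ ∀ z, G.Adj y z → c z = c x → z = x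

/-- Give `y` the color of `x`, so that `x` becomes the uncolored vertex. -/
noncomputable def shift (c : V → Fin m) (y x : V) : V → Fin m := Function.update c y (c x)

@[simp] lemma shift_self (c : V → Fin m) (y x : V) : shift c y x y = c x := by simp [shift]

lemma shift_of_ne (c : V → Fin m) {y x z : V} (h : z ≠ y) : shift c y x z = c z := by
  simp [shift, h]

lemma exists_ne_of_not_star {c : V → Fin m} {y x : V} (hx : G.Adj y x) (h : ¬ Star G c y x) :
    ∃ z, G.Adj y z ∧ c z = c x ∧ z ≠ x := by
  simp only [Star, not_and, not_forall] at h
  obtain ⟨z, h1, h2, h3⟩ := h hx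
  exact ⟨z, h1, h2, h3⟩

lemma Near.near_shift {y x : V} {c : V → Fin m} (h : Near G y c) (hx : Star G c y x) :
    Near G x (shift c y x) := by
  intro u w hu hw huw
  by_cases h1 : u = y
  · subst h1
    rw [shift_self, shift_of_ne _ huw.ne']
    exact fun h2 => hw (hx.2 w huw h2.symm)
  · by_cases h2 : w = y
    · subst h2
      rw [shift_self, shift_of_ne _ huw.ne]
      exact fun h2 => hu (hx.2 u huw.symm h2)
    · rw [shift_of_ne _ h1, shift_of_ne _ h2]
      exact h u w h1 h2 huw

/-- The previously uncolored vertex is a uniquely colored neighbor after a shift. -/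
lemma Near.star_shift_self {y x : V} {c : V → Fin m} (h : Near G y c) (hx : Star G c y x) :
    Star G (shift c y x) x y := by
  refine ⟨hx.1.symm, fun z hz hc => ?_⟩
  by_contra hzy
  rw [shift_self, shift_of_ne _ hzy] at hc
  exact h x z hx.1.ne' hzy hz hc.symm

/-- `s` is a neighbor of `x` in the color of `a` and at distance two from `y`. -/
def Fwd (G : SimpleGraph V) (c : V → Fin m) (y a x s : V) : Prop :=
  G.Adj x s ∧ ¬ G.Adj y s ∧ s ≠ y ∧ c s = c a

/-- `t` and `a` are adjacent uniquely colored neighbors of `y`, and `t` has another neighbor in the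
color of `a`. -/
def Rep (G : SimpleGraph V) (c : V → Fin m) (y t a : V) : Prop :=
  Star G c y t ∧ Star G c y a ∧ G.Adj t a ∧ ¬ Star G (shift c y t) t a

lemma rep_of_adj_fwd {y t a x s : V} {c : V → Fin m}
    (ht : Star G c y t) (ha : Star G c y a) (hta : G.Adj t a) (hs : Fwd G c y a x s)
    (hts : G.Adj t s) : Rep G c y t a := by
  refine ⟨ht, ha, hta, fun hstar => ?_⟩
  have := hstar.2 s hts (by rw [shift_of_ne _ hs.2.2.1, shift_of_ne _ ha.1.ne', hs.2.2.2])
  exact hs.2.1 (this ▸ ha.1)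

lemma isClique_insert_of_forall {K : Finset V} (hK : G.IsClique (K : Set V)) {p : V}
    (h : ∀ x ∈ K, G.Adj p x) : G.IsClique (insert p K : Finset V) := by
  rw [coe_insert]
  exact hK.insert fun x hx _ => h x hx

variable [Fintype V]

/-- `G` is claw-free, has maximum degree at most `m + 1` and no clique on `m + 1` vertices, and is
not `m`-colorable although every vertex-deleted subgraph is. -/
structure Critical (G : SimpleGraph V) (m : ℕ) : Prop where
  clawFree : ClawFree G
  card_le : ∀ v, #{z | G.Adj v z} ≤ m + 1
  cliqueFree : G.CliqueFree (m + 1)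
  not_proper : ¬ ∃ c : V → Fin m, ∀ u w, G.Adj u w → c u ≠ c w
  exists_near : ∀ v, ∃ c : V → Fin m, ∀ u w, u ≠ v → w ≠ v → G.Adj u w → c u ≠ c w

lemma Near.sees (hG : Critical G m) {y : V} {c : V → Fin m} (h : Near G y c) (γ : Fin m) :
    ∃ z, G.Adj y z ∧ c z = γ := by
  by_contra! hn
  refine hG.not_proper ⟨Function.update c y γ, fun u w huw => ?_⟩
  by_cases hu : u = y
  · subst hu
    have hw : w ≠ u := huw.ne'
    simp only [Function.update_self, Function.update_of_ne hw]
    exact (hn w huw).symm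
  · by_cases hw : w = y
    · subst hw
      simp only [Function.update_self, Function.update_of_ne hu]
      exact hn u huw.symm
    · simp only [Function.update_of_ne hw, Function.update_of_ne hu]
      exact h u w hu hw huw

/-- At most one color occurs more than once around the uncolored vertex. -/
lemma Near.double (hG : Critical G m) {y : V} {c : V → Fin m} (h : Near G y c) {a a' b b' : V}
    (ha : G.Adj y a) (ha' : G.Adj y a') (hb : G.Adj y b) (hb' : G.Adj y b')
    (haa : a ≠ a') (hbb : b ≠ b') (hca : c a = c a') (hcb : c b = c b') : c a = c b := by
  by_contra hne
  have hsub : (univ : Finset (Fin m)) ⊆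
      (((univ.filter fun z => G.Adj y z).erase a).erase b).image c := by
    intro γ _
    obtain ⟨z, hz, rfl⟩ := h.sees hG γ
    simp only [mem_image, mem_erase, mem_filter, mem_univ, true_and]
    by_cases h1 : z = a
    · exact ⟨a', ⟨by grind, by grind, ha'⟩, by grind⟩
    · by_cases h2 : z = b
      · exact ⟨b', ⟨by grind, by grind, hb'⟩, by grind⟩
      · exact ⟨z, ⟨h2, h1, hz⟩, rfl⟩
  have h1 := (card_le_card hsub).trans card_image_le
  have h2 := hG.card_le y
  have hab : b ≠ a := by grind
  rw [card_erase_of_mem (by simp [hab, hb]), card_erase_of_mem (by simp [ha])] at h1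
  have h3 : 2 ≤ #{z | G.Adj y z} := by
    rw [← card_pair hab]; exact card_le_card (by intro z; simp; rintro (rfl | rfl) <;> assumption)
  simp at h1
  omega

/-- Two neighbors that are not unique in their color have the same color. -/
lemma Near.color_eq_of_not_star (hG : Critical G m) {y : V} {c : V → Fin m} (h : Near G y c)
    {a b : V} (ha : G.Adj y a) (hb : G.Adj y b) (hsa : ¬ Star G c y a) (hsb : ¬ Star G c y b) :
    c a = c b := by
  obtain ⟨a', h1, h2, h3⟩ := exists_ne_of_not_star ha hsa
  obtain ⟨b', h4, h5, h6⟩ := exists_ne_of_not_star hb hsb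
  exact h.double hG ha h1 hb h4 h3.symm h6.symm h2.symm h5.symm

/-- If `s` is not adjacent to `y`, then shifting along `y, x, s` reveals a second neighbor of `s`
in the color of `x`. -/
lemma Near.exists_second (hG : Critical G m) {y x s : V} {c : V → Fin m} (h : Near G y c)
    (hsy : s ≠ y) (hs : ¬ G.Adj y s) (hx : Star G c y x) (hxs : Star G (shift c y x) x s) :
    ∃ z, G.Adj s z ∧ z ≠ x ∧ c z = c x := by
  obtain ⟨z, hz, hc⟩ := ((h.near_shift hx).near_shift hxs).sees hG (c x)
  have hzy : z ≠ y := fun e => hs (e ▸ hz.symm)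
  have hzx : z ≠ x := by
    rintro rfl
    rw [shift_self, shift_of_ne _ hsy] at hc
    exact h s z hsy hx.1.ne' hz hc
  rw [shift_of_ne _ hzx, shift_of_ne _ hzy] at hc
  exact ⟨z, hz, hzx, hc⟩

/-- No three uniquely colored neighbors of `y` allow a second shift to the same `s`. -/
lemma Near.no_three (hG : Critical G m) {y s : V} {c : V → Fin m} (h : Near G y c)
    (hsy : s ≠ y) (hs : ¬ G.Adj y s) {x₁ x₂ x₃ : V}
    (h₁ : Star G c y x₁) (h₂ : Star G c y x₂) (h₃ : Star G c y x₃)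
    (g₁ : Star G (shift c y x₁) x₁ s)
    (g₂ : Star G (shift c y x₂) x₂ s)
    (g₃ : Star G (shift c y x₃) x₃ s)
    (h12 : x₁ ≠ x₂) (h13 : x₁ ≠ x₃) (h23 : x₂ ≠ x₃) : False := by
  obtain ⟨z₂, a2, b2, e2⟩ := h.exists_second hG hsy hs h₂ g₂
  obtain ⟨z₃, a3, b3, e3⟩ := h.exists_second hG hsy hs h₃ g₃
  have c12 : c x₂ ≠ c x₁ := fun e => h12 (h₁.2 _ h₂.1 e).symm
  have c13 : c x₃ ≠ c x₁ := fun e => h13 (h₁.2 _ h₃.1 e).symm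
  have c23 : c x₂ ≠ c x₃ := fun e => h23 (h₃.2 _ h₂.1 e)
  have key : ∀ z, G.Adj s z → c z ≠ c x₁ →
      shift (shift c y x₁) x₁ s z = c z := by
    intro z hz hc
    rw [shift_of_ne _ (fun e => hc (by rw [e])),
      shift_of_ne _ (fun e => hs (by rw [← e]; exact hz.symm))]
  have := ((h.near_shift h₁).near_shift g₁).double hG g₂.1.symm a2 g₃.1.symm a3 b2.symm b3.symm
    (by rw [key _ g₂.1.symm c12, key _ a2 (e2 ▸ c12), e2])
    (by rw [key _ g₃.1.symm c13, key _ a3 (e3 ▸ c13), e3])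
  rw [key _ g₂.1.symm c12, key _ g₃.1.symm c13] at this
  exact c23 this

/-- A repeated color around `x` that occurs at `s`, outside the neighborhood of `y`, also occurs in
the neighborhood of `y`. -/
lemma Near.exists_adj_of_not_star (hG : Critical G m) {y x s : V} {c : V → Fin m} (h : Near G y c)
    (hsy : s ≠ y) (hs : ¬ G.Adj y s) (hx : Star G c y x) (hxs : G.Adj x s)
    (hn : ¬ Star G (shift c y x) x s) :
    ∃ z, G.Adj x z ∧ G.Adj y z ∧ z ≠ s ∧ c z = c s := by
  obtain ⟨z, h1, h2, h3⟩ := exists_ne_of_not_star hxs hn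
  have hzy : z ≠ y := by
    rintro rfl
    rw [shift_self, shift_of_ne _ hsy] at h2
    exact h x s hx.1.ne' hsy hxs h2
  rw [shift_of_ne _ hzy, shift_of_ne _ hsy] at h2
  refine ⟨z, h1, ?_, h3, h2⟩
  by_contra hyz
  have hzs : ¬ G.Adj z s := fun e => h z s hzy hsy e h2
  rcases hG.clawFree x y z s hx.1.symm h1 hxs hyz hs hzs with e | e | e
  · exact hzy e.symm
  · exact hsy e.symm
  · exact h3 e

/-- A connected graph of maximum degree two does not have three vertices of degree at most one. -/
lemma not_three_ends (H : SimpleGraph V) (h2 : ∀ v, #{w | H.Adj v w} ≤ 2) {x a s : V}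
    (hxa : H.Reachable x a) (hxs : H.Reachable x s) (hx : #{w | H.Adj x w} ≤ 1)
    (ha : #{w | H.Adj a w} ≤ 1) (hs : #{w | H.Adj s w} ≤ 1)
    (nxa : x ≠ a) (nxs : x ≠ s) (nas : a ≠ s) : False := by
  let C := H.connectedComponentMk x
  have hconn : C.toSimpleGraph.Connected := C.connected_toSimpleGraph
  have hle := hconn.card_vert_le_card_edgeSet_add_one
  rw [Nat.card_eq_fintype_card, Nat.card_eq_fintype_card, ← SimpleGraph.edgeFinset_card] at hle
  have hsum := C.toSimpleGraph.sum_degrees_eq_twice_card_edges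
  have hdeg : ∀ v : C, C.toSimpleGraph.degree v ≤ #{w | H.Adj v.1 w} := by
    intro v
    rw [← SimpleGraph.card_neighborFinset_eq_degree]
    refine card_le_card_of_injOn Subtype.val ?_ Subtype.val_injective.injOn
    intro w hw
    rw [mem_coe, mem_filter]
    exact ⟨mem_univ _, (C.toSimpleGraph.mem_neighborFinset v w).1 (mem_coe.1 hw)⟩
  let X : C := ⟨x, rfl⟩
  let A : C := ⟨a, (SimpleGraph.ConnectedComponent.eq.2 hxa.symm)⟩
  let S : C := ⟨s, (SimpleGraph.ConnectedComponent.eq.2 hxs.symm)⟩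
  have hXA : X ≠ A := fun e => nxa (congrArg Subtype.val e)
  have hXS : X ≠ S := fun e => nxs (congrArg Subtype.val e)
  have hAS : A ≠ S := fun e => nas (congrArg Subtype.val e)
  have hbound : ∑ v : C, (C.toSimpleGraph.degree v + if v ∈ ({X, A, S} : Finset C) then 1 else 0)
      ≤ ∑ _v : C, 2 := by
    refine sum_le_sum fun v _ => ?_
    have h1 := hdeg v
    have h3 := h2 v.1
    split_ifs with hv
    · simp only [mem_insert, mem_singleton] at hv
      rcases hv with rfl | rfl | rfl
      · exact Nat.succ_le_succ (h1.trans hx)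
      · exact Nat.succ_le_succ (h1.trans ha)
      · exact Nat.succ_le_succ (h1.trans hs)
    · omega
  rw [sum_add_distrib, hsum] at hbound
  have hc : #({X, A, S} : Finset C) = 3 := card_eq_three.2 ⟨X, A, S, hXA, hXS, hAS, rfl⟩
  simp only [sum_ite_mem, univ_inter, sum_const, smul_eq_mul, mul_one, hc, card_univ] at hbound
  omega

/-- The subgraph of `G - y` spanned by the edges between the colors `α` and `β`. -/
def kempe (G : SimpleGraph V) (c : V → Fin m) (y : V) (α β : Fin m) : SimpleGraph V where
  Adj u w := G.Adj u w ∧ u ≠ y ∧ w ≠ y ∧ (c u = α ∧ c w = β ∨ c u = β ∧ c w = α)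
  symm := ⟨fun _ _ h => ⟨h.1.symm, h.2.2.1, h.2.1, by tauto⟩⟩
  loopless := ⟨fun _ h => G.loopless.irrefl _ h.1⟩

/-- Two uniquely colored neighbors of the uncolored vertex lie in a common Kempe chain. -/
lemma Near.reachable (hG : Critical G m) {y a x : V} {c : V → Fin m} (h : Near G y c)
    (ha : Star G c y a) (hx : Star G c y x) :
    (kempe G c y (c a) (c x)).Reachable x a := by
  by_contra hn
  set H := kempe G c y (c a) (c x) with hH
  let c' : V → Fin m := fun z => if H.Reachable x z then Equiv.swap (c a) (c x) (c z) else c z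
  have cross : ∀ u w, u ≠ y → w ≠ y → G.Adj u w → H.Reachable x u → ¬ H.Reachable x w →
      Equiv.swap (c a) (c x) (c u) ≠ c w := by
    intro u w hu hw huw h1 h2
    have hnot : ¬ H.Adj u w := fun e => h2 (h1.trans e.reachable)
    have hc := h u w hu hw huw
    simp only [hH, kempe, not_and] at hnot
    have hnot := hnot huw hu hw
    rw [Equiv.swap_apply_def]
    split_ifs <;> grind
  have h' : Near G y c' := by
    intro u w hu hw huw
    simp only [c']
    split_ifs with h1 h2 h2
    · exact fun e => h u w hu hw huw ((Equiv.swap _ _).injective e)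
    · exact cross u w hu hw huw h1 h2
    · exact (cross w u hw hu huw.symm h2 h1).symm
    · exact h u w hu hw huw
  obtain ⟨z, hz, hc⟩ := h'.sees hG (c x)
  simp only [c'] at hc
  split_ifs at hc with h1
  · have : c z = c a := by
      have := congrArg (Equiv.swap (c a) (c x)) hc
      simpa using this
    rw [ha.2 z hz this] at h1
    exact hn h1
  · rw [hx.2 z hz hc] at h1
    exact h1 (SimpleGraph.Reachable.refl x)

lemma card_kempe_le_two (hG : Critical G m) {y : V} {c : V → Fin m} (h : Near G y c)
    {α β : Fin m} (hαβ : α ≠ β) (v : V) : #{w | (kempe G c y α β).Adj v w} ≤ 2 := by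
  by_contra hlt
  obtain ⟨p, q, r, hp, hq, hr, hpq, hpr, hqr⟩ := two_lt_card_iff.1 (not_le.1 hlt)
  simp only [mem_filter, mem_univ, true_and] at hp hq hr
  simp only [kempe] at hp hq hr
  have e1 : ¬ G.Adj p q := fun e => h p q hp.2.2.1 hq.2.2.1 e (by grind)
  have e2 : ¬ G.Adj p r := fun e => h p r hp.2.2.1 hr.2.2.1 e (by grind)
  have e3 : ¬ G.Adj q r := fun e => h q r hq.2.2.1 hr.2.2.1 e (by grind)
  have := hG.clawFree v p q r hp.1 hq.1 hr.1 e1 e2 e3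
  tauto

lemma Near.exists_fwd (hG : Critical G m) {y a x : V} {c : V → Fin m} (h : Near G y c)
    (ha : Star G c y a) (hx : Star G c y x) (hne : a ≠ x) (hax : ¬ G.Adj a x) :
    ∃ s, Fwd G c y a x s := by
  obtain ⟨s, hs, hc⟩ := (h.near_shift hx).sees hG (c a)
  have hsy : s ≠ y := by
    rintro rfl
    rw [shift_self] at hc
    exact hne (hx.2 a ha.1 hc.symm)
  rw [shift_of_ne _ hsy] at hc
  refine ⟨s, hs, fun e => ?_, hsy, hc⟩
  rw [ha.2 s e hc] at hs
  exact hax hs.symm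

/-- All neighbors of `x` in the color of a nonadjacent uniquely colored `a` coincide. -/
lemma Near.fwd_unique (hG : Critical G m) {y a x s z : V} {c : V → Fin m} (h : Near G y c)
    (ha : Star G c y a) (hx : Star G c y x) (hax : ¬ G.Adj a x) (hs : Fwd G c y a x s)
    (hz : G.Adj x z) (hzy : z ≠ y) (hc : c z = c a) : z = s := by
  obtain ⟨h1, h2, h3, h4⟩ := hs
  have hyz : ¬ G.Adj y z := fun e => by
    rw [ha.2 z e hc] at hz
    exact hax hz.symm
  by_contra hzs
  rcases hG.clawFree x y z s hx.1.symm hz h1 hyz h2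
    (fun e => h z s hzy h3 e (hc.trans h4.symm)) with e | e | e
  · exact hzy e.symm
  · exact h3 e.symm
  · exact hzs e

lemma Near.star_fwd (hG : Critical G m) {y a x s : V} {c : V → Fin m} (h : Near G y c)
    (ha : Star G c y a) (hx : Star G c y x) (hne : a ≠ x) (hax : ¬ G.Adj a x)
    (hs : Fwd G c y a x s) : Star G (shift c y x) x s := by
  refine ⟨hs.1, fun z hz hc => ?_⟩
  rw [shift_of_ne _ hs.2.2.1] at hc
  have hzy : z ≠ y := by
    rintro rfl
    rw [shift_self, hs.2.2.2] at hc
    exact hne (hx.2 a ha.1 hc.symm)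
  rw [shift_of_ne _ hzy] at hc
  exact h.fwd_unique hG ha hx hax hs hz hzy (hc.trans hs.2.2.2)

/-- Three distinct neighbors of a vertex are not pairwise nonadjacent. -/
lemma Critical.adj_of_not_adj (hG : Critical G m) {v a x x' : V} (ha : G.Adj v a) (hx : G.Adj v x)
    (hx' : G.Adj v x') (h1 : a ≠ x) (h2 : a ≠ x') (h3 : x ≠ x') (hax : ¬ G.Adj a x)
    (hax' : ¬ G.Adj a x') : G.Adj x x' := by
  by_contra hn
  have := hG.clawFree v a x x' ha hx hx' hax hax' hn
  tauto

/-- The Vizing fan argument. -/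
lemma Near.fwd_eq (hG : Critical G m) {y a x x' s s' : V} {c : V → Fin m} (h : Near G y c)
    (ha : Star G c y a) (hx : Star G c y x) (hx' : Star G c y x') (hne : a ≠ x) (hne' : a ≠ x')
    (hxx : x ≠ x') (hax : ¬ G.Adj a x) (hax' : ¬ G.Adj a x')
    (hu : Star G (shift c y x') x' x) (hs : Fwd G c y a x s) (hs' : Fwd G c y a x' s') :
    s = s' := by
  by_contra hss
  have hsx : ¬ G.Adj x s' := fun e =>
    hss (h.fwd_unique hG ha hx hax hs e hs'.2.2.1 hs'.2.2.2).symm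
  have hcax : c a ≠ c x := fun e => hne (hx.2 a ha.1 e)
  have hcx' : c x' ≠ c x := fun e => hxx (hx.2 x' hx'.1 e).symm
  have hcax' : c a ≠ c x' := fun e => hne' (hx'.2 a ha.1 e)
  have hxy : x ≠ y := hx.1.ne'
  have r1 := h.reachable hG ha hx
  have r2 := (h.near_shift hx').reachable hG (h.star_fwd hG ha hx' hne' hax' hs') hu
  rw [shift_of_ne _ hs'.2.2.1, shift_of_ne _ hxy, hs'.2.2.2] at r2
  have hmono : kempe G (shift c y x') x' (c a) (c x) ≤ kempe G c y (c a) (c x) := by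
    intro u w huw
    obtain ⟨g1, g2, g3, g4⟩ := huw
    have hu : u ≠ y := by
      rintro rfl
      rw [shift_self] at g4
      grind
    have hw : w ≠ y := by
      rintro rfl
      rw [shift_self] at g4
      grind
    rw [shift_of_ne _ hu, shift_of_ne _ hw] at g4
    exact ⟨g1, hu, hw, g4⟩
  refine not_three_ends _ (card_kempe_le_two hG h hcax) r1 (r2.mono hmono) ?_ ?_ ?_ hne.symm ?_ ?_
  · rw [card_le_one]
    intro p hp q hq
    simp only [mem_filter, mem_univ, true_and] at hp hq
    simp only [kempe] at hp hq
    rw [h.fwd_unique hG ha hx hax hs hp.1 hp.2.2.1 (by grind),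
      h.fwd_unique hG ha hx hax hs hq.1 hq.2.2.1 (by grind)]
  · rw [card_le_one]
    intro p hp q hq
    simp only [mem_filter, mem_univ, true_and] at hp hq
    simp only [kempe] at hp hq
    by_contra hpq
    have key : ∀ p, G.Adj a p → c p = c x → ¬ G.Adj y p := by
      intro p h1 h2 h3
      rw [hx.2 p h3 h2] at h1
      exact hax h1
    have e1 := key p hp.1 (by grind)
    have e2 := key q hq.1 (by grind)
    exact h p q hp.2.2.1 hq.2.2.1 (hG.adj_of_not_adj ha.1.symm hp.1 hq.1 hp.2.2.1.symm
      hq.2.2.1.symm hpq e1 e2) (by grind)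
  · rw [card_le_one]
    intro p hp q hq
    simp only [mem_filter, mem_univ, true_and] at hp hq
    simp only [kempe] at hp hq
    by_contra hpq
    have hcs := hs'.2.2.2
    have key : ∀ p, G.Adj s' p → p ≠ y → c p = c x → p ≠ x' ∧ ¬ G.Adj x' p := by
      intro p h1 hpy h2
      refine ⟨fun e => hcx' (by rw [← e, h2]), fun h3 => ?_⟩
      have := hu.2 p h3 (by rw [shift_of_ne _ hpy, shift_of_ne _ hxy, h2])
      rw [this] at h1
      exact hsx h1.symm
    have e1 := key p hp.1 hp.2.2.1 (by grind)
    have e2 := key q hq.1 hq.2.2.1 (by grind)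
    exact h p q hp.2.2.1 hq.2.2.1 (hG.adj_of_not_adj hs'.1.symm hp.1 hq.1 e1.1.symm
      e2.1.symm hpq e1.2 e2.2) (by grind)
  · intro e
    have := hs'.2.2.2
    rw [← e] at this
    exact hcax this.symm
  · intro e
    exact hs'.2.1 (e ▸ ha.1)

/-- A uniquely colored neighbor of `y` has at most two nonneighbors among the others. -/
lemma Near.no_three_nonadj (hG : Critical G m) {y a x₁ x₂ x₃ : V} {c : V → Fin m} (h : Near G y c)
    (ha : Star G c y a) (h₁ : Star G c y x₁) (h₂ : Star G c y x₂) (h₃ : Star G c y x₃)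
    (n₁ : a ≠ x₁) (n₂ : a ≠ x₂) (n₃ : a ≠ x₃) (h12 : x₁ ≠ x₂) (h13 : x₁ ≠ x₃) (h23 : x₂ ≠ x₃)
    (a₁ : ¬ G.Adj a x₁) (a₂ : ¬ G.Adj a x₂) (a₃ : ¬ G.Adj a x₃) : False := by
  obtain ⟨s₁, f₁⟩ := h.exists_fwd hG ha h₁ n₁ a₁
  obtain ⟨s₂, f₂⟩ := h.exists_fwd hG ha h₂ n₂ a₂
  obtain ⟨s₃, f₃⟩ := h.exists_fwd hG ha h₃ n₃ a₃
  have unshared : ∀ {x x' s s'}, Star G c y x → Star G c y x' → a ≠ x → a ≠ x' → x ≠ x' →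
      ¬ G.Adj a x → ¬ G.Adj a x' → Fwd G c y a x s → Fwd G c y a x' s' → s ≠ s' →
      ¬ Star G (shift c y x') x' x ∧ ¬ Star G (shift c y x) x x' := by
    intro x x' s s' hx hx' e1 e2 e3 e4 e5 hs hs' hss
    exact ⟨fun hu => hss (h.fwd_eq hG ha hx hx' e1 e2 e3 e4 e5 hu hs hs'),
      fun hu => hss (h.fwd_eq hG ha hx' hx e2 e1 e3.symm e5 e4 hu hs' hs).symm⟩
  have single : ∀ {x p q}, Star G c y x → Star G c y p → Star G c y q → a ≠ x → a ≠ p → a ≠ q →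
      x ≠ p → x ≠ q → p ≠ q → ¬ G.Adj a x → ¬ G.Adj a p → ¬ G.Adj a q →
      ¬ Star G (shift c y x) x p → ¬ Star G (shift c y x) x q → False := by
    intro x p q hx hp hq e1 e2 e3 e4 e5 e6 e7 e8 e9 hsp hsq
    have := (h.near_shift hx).color_eq_of_not_star hG
      (hG.adj_of_not_adj ha.1 hx.1 hp.1 e1 e2 e4 e7 e8)
      (hG.adj_of_not_adj ha.1 hx.1 hq.1 e1 e3 e5 e7 e9) hsp hsq
    rw [shift_of_ne _ hp.1.ne', shift_of_ne _ hq.1.ne'] at this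
    exact e6 (hq.2 p hp.1 this)
  have m12 := unshared h₁ h₂ n₁ n₂ h12 a₁ a₂ f₁ f₂
  have m13 := unshared h₁ h₃ n₁ n₃ h13 a₁ a₃ f₁ f₃
  have m23 := unshared h₂ h₃ n₂ n₃ h23 a₂ a₃ f₂ f₃
  have k1 := single h₁ h₂ h₃ n₁ n₂ n₃ h12 h13 h23 a₁ a₂ a₃
  have k2 := single h₂ h₁ h₃ n₂ n₁ n₃ h12.symm h23 h13 a₂ a₁ a₃
  have k3 := single h₃ h₁ h₂ n₃ n₁ n₂ h13.symm h23.symm h12 a₃ a₁ a₂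
  have e12 : s₁ = s₂ := by grind
  have e13 : s₁ = s₃ := by grind
  subst e12 e13
  exact h.no_three hG f₁.2.2.1 f₁.2.1 h₁ h₂ h₃ (h.star_fwd hG ha h₁ n₁ a₁ f₁)
    (h.star_fwd hG ha h₂ n₂ a₂ f₂) (h.star_fwd hG ha h₃ n₃ a₃ f₃) h12 h13 h23

/-- The uniquely colored neighbors of `y`. -/
noncomputable def stars (G : SimpleGraph V) (c : V → Fin m) (y : V) : Finset V :=
  univ.filter (Star G c y)

@[simp] lemma mem_stars {c : V → Fin m} {y x : V} : x ∈ stars G c y ↔ Star G c y x := by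
  simp [stars]

lemma Near.card_stars_of_forall (hG : Critical G m) {y : V} {c : V → Fin m} (h : Near G y c)
    (hall : ∀ x, G.Adj y x → Star G c y x) : m ≤ #(stars G c y) := by
  have hsub : (univ : Finset (Fin m)) ⊆ (stars G c y).image c := by
    intro γ _
    obtain ⟨z, hz, rfl⟩ := h.sees hG γ
    exact mem_image_of_mem c (mem_stars.2 (hall z hz))
  simpa using (card_le_card hsub).trans card_image_le

lemma Near.card_stars (hG : Critical G m) {y : V} {c : V → Fin m} (h : Near G y c) :
    m ≤ #(stars G c y) + 1 := by
  by_cases hall : ∀ x, G.Adj y x → Star G c y x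
  · exact (h.card_stars_of_forall hG hall).trans (Nat.le_succ _)
  push Not at hall
  obtain ⟨p, hp, hps⟩ := hall
  have hsub : (univ : Finset (Fin m)).erase (c p) ⊆ (stars G c y).image c := by
    intro γ hγ
    obtain ⟨z, hz, rfl⟩ := h.sees hG γ
    refine mem_image_of_mem c (mem_stars.2 ?_)
    by_contra hzs
    exact (mem_erase.1 hγ).1 (h.color_eq_of_not_star hG hz hp hzs hps)
  have h1 := (card_le_card hsub).trans card_image_le
  rw [card_erase_of_mem (mem_univ _), card_univ, Fintype.card_fin] at h1
  omega

/-- At most one neighbor of `p` in a clique is not uniquely colored. -/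
lemma Near.card_not_star_le_one (hG : Critical G m) {p : V} {c : V → Fin m} (h : Near G p c)
    {K : Finset V} (hK : G.IsClique (K : Set V)) :
    #{x ∈ K | G.Adj p x} ≤ #{x ∈ K | Star G c p x} + 1 := by
  have h1 : #{x ∈ K | G.Adj p x ∧ ¬ Star G c p x} ≤ 1 := by
    rw [card_le_one]
    intro x hx z hz
    rw [mem_filter] at hx hz
    by_contra hxz
    exact h x z hx.2.1.ne' hz.2.1.ne' (hK hx.1 hz.1 hxz)
      (h.color_eq_of_not_star hG hx.2.1 hz.2.1 hx.2.2 hz.2.2)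
  have h2 : ({x ∈ K | G.Adj p x} : Finset V) ⊆
      ({x ∈ K | Star G c p x} : Finset V) ∪ ({x ∈ K | G.Adj p x ∧ ¬ Star G c p x} : Finset V) := by
    intro x hx
    rw [mem_filter] at hx
    rw [mem_union, mem_filter, mem_filter]
    tauto
  have := (card_le_card h2).trans (card_union_le _ _)
  omega

/-- A vertex with four neighbors in a large clique misses at most one vertex of it. -/
lemma Critical.card_not_adj_le_one (hG : Critical G m) (hm : 8 ≤ m) {K : Finset V}
    (hK : G.IsClique (K : Set V)) (hcard : #K = m) {p : V} (hp : p ∉ K)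
    (h4 : 4 ≤ #{x ∈ K | G.Adj p x}) : #{x ∈ K | ¬ G.Adj p x} ≤ 1 := by
  by_contra! hS
  obtain ⟨c, h⟩ : ∃ c : V → Fin m, Near G p c := hG.exists_near p
  have hX := h.card_not_star_le_one hG hK
  have hsum := card_filter_add_card_filter_not (s := K) (fun x => G.Adj p x)
  set S : Finset V := {x ∈ K | ¬ G.Adj p x} with hSdef
  set X : Finset V := {x ∈ K | Star G c p x} with hXdef
  let B : V → Finset V := fun s => {x ∈ X | ¬ Star G (shift c p x) x s}
  have hSK : ∀ s ∈ S, s ∈ K ∧ s ≠ p ∧ ¬ G.Adj p s := by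
    intro s hs
    rw [hSdef, mem_filter] at hs
    exact ⟨hs.1, fun e => hp (e ▸ hs.1), hs.2⟩
  have hXK : ∀ x ∈ X, x ∈ K ∧ Star G c p x := by
    intro x hx
    rwa [hXdef, mem_filter] at hx
  have hB : ∀ s ∈ S, #X - 2 ≤ #(B s) := by
    intro s hs
    obtain ⟨_, h2, h3⟩ := hSK s hs
    have h5 := card_filter_add_card_filter_not (s := X) (fun x => Star G (shift c p x) x s)
    have h6 : #{x ∈ X | Star G (shift c p x) x s} ≤ 2 := by
      by_contra hlt
      obtain ⟨a, b, d, ha, hb, hd, hab, had, hbd⟩ := two_lt_card_iff.1 (not_le.1 hlt)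
      rw [mem_filter] at ha hb hd
      exact h.no_three hG h2 h3 (hXK a ha.1).2 (hXK b hb.1).2 (hXK d hd.1).2 ha.2 hb.2 hd.2
        hab had hbd
    simp only [B]
    omega
  have hdisj : (S : Set V).PairwiseDisjoint B := by
    intro s hs s' hs' hne
    rw [Function.onFun, Finset.disjoint_left]
    intro x hx hx'
    simp only [B, mem_filter] at hx hx'
    obtain ⟨g1, g2, g3⟩ := hSK s hs
    obtain ⟨g1', g2', g3'⟩ := hSK s' hs'
    obtain ⟨k1, k2⟩ := hXK x hx.1
    have hadj : ∀ t ∈ K, ¬ G.Adj p t → G.Adj x t := fun t ht hpt =>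
      hK k1 ht (fun e => hpt (e ▸ k2.1))
    have := (h.near_shift k2).color_eq_of_not_star hG (hadj s g1 g3) (hadj s' g1' g3') hx.2 hx'.2
    rw [shift_of_ne _ g2, shift_of_ne _ g2'] at this
    exact h s s' g2 g2' (hK g1 g1' hne) this
  have h1 : #(S.biUnion B) ≤ #X := card_le_card (biUnion_subset.2 fun s _ => filter_subset _ _)
  rw [card_biUnion hdisj] at h1
  have h2 := (card_nsmul_le_sum S (fun s => #(B s)) _ hB).trans h1
  rw [smul_eq_mul] at h2
  have h3 : 3 ≤ #X := by omega
  obtain ⟨n, hn⟩ := Nat.exists_eq_add_of_le h3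
  rw [hn, show 3 + n - 2 = n + 1 by omega] at h2
  rcases Nat.lt_or_ge n 2 with hn2 | hn2
  · interval_cases n <;> omega
  · nlinarith

/-- No vertex has four neighbors in a disjoint clique on `m` vertices. -/
lemma Critical.card_adj_lt_four (hG : Critical G m) (hm : 8 ≤ m) {K : Finset V}
    (hK : G.IsClique (K : Set V)) (hcard : #K = m) {p : V} (hp : p ∉ K) :
    #{x ∈ K | G.Adj p x} < 4 := by
  by_contra! h4
  have hS := hG.card_not_adj_le_one hm hK hcard hp h4
  have hsum := card_filter_add_card_filter_not (s := K) (fun x => G.Adj p x)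
  rcases Nat.lt_or_ge #{x ∈ K | ¬ G.Adj p x} 1 with h0 | h1
  · rw [Nat.lt_one_iff, card_filter_eq_zero_iff] at h0
    push Not at h0
    exact hG.cliqueFree _ ⟨isClique_insert_of_forall hK h0, by rw [card_insert_of_notMem hp, hcard]⟩
  obtain ⟨w, hw⟩ := card_eq_one.1 (le_antisymm hS h1)
  have hwK : w ∈ K ∧ ¬ G.Adj p w := by
    rw [← mem_filter (p := fun x => ¬ G.Adj p x), hw]
    exact mem_singleton_self w
  have hwp : w ≠ p := fun e => hp (e ▸ hwK.1)
  have hKw : ∀ x ∈ K, x ≠ w → G.Adj p x := by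
    intro x hx hxw
    by_contra hn
    have : x ∈ ({x ∈ K | ¬ G.Adj p x} : Finset V) := mem_filter.2 ⟨hx, hn⟩
    rw [hw, mem_singleton] at this
    exact hxw this
  obtain ⟨c, h⟩ : ∃ c : V → Fin m, Near G p c := hG.exists_near p
  have hzK : ∀ z, G.Adj p z → c z = c w → z ∉ K := by
    intro z hz hc hzK
    exact h z w hz.ne' hwp (hK hzK hwK.1 fun e => hwK.2 (e ▸ hz)) hc
  have few : ∀ z, G.Adj p z → c z = c w → #{x ∈ K | G.Adj z x} < 4 := by
    intro z hz hc
    by_contra! hz4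
    have hz1 := hG.card_not_adj_le_one hm hK hcard (hzK z hz hc) hz4
    have hzw : ¬ G.Adj z w := fun e => h z w hz.ne' hwp e hc
    have hall : ∀ x ∈ K.erase w, G.Adj z x := by
      intro x hx
      rw [mem_erase] at hx
      by_contra hn
      exact hx.1 (card_le_one.1 hz1 x (mem_filter.2 ⟨hx.2, hn⟩) w (mem_filter.2 ⟨hwK.1, hzw⟩))
    have hKe : G.IsClique ((K.erase w : Finset V) : Set V) :=
      hK.subset (coe_subset.2 (erase_subset w K))
    have hc1 := isClique_insert_of_forall hKe (p := p)
      fun x hx => hKw x (mem_of_mem_erase hx) (ne_of_mem_erase hx)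
    have hc2 := isClique_insert_of_forall hc1 (p := z) (by
      intro x hx
      rcases mem_insert.1 hx with rfl | hx
      · exact hz.symm
      · exact hall x hx)
    refine hG.cliqueFree _ ⟨hc2, ?_⟩
    rw [card_insert_of_notMem, card_insert_of_notMem, card_erase_of_mem hwK.1, hcard]
    · omega
    · exact fun e => hp (mem_of_mem_erase e)
    · intro e
      rcases mem_insert.1 e with e | e
      · exact hz.ne' e
      · exact hzK z hz hc (mem_of_mem_erase e)
  obtain ⟨z, hz, hc⟩ := h.sees hG (c w)
  have hzfew := few z hz hc
  by_cases hzs : Star G c p z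
  · have hX := h.card_not_star_le_one hG hK
    have h5 := card_filter_add_card_filter_not (s := {x ∈ K | Star G c p x}) (fun x => G.Adj z x)
    have h6 : #{x ∈ ({x ∈ K | Star G c p x} : Finset V) | ¬ G.Adj z x} ≤ 2 := by
      by_contra hlt
      obtain ⟨a, b, d, ha, hb, hd, hab, had, hbd⟩ := two_lt_card_iff.1 (not_le.1 hlt)
      simp only [mem_filter] at ha hb hd
      have hne : ∀ x ∈ K, z ≠ x := fun x hx e => hzK z hz hc (e ▸ hx)
      exact h.no_three_nonadj hG hzs ha.1.2 hb.1.2 hd.1.2 (hne a ha.1.1) (hne b hb.1.1)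
        (hne d hd.1.1) hab had hbd ha.2 hb.2 hd.2
    have h7 : #{x ∈ ({x ∈ K | Star G c p x} : Finset V) | G.Adj z x} ≤ #{x ∈ K | G.Adj z x} :=
      card_le_card (filter_subset_filter _ (filter_subset _ _))
    omega
  · obtain ⟨z', hz', hc', hne⟩ := exists_ne_of_not_star hz hzs
    have hzfew' := few z' hz' (hc'.trans hc)
    have hsub : ({x ∈ K | G.Adj p x} : Finset V) ⊆
        ({x ∈ K | G.Adj z x} : Finset V) ∪ ({x ∈ K | G.Adj z' x} : Finset V) := by
      intro x hx
      rw [mem_filter] at hx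
      rw [mem_union, mem_filter, mem_filter]
      by_contra! hn
      have := hG.adj_of_not_adj hx.2 hz hz' (fun e => hzK z hz hc (e ▸ hx.1))
        (fun e => hzK z' hz' (hc'.trans hc) (e ▸ hx.1)) hne.symm
        (fun e => hn.1 hx.1 e.symm) (fun e => hn.2 hx.1 e.symm)
      exact h z z' hz.ne' hz'.ne' this hc'.symm
    have := (card_le_card hsub).trans (card_union_le _ _)
    omega

/-- The uniquely colored neighbors of the uncolored vertex do not form a clique. -/
lemma Near.exists_not_adj (hG : Critical G m) (hm : 8 ≤ m) {y : V} {c : V → Fin m}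
    (h : Near G y c) : ∃ a x, Star G c y a ∧ Star G c y x ∧ a ≠ x ∧ ¬ G.Adj a x := by
  by_contra! hn
  have hcl : G.IsClique (stars G c y : Set V) := by
    intro a ha x hx hax
    exact hn a x (mem_stars.1 ha) (mem_stars.1 hx) hax
  have hK := isClique_insert_of_forall hcl (p := y) fun x hx => (mem_stars.1 hx).1
  have hy : y ∉ stars G c y := fun e => (mem_stars.1 e).1.ne rfl
  have hKcard : #(insert y (stars G c y)) = #(stars G c y) + 1 := card_insert_of_notMem hy
  have hlt : #(stars G c y) + 1 < m + 1 := by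
    by_contra! hle
    exact hG.cliqueFree.mono hle _ ⟨hK, hKcard⟩
  by_cases hall : ∀ x, G.Adj y x → Star G c y x
  · have := h.card_stars_of_forall hG hall
    omega
  push Not at hall
  obtain ⟨p, hp, hps⟩ := hall
  obtain ⟨p', hp', hc, hne⟩ := exists_ne_of_not_star hp hps
  have hps' : ¬ Star G c y p' := fun e => hne (e.2 p hp hc.symm).symm
  have hcard := h.card_stars hG
  have notin : ∀ q, G.Adj y q → ¬ Star G c y q → q ∉ insert y (stars G c y) := by
    intro q hq hqs e
    rcases mem_insert.1 e with e | e
    · exact hq.ne' e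
    · exact hqs (mem_stars.1 e)
  have k1 := hG.card_adj_lt_four hm hK (by omega) (notin p hp hps)
  have k2 := hG.card_adj_lt_four hm hK (by omega) (notin p' hp' hps')
  have hsub : stars G c y ⊆ ({x ∈ insert y (stars G c y) | G.Adj p x} : Finset V) ∪
      ({x ∈ insert y (stars G c y) | G.Adj p' x} : Finset V) := by
    intro x hx
    have hxs := mem_stars.1 hx
    rw [mem_union, mem_filter, mem_filter]
    by_contra! hn
    have hx' := mem_insert_of_mem (b := y) hx
    have := hG.adj_of_not_adj hxs.1 hp hp' (fun e => hps (e ▸ hxs)) (fun e => hps' (e ▸ hxs))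
      hne.symm (fun e => hn.1 hx' e.symm) (fun e => hn.2 hx' e.symm)
    exact h p p' hp.ne' hp'.ne' this hc.symm
  have := (card_le_card hsub).trans (card_union_le _ _)
  omega

lemma Near.rep_unique (hG : Critical G m) {y t a b : V} {c : V → Fin m} (h : Near G y c)
    (ha : Rep G c y t a) (hb : Rep G c y t b) : a = b := by
  have := (h.near_shift ha.1).color_eq_of_not_star hG ha.2.2.1 hb.2.2.1 ha.2.2.2 hb.2.2.2
  rw [shift_of_ne _ ha.2.1.1.ne', shift_of_ne _ hb.2.1.1.ne'] at this
  exact hb.2.1.2 a ha.2.1.1 this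

/-- At most two common uniquely colored neighbors of `a` and `x` are not adjacent to the forward
neighbor of `x` in the color of `a`. -/
lemma Near.exists_adj_fwd (hG : Critical G m) {y a x s t₁ t₂ t₃ : V} {c : V → Fin m}
    (h : Near G y c) (ha : Star G c y a) (hx : Star G c y x) (hne : a ≠ x) (hax : ¬ G.Adj a x)
    (hs : Fwd G c y a x s) (h₁ : Star G c y t₁) (h₂ : Star G c y t₂) (h₃ : Star G c y t₃)
    (h12 : t₁ ≠ t₂) (h13 : t₁ ≠ t₃) (h23 : t₂ ≠ t₃)
    (a₁ : G.Adj a t₁) (a₂ : G.Adj a t₂) (a₃ : G.Adj a t₃)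
    (b₁ : G.Adj x t₁) (b₂ : G.Adj x t₂) (b₃ : G.Adj x t₃) :
    G.Adj t₁ s ∨ G.Adj t₂ s ∨ G.Adj t₃ s := by
  by_contra! hn
  have h' := h.near_shift hx
  have hay : a ≠ y := ha.1.ne'
  have hxa : ¬ G.Adj x a := fun e => hax e.symm
  have hcax : c a ≠ c x := fun e => hne (hx.2 a ha.1 e)
  have hy1 := h.star_shift_self hx
  have hy2 : Star G (shift (shift c y x) x y) y a := by
    refine ⟨ha.1, fun z hz hc => ?_⟩
    have hoff : ∀ z, z ≠ y → shift (shift c y x) x y z = c z := by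
      intro z hzy
      by_cases hzx : z = x
      · subst hzx
        simp
      · rw [shift_of_ne _ hzx, shift_of_ne _ hzy]
    rw [hoff z hz.ne', hoff a hay] at hc
    exact ha.2 z hz hc
  have good : ∀ t, G.Adj a t → ¬ G.Adj t s → Star G (shift c y x) x t →
      Star G (shift (shift c y x) x t) t a := by
    intro t hat hts hxt
    by_contra hnot
    obtain ⟨z, g1, g2, g3, g4⟩ := h'.exists_adj_of_not_star hG hne hxa hxt hat.symm hnot
    have hzy : z ≠ y := by
      rintro rfl
      rw [shift_self, shift_of_ne _ hay] at g4
      exact hcax g4.symm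
    rw [shift_of_ne _ hzy, shift_of_ne _ hay] at g4
    rw [h.fwd_unique hG ha hx hax hs g2 hzy g4] at g1
    exact hts g1
  have two_good : ∀ t t', Star G c y t → Star G c y t' → t ≠ t' → G.Adj a t → G.Adj a t' →
      ¬ G.Adj t s → ¬ G.Adj t' s → Star G (shift c y x) x t → ¬ Star G (shift c y x) x t' := by
    intro t t' ht ht' htt e1 e2 e3 e4 e5 e6
    exact h'.no_three hG hne hxa hy1 e5 e6 hy2 (good t e1 e3 e5) (good t' e2 e4 e6)
      ht.1.ne ht'.1.ne htt
  have two_bad : ∀ t t', Star G c y t → Star G c y t' → t ≠ t' → G.Adj x t → G.Adj x t' →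
      ¬ Star G (shift c y x) x t → Star G (shift c y x) x t' := by
    intro t t' ht ht' htt e1 e2 e3
    by_contra e4
    have := h'.color_eq_of_not_star hG e1 e2 e3 e4
    rw [shift_of_ne _ ht.1.ne', shift_of_ne _ ht'.1.ne'] at this
    exact htt (ht'.2 t ht.1 this)
  have p12 := two_good t₁ t₂ h₁ h₂ h12 a₁ a₂ hn.1 hn.2.1
  have p13 := two_good t₁ t₃ h₁ h₃ h13 a₁ a₃ hn.1 hn.2.2
  have p23 := two_good t₂ t₃ h₂ h₃ h23 a₂ a₃ hn.2.1 hn.2.2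
  have q12 := two_bad t₁ t₂ h₁ h₂ h12 b₁ b₂
  have q13 := two_bad t₁ t₃ h₁ h₃ h13 b₁ b₃
  have q23 := two_bad t₂ t₃ h₂ h₃ h23 b₂ b₃
  tauto

section Config

variable {α : Type*} {N : Finset α} {H D : α → α → Prop}

/-- The combinatorial pattern formed by the uniquely colored neighbors `N` of the uncolored vertex:
`H` is nonadjacency and `D t a` says that `t` sees the color of `a` twice. -/
structure Config (N : Finset α) (H D : α → α → Prop) : Prop where
  symm : ∀ a b, H a b → H b a
  triangle_free : ∀ a ∈ N, ∀ b ∈ N, ∀ c ∈ N, H a b → H a c → ¬ H b c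
  card_le : ∀ a ∈ N, #{z ∈ N | H a z} ≤ 2
  unique : ∀ t a b, D t a → D t b → a = b
  few : ∀ a ∈ N, ∀ x ∈ N, H a x → #{t ∈ N | ¬ H a t ∧ ¬ H x t ∧ ¬ D t a} ≤ 2
  exists_edge : ∃ a ∈ N, ∃ x ∈ N, H a x
  seven_le : 7 ≤ #N

namespace Config

lemma card_common (h : Config N H D) {a x : α} (ha : a ∈ N) (hx : x ∈ N) (hax : H a x) :
    #{t ∈ N | ¬ H a t ∧ ¬ H x t} + #{t ∈ N | H a t} + #{t ∈ N | H x t} = #N := by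
  have h1 := card_filter_add_card_filter_not (s := N) (fun t => H a t)
  have h2 := card_filter_add_card_filter_not (s := {t ∈ N | ¬ H a t}) (fun t => H x t)
  rw [filter_filter, filter_filter] at h2
  have h3 : ({t ∈ N | ¬ H a t ∧ H x t} : Finset α) = ({t ∈ N | H x t} : Finset α) := by
    refine filter_congr fun t ht => ⟨fun e => e.2, fun e => ⟨fun e' => ?_, e⟩⟩
    exact h.triangle_free a ha x hx t ht hax e' e
  rw [h3] at h2
  omega

lemma card_common_le (h : Config N H D) {a x : α} (ha : a ∈ N) (hax : H a x) (hx : x ∈ N) :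
    #{t ∈ N | ¬ H a t ∧ ¬ H x t} ≤ #{t ∈ N | ¬ H a t ∧ ¬ H x t ∧ D t a} + 2 := by
  have h1 := card_filter_add_card_filter_not (s := {t ∈ N | ¬ H a t ∧ ¬ H x t}) (fun t => D t a)
  rw [filter_filter, filter_filter] at h1
  simp only [and_assoc] at h1
  have := h.few a ha x hx hax
  omega

lemma card_add_card_le (h : Config N H D) {a x : α} (hne : a ≠ x) :
    #{t ∈ N | ¬ H a t ∧ ¬ H x t ∧ D t a} + #{t ∈ N | ¬ H a t ∧ ¬ H x t ∧ D t x} +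
      #{t ∈ N | ¬ H a t ∧ ¬ H x t ∧ ¬ D t a ∧ ¬ D t x} = #{t ∈ N | ¬ H a t ∧ ¬ H x t} := by
  have h1 := card_filter_add_card_filter_not (s := {t ∈ N | ¬ H a t ∧ ¬ H x t}) (fun t => D t a)
  have h2 := card_filter_add_card_filter_not (s := {t ∈ N | ¬ H a t ∧ ¬ H x t ∧ ¬ D t a})
    (fun t => D t x)
  rw [filter_filter, filter_filter] at h1 h2
  simp only [and_assoc] at h1 h2
  have h3 : ({t ∈ N | ¬ H a t ∧ ¬ H x t ∧ ¬ D t a ∧ D t x} : Finset α) =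
      ({t ∈ N | ¬ H a t ∧ ¬ H x t ∧ D t x} : Finset α) := by
    refine filter_congr fun t _ => ?_
    have := h.unique t a x
    tauto
  rw [h3] at h2
  omega

lemma common_symm (a x : α) (P : α → Prop) :
    #{t ∈ N | ¬ H x t ∧ ¬ H a t ∧ P t} = #{t ∈ N | ¬ H a t ∧ ¬ H x t ∧ P t} := by
  congr 1
  exact filter_congr fun t _ => by tauto

lemma ne_of_edge (h : Config N H D) {a x : α} (ha : a ∈ N) (hax : H a x) : a ≠ x := by
  rintro rfl
  exact h.triangle_free a ha a ha a ha hax hax hax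

/-- The common vertices of an edge `a x`, counted by the value they repeat. -/
lemma two_le_add (h : Config N H D) {a x : α} (ha : a ∈ N) (hx : x ∈ N) (hax : H a x) :
    #{t ∈ N | ¬ H a t ∧ ¬ H x t} ≤ #{t ∈ N | ¬ H a t ∧ ¬ H x t ∧ D t a} + 2 ∧
    #{t ∈ N | ¬ H a t ∧ ¬ H x t} ≤ #{t ∈ N | ¬ H a t ∧ ¬ H x t ∧ D t x} + 2 := by
  refine ⟨h.card_common_le ha hax hx, ?_⟩
  have := h.card_common_le hx (h.symm _ _ hax) ha
  rw [common_symm a x] at this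
  refine le_trans (le_of_eq ?_) this
  congr 1
  exact filter_congr fun t _ => by tauto

lemma card_eq_two (h : Config N H D) {a x : α} (ha : a ∈ N) (hx : x ∈ N) (hax : H a x) :
    #{t ∈ N | H a t} = 2 := by
  by_contra hne2
  have hxa := h.symm _ _ hax
  have hnax := h.ne_of_edge ha hax
  have hQ1 : #{t ∈ N | H a t} ≤ 1 := by
    have := h.card_le a ha
    omega
  have hQ : ∀ t ∈ N, H a t → t = x := fun t ht hat =>
    card_le_one.1 hQ1 t (mem_filter.2 ⟨ht, hat⟩) x (mem_filter.2 ⟨hx, hax⟩)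
  have h1 := h.card_common ha hx hax
  obtain ⟨h2, h3⟩ := h.two_le_add ha hx hax
  have h4 := h.card_add_card_le hnax
  have h5 := h.card_le x hx
  have h6 := h.seven_le
  have h7 : #{t ∈ N | H x t} = 2 := by omega
  obtain ⟨b, hb, hba⟩ := exists_mem_ne (by omega : 1 < #{t ∈ N | H x t}) a
  rw [mem_filter] at hb
  have g1 := h.card_common hx hb.1 hb.2
  have g2 := (h.two_le_add hx hb.1 hb.2).2
  have g3 := h.card_le b hb.1
  obtain ⟨t, ht⟩ := card_pos.1 (by omega : 0 < #{t ∈ N | ¬ H x t ∧ ¬ H b t ∧ D t b})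
  rw [mem_filter] at ht
  obtain ⟨t1, t2, t3, t4⟩ := ht
  have h8 : #{t ∈ N | ¬ H a t ∧ ¬ H x t ∧ ¬ D t a ∧ ¬ D t x} = 0 := by omega
  rw [card_filter_eq_zero_iff] at h8
  refine h8 t t1 ⟨fun e => ?_, t2, fun e => hba (h.unique t b a t4 e), fun e => ?_⟩
  · rw [hQ t t1 e] at t3
    exact t3 (h.symm _ _ hb.2)
  · exact h.ne_of_edge hx hb.2 (h.unique t x b e t4)

lemma card_eq_seven (h : Config N H D) : #N = 7 := by
  obtain ⟨a, ha, x, hx, hax⟩ := h.exists_edge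
  have hxa := h.symm _ _ hax
  have hnax := h.ne_of_edge ha hax
  have d1 := h.card_eq_two ha hx hax
  have d2 := h.card_eq_two hx ha hxa
  obtain ⟨b, hb, hba⟩ := exists_mem_ne (by omega : 1 < #{t ∈ N | H x t}) a
  rw [mem_filter] at hb
  obtain ⟨hbN, hxb⟩ := hb
  have d3 := h.card_eq_two hbN hx (h.symm _ _ hxb)
  have h1 := h.card_common ha hx hax
  obtain ⟨h2, h3⟩ := h.two_le_add ha hx hax
  have h4 := h.card_add_card_le hnax
  have g1 := h.card_common hx hbN hxb
  obtain ⟨g2, g3⟩ := h.two_le_add hx hbN hxb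
  have g4 := h.card_add_card_le (h.ne_of_edge hx hxb)
  have h5 := h.seven_le
  by_contra hne
  have h6 : #{t ∈ N | ¬ H a t ∧ ¬ H x t ∧ ¬ D t a ∧ ¬ D t x} = 0 := by omega
  have g6 : #{t ∈ N | ¬ H x t ∧ ¬ H b t ∧ ¬ D t x ∧ ¬ D t b} = 0 := by omega
  rw [card_filter_eq_zero_iff] at h6 g6
  have hsub : N ⊆ ({t ∈ N | ¬ H a t ∧ ¬ H x t ∧ D t x} : Finset α) ∪
      (({t ∈ N | H x t} : Finset α) ∪
        (({t ∈ N | H a t} : Finset α) ∪ ({t ∈ N | H b t} : Finset α).erase x)) := by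
    intro t ht
    simp only [mem_union, mem_filter, mem_erase]
    have e1 := h6 t ht
    have e2 := g6 t ht
    have e3 : D t a → D t b → False := fun e e' => hba (h.unique t b a e' e)
    have e4 : t = x → H a t := fun e => e ▸ hax
    clear * - ht e1 e2 e3 e4
    grind
  have k1 := card_le_card hsub
  have k2 := card_union_le ({t ∈ N | ¬ H a t ∧ ¬ H x t ∧ D t x} : Finset α)
    (({t ∈ N | H x t} : Finset α) ∪
        (({t ∈ N | H a t} : Finset α) ∪ ({t ∈ N | H b t} : Finset α).erase x))
  have k3 := card_union_le ({t ∈ N | H x t} : Finset α)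
    (({t ∈ N | H a t} : Finset α) ∪ ({t ∈ N | H b t} : Finset α).erase x)
  have k4 := card_union_le ({t ∈ N | H a t} : Finset α) (({t ∈ N | H b t} : Finset α).erase x)
  have k5 := card_erase_of_mem
    (mem_filter.2 ⟨hx, h.symm _ _ hxb⟩ : x ∈ ({t ∈ N | H b t} : Finset α))
  omega

/-- Some common vertex of an edge repeats the first end. -/
lemma exists_rep (h : Config N H D) {a x : α} (ha : a ∈ N) (hx : x ∈ N) (hax : H a x) :
    ∃ t ∈ N, ¬ H a t ∧ ¬ H x t ∧ D t a := by
  have h1 := h.card_common ha hx hax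
  have h2 := (h.two_le_add ha hx hax).1
  have d1 := h.card_eq_two ha hx hax
  have d2 := h.card_eq_two hx ha (h.symm _ _ hax)
  have d3 := h.card_eq_seven
  obtain ⟨t, ht⟩ := card_pos.1 (by omega : 0 < #{t ∈ N | ¬ H a t ∧ ¬ H x t ∧ D t a})
  exact ⟨t, mem_filter.1 ht⟩

/-- Every vertex on an edge has exactly one further neighbor. -/
lemma exists_other (h : Config N H D) {a x : α} (ha : a ∈ N) (hx : x ∈ N) (hax : H a x) :
    ∃ b ∈ N, b ≠ x ∧ H a b ∧ ∀ z ∈ N, H a z → z = x ∨ z = b := by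
  have d1 := h.card_eq_two ha hx hax
  obtain ⟨b, hb, hbx⟩ := exists_mem_ne (by omega : 1 < #{t ∈ N | H a t}) x
  rw [mem_filter] at hb
  refine ⟨b, hb.1, hbx, hb.2, fun z hz haz => ?_⟩
  by_contra! hn
  have : 2 < #{t ∈ N | H a t} := two_lt_card_iff.2
    ⟨z, x, b, mem_filter.2 ⟨hz, haz⟩, mem_filter.2 ⟨hx, hax⟩, mem_filter.2 hb, hn.1, hn.2, hbx.symm⟩
  omega

lemma card_sdiff_list {l : List α} (hl : l.Nodup) (hN : ∀ z ∈ l, z ∈ N) :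
    #(N \ l.toFinset) + l.length = #N := by
  rw [← List.toFinset_card_of_nodup hl]
  exact card_sdiff_add_card_eq_card fun z hz => hN z (List.mem_toFinset.1 hz)

lemma not_square (h : Config N H D) {v₀ v₁ v₂ v₃ : α} (m₀ : v₀ ∈ N) (m₁ : v₁ ∈ N) (m₂ : v₂ ∈ N)
    (m₃ : v₃ ∈ N) (n₀₂ : v₀ ≠ v₂) (n₁₃ : v₁ ≠ v₃) (e₀₁ : H v₀ v₁) (e₁₂ : H v₁ v₂) (e₂₃ : H v₂ v₃)
    (e₃₀ : H v₃ v₀) : False := by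
  obtain ⟨t₀, p₀, q₀, r₀, d₀⟩ := h.exists_rep m₀ m₁ e₀₁
  obtain ⟨t₁, p₁, q₁, r₁, d₁⟩ := h.exists_rep m₁ m₂ e₁₂
  obtain ⟨t₂, p₂, q₂, r₂, d₂⟩ := h.exists_rep m₂ m₃ e₂₃
  obtain ⟨t₃, p₃, q₃, r₃, d₃⟩ := h.exists_rep m₃ m₀ e₃₀
  have n₀₁ := h.ne_of_edge m₀ e₀₁
  have n₁₂ := h.ne_of_edge m₁ e₁₂
  have n₂₃ := h.ne_of_edge m₂ e₂₃
  have n₃₀ := h.ne_of_edge m₃ e₃₀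
  have hsymm := h.symm
  have huniq := h.unique
  have := card_sdiff_list (N := N) (l := [v₀, v₁, v₂, v₃, t₀, t₁, t₂, t₃])
    (by
      simp only [List.nodup_cons, List.mem_cons, List.not_mem_nil, not_or]
      split_ands <;> grind)
    (by simp only [List.mem_cons, List.not_mem_nil]; grind)
  have h7 := h.card_eq_seven
  simp at this
  omega

lemma not_pentagon (h : Config N H D) {v₀ v₁ v₂ v₃ v₄ : α} (m₀ : v₀ ∈ N) (m₁ : v₁ ∈ N)
    (m₂ : v₂ ∈ N) (m₃ : v₃ ∈ N) (m₄ : v₄ ∈ N) (hnd : [v₀, v₁, v₂, v₃, v₄].Nodup)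
    (e₀₁ : H v₀ v₁) (e₁₂ : H v₁ v₂) (e₂₃ : H v₂ v₃) (e₃₄ : H v₃ v₄) (e₄₀ : H v₄ v₀) : False := by
  have hcard := card_sdiff_list (N := N) hnd
    (by simp only [List.mem_cons, List.not_mem_nil]; grind)
  rw [h.card_eq_seven, List.length_cons, List.length_cons, List.length_cons, List.length_cons,
    List.length_cons, List.length_nil] at hcard
  obtain ⟨o, o', -, ho⟩ := Finset.card_eq_two.1
    (by omega : #(N \ [v₀, v₁, v₂, v₃, v₄].toFinset) = 2)
  have hmem : ∀ z ∈ N, z = v₀ ∨ z = v₁ ∨ z = v₂ ∨ z = v₃ ∨ z = v₄ ∨ z = o ∨ z = o' := by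
    intro z hz
    by_contra! hn
    have : z ∈ N \ [v₀, v₁, v₂, v₃, v₄].toFinset := by
      simp [hz, hn]
    rw [ho] at this
    simp [hn] at this
  have key : ∀ {a b c d e : α}, a ∈ N → b ∈ N → H a b → H b c → H d e → H e a →
      (∀ z ∈ N, z = a ∨ z = b ∨ z = c ∨ z = d ∨ z = e ∨ z = o ∨ z = o') →
      (D d a ∨ D o a ∨ D o' a) ∧ (D d b ∨ D o b ∨ D o' b) := by
    intro a b c d e ha hb hab hbc hde hea hall
    obtain ⟨t, p, q, r, s⟩ := h.exists_rep ha hb hab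
    obtain ⟨t', p', q', r', s'⟩ := h.exists_rep hb ha (h.symm _ _ hab)
    have g1 := h.symm _ _ hab
    have g2 := h.symm _ _ hea
    have k1 := hall t p
    have k2 := hall t' p'
    constructor <;> grind
  have r₀ := key m₀ m₁ e₀₁ e₁₂ e₃₄ e₄₀ (by grind)
  have r₁ := key m₁ m₂ e₁₂ e₂₃ e₄₀ e₀₁ (by grind)
  have r₂ := key m₂ m₃ e₂₃ e₃₄ e₀₁ e₁₂ (by grind)
  have r₃ := key m₃ m₄ e₃₄ e₄₀ e₁₂ e₂₃ (by grind)
  have r₄ := key m₄ m₀ e₄₀ e₀₁ e₂₃ e₃₄ (by grind)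
  have huniq := h.unique
  simp only [List.nodup_cons, List.mem_cons, List.not_mem_nil, not_or] at hnd
  clear hmem key ho hcard m₀ m₁ m₂ m₃ m₄ e₀₁ e₁₂ e₂₃ e₃₄ e₄₀
  grind

/-- The graph `H` on `N` is a cycle `v₁ v₂ v₃ v₄ v₅ v₆` together with an isolated vertex `o`. -/
structure Hexagon (N : Finset α) (H : α → α → Prop) (v₁ v₂ v₃ v₄ v₅ v₆ o : α) : Prop where
  mem_iff : ∀ z, z ∈ N ↔ z = v₁ ∨ z = v₂ ∨ z = v₃ ∨ z = v₄ ∨ z = v₅ ∨ z = v₆ ∨ z = o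
  nodup : [v₁, v₂, v₃, v₄, v₅, v₆, o].Nodup
  adj₁ : ∀ z ∈ N, H v₁ z ↔ z = v₂ ∨ z = v₆
  adj₂ : ∀ z ∈ N, H v₂ z ↔ z = v₃ ∨ z = v₁
  adj₃ : ∀ z ∈ N, H v₃ z ↔ z = v₄ ∨ z = v₂
  adj₄ : ∀ z ∈ N, H v₄ z ↔ z = v₅ ∨ z = v₃
  adj₅ : ∀ z ∈ N, H v₅ z ↔ z = v₆ ∨ z = v₄
  adj₆ : ∀ z ∈ N, H v₆ z ↔ z = v₁ ∨ z = v₅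
  not_adj : ∀ z ∈ N, ¬ H o z

variable {v₁ v₂ v₃ v₄ v₅ v₆ o : α}

lemma Hexagon.rotate
    (h : Hexagon N H v₁ v₂ v₃ v₄ v₅ v₆ o) : Hexagon N H v₂ v₃ v₄ v₅ v₆ v₁ o where
  mem_iff z := (h.mem_iff z).trans (by tauto)
  nodup := by
    have := h.nodup
    simp only [List.nodup_cons, List.mem_cons, List.not_mem_nil, not_or] at this ⊢
    grind
  adj₁ := h.adj₂
  adj₂ := h.adj₃
  adj₃ := h.adj₄
  adj₄ := h.adj₅
  adj₅ := h.adj₆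
  adj₆ := h.adj₁
  not_adj := h.not_adj

lemma Hexagon.rep (hx : Hexagon N H v₁ v₂ v₃ v₄ v₅ v₆ o) (h : Config N H D) :
    (D v₄ v₁ ∨ D v₅ v₁ ∨ D o v₁) ∧ (D v₄ v₂ ∨ D v₅ v₂ ∨ D o v₂) := by
  have m₁ : v₁ ∈ N := by simp [hx.mem_iff]
  have m₂ : v₂ ∈ N := by simp [hx.mem_iff]
  have e : H v₁ v₂ := by simp [hx.adj₁ _ m₂]
  obtain ⟨t, p, q, r, s⟩ := h.exists_rep m₁ m₂ e
  obtain ⟨t', p', q', r', s'⟩ := h.exists_rep m₂ m₁ (h.symm _ _ e)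
  rw [hx.adj₁ _ p] at q
  rw [hx.adj₂ _ p] at r
  rw [hx.adj₂ _ p'] at q'
  rw [hx.adj₁ _ p'] at r'
  have k := (hx.mem_iff t).1 p
  have k' := (hx.mem_iff t').1 p'
  clear hx h
  constructor <;> grind

/-- A hexagon can be labeled so that the repeated values are determined. -/
lemma Hexagon.values (hx : Hexagon N H v₁ v₂ v₃ v₄ v₅ v₆ o) (h : Config N H D)
    (ho : ∀ a, D o a → a ≠ v₁ ∧ a ≠ v₂ ∧ a ≠ v₃ ∧ a ≠ v₄ ∧ a ≠ v₅) :
    D v₄ v₁ ∧ D v₅ v₂ ∧ D v₆ v₃ ∧ D v₂ v₅ ∧ ¬ D o v₁ ∧ ¬ D o v₃ := by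
  have r₁ := hx.rep h
  have r₂ := hx.rotate.rep h
  have r₃ := hx.rotate.rotate.rep h
  have r₄ := hx.rotate.rotate.rotate.rep h
  have o₁ : ¬ D o v₁ := fun e => (ho _ e).1 rfl
  have o₂ : ¬ D o v₂ := fun e => (ho _ e).2.1 rfl
  have o₃ : ¬ D o v₃ := fun e => (ho _ e).2.2.1 rfl
  have o₄ : ¬ D o v₄ := fun e => (ho _ e).2.2.2.1 rfl
  have o₅ : ¬ D o v₅ := fun e => (ho _ e).2.2.2.2 rfl
  have hnd := hx.nodup
  have hu := h.unique
  simp only [List.nodup_cons, List.mem_cons, List.not_mem_nil, not_or] at hnd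
  clear hx h ho
  grind

lemma Hexagon.exists_values (hx : Hexagon N H v₁ v₂ v₃ v₄ v₅ v₆ o) (h : Config N H D) :
    ∃ v₁ v₂ v₃ v₄ v₅ v₆ o, Hexagon N H v₁ v₂ v₃ v₄ v₅ v₆ o ∧
      D v₄ v₁ ∧ D v₅ v₂ ∧ D v₆ v₃ ∧ D v₂ v₅ ∧ ¬ D o v₁ ∧ ¬ D o v₃ := by
  have hnd := hx.nodup
  simp only [List.nodup_cons, List.mem_cons, List.not_mem_nil, not_or] at hnd
  have hu := h.unique o
  by_cases c₁ : D o v₁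
  · exact ⟨_, _, _, _, _, _, _, hx.rotate, hx.rotate.values h fun a ha => by
      rw [hu a v₁ ha c₁]; grind⟩
  by_cases c₂ : D o v₂
  · exact ⟨_, _, _, _, _, _, _, hx.rotate.rotate, hx.rotate.rotate.values h fun a ha => by
      rw [hu a v₂ ha c₂]; grind⟩
  by_cases c₃ : D o v₃
  · exact ⟨_, _, _, _, _, _, _, hx.rotate.rotate.rotate,
      hx.rotate.rotate.rotate.values h fun a ha => by rw [hu a v₃ ha c₃]; grind⟩
  by_cases c₄ : D o v₄
  · exact ⟨_, _, _, _, _, _, _, hx.rotate.rotate.rotate.rotate,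
      hx.rotate.rotate.rotate.rotate.values h fun a ha => by rw [hu a v₄ ha c₄]; grind⟩
  by_cases c₅ : D o v₅
  · exact ⟨_, _, _, _, _, _, _, hx.rotate.rotate.rotate.rotate.rotate,
      hx.rotate.rotate.rotate.rotate.rotate.values h fun a ha => by rw [hu a v₅ ha c₅]; grind⟩
  · exact ⟨_, _, _, _, _, _, _, hx, hx.values h fun a ha => by
      split_ands <;> (rintro rfl; contradiction)⟩

/-- The graph `H` on `N` is a hexagon with an isolated vertex, or a heptagon. -/
lemma hexagon_or_heptagon (h : Config N H D) :
    (∃ v₁ v₂ v₃ v₄ v₅ v₆ o, Hexagon N H v₁ v₂ v₃ v₄ v₅ v₆ o) ∨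
    ∃ v₁ v₂ v₃ v₄ v₅ v₆ v₇, (∀ z, z ∈ N ↔ z ∈ [v₁, v₂, v₃, v₄, v₅, v₆, v₇]) ∧
      H v₁ v₂ ∧ H v₂ v₃ ∧ H v₃ v₄ ∧ H v₄ v₅ ∧ H v₅ v₆ ∧ H v₆ v₇ ∧ H v₇ v₁ := by
  obtain ⟨v₁, m₁, v₂, m₂, e₁₂⟩ := h.exists_edge
  have h7 := h.card_eq_seven
  have e₂₁ := h.symm _ _ e₁₂
  obtain ⟨v₃, m₃, n₃₁, e₂₃, q₂⟩ := h.exists_other m₂ m₁ e₂₁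
  have e₃₂ := h.symm _ _ e₂₃
  obtain ⟨w, mw, nw, e₁w, q₁⟩ := h.exists_other m₁ m₂ e₁₂
  have ew₁ := h.symm _ _ e₁w
  obtain ⟨v₄, m₄, n₄₂, e₃₄, q₃⟩ := h.exists_other m₃ m₂ e₃₂
  have e₄₃ := h.symm _ _ e₃₄
  have n₁₂ := h.ne_of_edge m₁ e₁₂
  have n₂₃ := h.ne_of_edge m₂ e₂₃
  have n₃₄ := h.ne_of_edge m₃ e₃₄
  have hw₃ : w ≠ v₃ := by
    rintro rfl
    exact h.triangle_free _ m₁ _ m₂ _ mw e₁₂ e₁w e₂₃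
  have n₄₁ : v₄ ≠ v₁ := by
    rintro rfl
    exact h.triangle_free _ m₁ _ m₂ _ m₃ e₁₂ e₄₃ e₂₃
  have hw₄ : w ≠ v₄ := by
    rintro rfl
    exact h.not_square m₁ m₂ m₃ mw n₃₁.symm nw.symm e₁₂ e₂₃ e₃₄ ew₁
  obtain ⟨v₅, m₅, n₅₃, e₄₅, q₄⟩ := h.exists_other m₄ m₃ e₄₃
  have e₅₄ := h.symm _ _ e₄₅
  have n₄₅ := h.ne_of_edge m₄ e₄₅
  have n₅₁ : v₅ ≠ v₁ := by
    rintro rfl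
    have := q₁ v₄ m₄ e₅₄
    grind
  have n₅₂ : v₅ ≠ v₂ := by
    rintro rfl
    have := q₂ v₄ m₄ e₅₄
    grind
  have hw₅ : w ≠ v₅ := by
    rintro rfl
    refine h.not_pentagon m₁ m₂ m₃ m₄ mw ?_ e₁₂ e₂₃ e₃₄ e₄₅ ew₁
    simp only [List.nodup_cons, List.mem_cons, List.not_mem_nil, not_or]
    grind
  obtain ⟨v₆, m₆, n₆₄, e₅₆, q₅⟩ := h.exists_other m₅ m₄ e₅₄
  have e₆₅ := h.symm _ _ e₅₆
  have n₅₆ := h.ne_of_edge m₅ e₅₆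
  have n₆₁ : v₆ ≠ v₁ := by
    rintro rfl
    have := q₁ v₅ m₅ e₆₅
    grind
  have n₆₂ : v₆ ≠ v₂ := by
    rintro rfl
    have := q₂ v₅ m₅ e₆₅
    grind
  have n₆₃ : v₆ ≠ v₃ := by
    rintro rfl
    have := q₃ v₅ m₅ e₆₅
    grind
  have hnd : [v₁, v₂, v₃, v₄, v₅, v₆].Nodup := by
    simp only [List.nodup_cons, List.mem_cons, List.not_mem_nil, not_or]
    grind
  have hcard := card_sdiff_list (N := N) hnd
    (by simp only [List.mem_cons, List.not_mem_nil]; grind)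
  simp only [h7, List.length_cons, List.length_nil] at hcard
  obtain ⟨o, ho⟩ := card_eq_one.1 (by omega : #(N \ [v₁, v₂, v₃, v₄, v₅, v₆].toFinset) = 1)
  have hmem : ∀ z, z ∈ N ↔
      z = v₁ ∨ z = v₂ ∨ z = v₃ ∨ z = v₄ ∨ z = v₅ ∨ z = v₆ ∨ z = o := by
    intro z
    have h1 : z ∈ N \ [v₁, v₂, v₃, v₄, v₅, v₆].toFinset ↔ z = o := by rw [ho, mem_singleton]
    rw [mem_sdiff, List.mem_toFinset] at h1
    simp only [List.mem_cons, List.not_mem_nil, or_false] at h1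
    constructor
    · tauto
    · rintro (rfl | rfl | rfl | rfl | rfl | rfl | e) <;> tauto
  have hoN : o ∈ N ∧ o ≠ v₁ ∧ o ≠ v₂ ∧ o ≠ v₃ ∧ o ≠ v₄ ∧ o ≠ v₅ ∧ o ≠ v₆ := by
    have h1 : o ∈ N \ [v₁, v₂, v₃, v₄, v₅, v₆].toFinset := by rw [ho]; exact mem_singleton_self o
    rw [mem_sdiff, List.mem_toFinset] at h1
    simpa only [List.mem_cons, List.not_mem_nil, or_false, not_or] using h1
  obtain ⟨mo, o₁, o₂, o₃, o₄, o₅, o₆⟩ := hoN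
  obtain ⟨u, mu, nu, e₆u, q₆⟩ := h.exists_other m₆ m₅ e₆₅
  have eu₆ := h.symm _ _ e₆u
  rcases (hmem w).1 mw with rfl | rfl | rfl | rfl | rfl | rfl | rfl
  · exact absurd rfl (h.ne_of_edge m₁ e₁w)
  · exact absurd rfl nw
  · exact absurd rfl hw₃
  · exact absurd rfl hw₄
  · exact absurd rfl hw₅
  · left
    have hu₁ := q₆ v₁ m₁ ew₁
    have hu : v₁ = u := by grind
    subst hu
    refine ⟨v₁, v₂, v₃, v₄, v₅, w, o, hmem, ?_, ?_, ?_, ?_, ?_, ?_, ?_, ?_⟩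
    · simp only [List.nodup_cons, List.mem_cons, List.not_mem_nil, not_or]
      split_ands <;> grind
    · exact fun z hz => ⟨q₁ z hz, by rintro (rfl | rfl) <;> assumption⟩
    · exact fun z hz => ⟨fun e => (q₂ z hz e).symm, by rintro (rfl | rfl) <;> assumption⟩
    · exact fun z hz => ⟨fun e => (q₃ z hz e).symm, by rintro (rfl | rfl) <;> assumption⟩
    · exact fun z hz => ⟨fun e => (q₄ z hz e).symm, by rintro (rfl | rfl) <;> assumption⟩
    · exact fun z hz => ⟨fun e => (q₅ z hz e).symm, by rintro (rfl | rfl) <;> assumption⟩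
    · exact fun z hz => ⟨fun e => (q₆ z hz e).symm, by rintro (rfl | rfl) <;> assumption⟩
    · intro z hz e
      have e' := h.symm _ _ e
      have hne := h.ne_of_edge mo e
      rcases (hmem z).1 hz with rfl | rfl | rfl | rfl | rfl | rfl | rfl
      · have := q₁ o mo e'; grind
      · have := q₂ o mo e'; grind
      · have := q₃ o mo e'; grind
      · have := q₄ o mo e'; grind
      · have := q₅ o mo e'; grind
      · have := q₆ o mo e'; grind
      · exact hne rfl
  · right
    have hu : u = w := by
      rcases (hmem u).1 mu with rfl | rfl | rfl | rfl | rfl | rfl | rfl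
      · have := q₁ v₆ m₆ eu₆; grind
      · have := q₂ v₆ m₆ eu₆; grind
      · have := q₃ v₆ m₆ eu₆; grind
      · have := q₄ v₆ m₆ eu₆; grind
      · exact absurd rfl nu
      · exact absurd rfl (h.ne_of_edge m₆ e₆u)
      · rfl
    subst hu
    refine ⟨v₁, v₂, v₃, v₄, v₅, v₆, u, fun z => ?_, e₁₂, e₂₃, e₃₄, e₄₅, e₅₆, e₆u, ew₁⟩
    rw [hmem z]
    simp only [List.mem_cons, List.not_mem_nil, or_false]

/-- Two distinct vertices are not both isolated. -/
lemma exists_adj_of_ne (h : Config N H D) {a b : α} (ha : a ∈ N) (hb : b ∈ N) (hab : a ≠ b) :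
    ∃ z ∈ N, H a z ∨ H b z := by
  rcases h.hexagon_or_heptagon with ⟨v₁, v₂, v₃, v₄, v₅, v₆, o, hx⟩ |
    ⟨v₁, v₂, v₃, v₄, v₅, v₆, v₇, hmem, e⟩
  · have key : ∀ a ∈ N, a ≠ o → ∃ z ∈ N, H a z := by
      intro a ha hao
      have hm := hx.mem_iff
      rcases (hm a).1 ha with rfl | rfl | rfl | rfl | rfl | rfl | rfl
      · exact ⟨v₂, by simp [hm], by simp [hx.adj₁ v₂ (by simp [hm])]⟩
      · exact ⟨v₃, by simp [hm], by simp [hx.adj₂ v₃ (by simp [hm])]⟩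
      · exact ⟨v₄, by simp [hm], by simp [hx.adj₃ v₄ (by simp [hm])]⟩
      · exact ⟨v₅, by simp [hm], by simp [hx.adj₄ v₅ (by simp [hm])]⟩
      · exact ⟨v₆, by simp [hm], by simp [hx.adj₅ v₆ (by simp [hm])]⟩
      · exact ⟨v₁, by simp [hm], by simp [hx.adj₆ v₁ (by simp [hm])]⟩
      · exact absurd rfl hao
    by_cases hao : a = o
    · obtain ⟨z, hz, hbz⟩ := key b hb (fun e => hab (hao.trans e.symm))
      exact ⟨z, hz, Or.inr hbz⟩
    · obtain ⟨z, hz, haz⟩ := key a ha hao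
      exact ⟨z, hz, Or.inl haz⟩
  · have ha' := (hmem a).1 ha
    simp only [List.mem_cons, List.not_mem_nil, or_false] at ha' hmem
    rcases ha' with rfl | rfl | rfl | rfl | rfl | rfl | rfl
    · exact ⟨v₂, by simp [hmem], by tauto⟩
    · exact ⟨v₃, by simp [hmem], by tauto⟩
    · exact ⟨v₄, by simp [hmem], by tauto⟩
    · exact ⟨v₅, by simp [hmem], by tauto⟩
    · exact ⟨v₆, by simp [hmem], by tauto⟩
    · exact ⟨v₇, by simp [hmem], by tauto⟩
    · exact ⟨v₁, by simp [hmem], by tauto⟩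

lemma forall_exists_rep (h : Config N H D) (hno : ∀ a ∈ N, ∃ x ∈ N, H a x) :
    ∀ t ∈ N, ∃ a, D t a := by
  have hrep : ∀ a ∈ N, ∃ t ∈ N, D t a := by
    intro a ha
    obtain ⟨x, hx, hax⟩ := hno a ha
    obtain ⟨t, ht, -, -, hta⟩ := h.exists_rep ha hx hax
    exact ⟨t, ht, hta⟩
  obtain ⟨a₀, -⟩ := h.exists_edge
  have : Nonempty α := ⟨a₀⟩
  choose! f hf using hrep
  have hinj : Set.InjOn f (N : Set α) := fun a ha b hb hab =>
    h.unique (f a) a b (hf a ha).2 (hab ▸ (hf b hb).2)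
  have himg : N.image f = N := eq_of_subset_of_card_le
    (image_subset_iff.2 fun a ha => (hf a ha).1) (card_image_of_injOn hinj).ge
  intro t ht
  rw [← himg, mem_image] at ht
  obtain ⟨a, ha, rfl⟩ := ht
  exact ⟨a, (hf a ha).2⟩

end Config

end Config

/-- Distinct and nonadjacent. -/
def NonAdj (G : SimpleGraph V) (a b : V) : Prop := a ≠ b ∧ ¬ G.Adj a b

lemma Near.config (hG : Critical G m) (hm : 8 ≤ m) {y : V} {c : V → Fin m} (h : Near G y c) :
    Config (stars G c y) (NonAdj G) (Rep G c y) where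
  symm a b hab := ⟨hab.1.symm, fun e => hab.2 e.symm⟩
  triangle_free a ha b hb d hd hab had hbd :=
    hbd.2 (hG.adj_of_not_adj (mem_stars.1 ha).1 (mem_stars.1 hb).1 (mem_stars.1 hd).1
      hab.1 had.1 hbd.1 hab.2 had.2)
  card_le a ha := by
    by_contra hlt
    obtain ⟨x₁, x₂, x₃, h₁, h₂, h₃, h12, h13, h23⟩ := two_lt_card_iff.1 (not_le.1 hlt)
    rw [mem_filter, mem_stars] at h₁ h₂ h₃
    exact h.no_three_nonadj hG (mem_stars.1 ha) h₁.1 h₂.1 h₃.1 h₁.2.1 h₂.2.1 h₃.2.1 h12 h13 h23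
      h₁.2.2 h₂.2.2 h₃.2.2
  unique t a b ha hb := h.rep_unique hG ha hb
  few a ha x hx hax := by
    by_contra hlt
    obtain ⟨t₁, t₂, t₃, h₁, h₂, h₃, h12, h13, h23⟩ := two_lt_card_iff.1 (not_le.1 hlt)
    rw [mem_filter, mem_stars] at h₁ h₂ h₃
    rw [mem_stars] at ha hx
    obtain ⟨s, hs⟩ := h.exists_fwd hG ha hx hax.1 hax.2
    have hxa : NonAdj G x a := ⟨hax.1.symm, fun e => hax.2 e.symm⟩
    have adj : ∀ t, ¬ NonAdj G a t ∧ ¬ NonAdj G x t → G.Adj a t ∧ G.Adj x t := by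
      intro t ht
      have h1 : a ≠ t := fun e => ht.2 (e ▸ hxa)
      have h2 : x ≠ t := fun e => ht.1 (e ▸ hax)
      simp only [NonAdj] at ht
      tauto
    have a₁ := adj t₁ ⟨h₁.2.1, h₁.2.2.1⟩
    have a₂ := adj t₂ ⟨h₂.2.1, h₂.2.2.1⟩
    have a₃ := adj t₃ ⟨h₃.2.1, h₃.2.2.1⟩
    rcases h.exists_adj_fwd hG ha hx hax.1 hax.2 hs h₁.1 h₂.1 h₃.1 h12 h13 h23 a₁.1 a₂.1 a₃.1
      a₁.2 a₂.2 a₃.2 with e | e | e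
    · exact h₁.2.2.2 (rep_of_adj_fwd h₁.1 ha a₁.1.symm hs e)
    · exact h₂.2.2.2 (rep_of_adj_fwd h₂.1 ha a₂.1.symm hs e)
    · exact h₃.2.2.2 (rep_of_adj_fwd h₃.1 ha a₃.1.symm hs e)
  exists_edge := by
    obtain ⟨a, x, ha, hx, hne, hax⟩ := h.exists_not_adj hG hm
    exact ⟨a, mem_stars.2 ha, x, mem_stars.2 hx, hne, hax⟩
  seven_le := by
    have := h.card_stars hG
    omega

lemma Near.not_heptagon (hG : Critical G m) (hm : 8 ≤ m) {y : V} {c : V → Fin m} (h : Near G y c)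
    {v₁ v₂ v₃ v₄ v₅ v₆ v₇ : V}
    (hmem : ∀ z, z ∈ stars G c y ↔ z ∈ [v₁, v₂, v₃, v₄, v₅, v₆, v₇])
    (e₁ : NonAdj G v₁ v₂) (e₂ : NonAdj G v₂ v₃) (e₃ : NonAdj G v₃ v₄) (e₄ : NonAdj G v₄ v₅)
    (e₅ : NonAdj G v₅ v₆) (e₆ : NonAdj G v₆ v₇) (e₇ : NonAdj G v₇ v₁) : False := by
  have hC := h.config hG hm
  simp only [List.mem_cons, List.not_mem_nil, or_false] at hmem
  have hrep := hC.forall_exists_rep (by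
    intro a ha
    rcases (hmem a).1 ha with rfl | rfl | rfl | rfl | rfl | rfl | rfl
    · exact ⟨v₂, by simp [hmem], e₁⟩
    · exact ⟨v₃, by simp [hmem], e₂⟩
    · exact ⟨v₄, by simp [hmem], e₃⟩
    · exact ⟨v₅, by simp [hmem], e₄⟩
    · exact ⟨v₆, by simp [hmem], e₅⟩
    · exact ⟨v₇, by simp [hmem], e₆⟩
    · exact ⟨v₁, by simp [hmem], e₇⟩)
  have hex : ∃ p, G.Adj y p ∧ ¬ Star G c y p := by
    by_contra! hn
    have h1 := h.card_stars_of_forall hG hn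
    have h2 := hC.card_eq_seven
    omega
  obtain ⟨p, hp, hps⟩ := hex
  obtain ⟨p', hp', hc, hne⟩ := exists_ne_of_not_star hp hps
  have hps' : ¬ Star G c y p' := fun e => hne (e.2 p hp hc.symm).symm
  have hpp : ¬ G.Adj p p' := fun e => h p p' hp.ne' hp'.ne' e hc.symm
  have one : ∀ t ∈ stars G c y, (G.Adj p t ↔ ¬ G.Adj p' t) := by
    intro t ht
    have hts := mem_stars.1 ht
    obtain ⟨a, ha⟩ := hrep t ht
    constructor
    · intro g1 g2
      have hnot : ¬ Star G (shift c y t) t p := fun e => hne (e.2 p' g2.symm (by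
        rw [shift_of_ne _ hp'.ne', shift_of_ne _ hp.ne', hc]))
      have := (h.near_shift hts).color_eq_of_not_star hG g1.symm ha.2.2.1 hnot ha.2.2.2
      rw [shift_of_ne _ hp.ne', shift_of_ne _ ha.2.1.1.ne'] at this
      exact hps (ha.2.1.2 p hp this ▸ ha.2.1)
    · intro g
      by_contra g'
      exact hpp (hG.adj_of_not_adj hts.1 hp hp' (fun e => hps (e ▸ hts)) (fun e => hps' (e ▸ hts))
        hne.symm (fun e => g' e.symm) (fun e => g e.symm))
  have cover : ∀ q, G.Adj y q → ¬ Star G c y q → ∀ u ∈ stars G c y, ∀ w ∈ stars G c y,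
      NonAdj G u w → G.Adj q u ∨ G.Adj q w := by
    intro q hq hqs u hu w hw huw
    rw [mem_stars] at hu hw
    by_contra! hn
    exact huw.2 (hG.adj_of_not_adj hq hu.1 hw.1 (fun e => hqs (e ▸ hu)) (fun e => hqs (e ▸ hw))
      huw.1 hn.1 hn.2)
  have alt : ∀ u ∈ stars G c y, ∀ w ∈ stars G c y, NonAdj G u w →
      (G.Adj p u ↔ ¬ G.Adj p w) := by
    intro u hu w hw huw
    have := cover p hp hps u hu w hw huw
    have := cover p' hp' hps' u hu w hw huw
    have := one u hu
    have := one w hw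
    tauto
  have a₁ := alt v₁ (by simp [hmem]) v₂ (by simp [hmem]) e₁
  have a₂ := alt v₂ (by simp [hmem]) v₃ (by simp [hmem]) e₂
  have a₃ := alt v₃ (by simp [hmem]) v₄ (by simp [hmem]) e₃
  have a₄ := alt v₄ (by simp [hmem]) v₅ (by simp [hmem]) e₄
  have a₅ := alt v₅ (by simp [hmem]) v₆ (by simp [hmem]) e₅
  have a₆ := alt v₆ (by simp [hmem]) v₇ (by simp [hmem]) e₆
  have a₇ := alt v₇ (by simp [hmem]) v₁ (by simp [hmem]) e₇
  clear alt cover one hmem hrep hC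
  grind

lemma Near.not_hexagon (hG : Critical G m) (hm : 8 ≤ m) {y : V} {c : V → Fin m} (h : Near G y c)
    {v₁ v₂ v₃ v₄ v₅ v₆ o : V} (hx : Config.Hexagon (stars G c y) (NonAdj G) v₁ v₂ v₃ v₄ v₅ v₆ o)
    (d₅₂ : Rep G c y v₅ v₂) (d₂₅ : Rep G c y v₂ v₅) (o₁ : ¬ Rep G c y o v₁)
    (o₃ : ¬ Rep G c y o v₃) : False := by
  have hmem := hx.mem_iff
  have hnd := hx.nodup
  simp only [List.nodup_cons, List.mem_cons, List.not_mem_nil, not_or] at hnd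
  have m₁ : v₁ ∈ stars G c y := by simp only [hmem]; simp
  have m₂ : v₂ ∈ stars G c y := by simp only [hmem]; simp
  have m₃ : v₃ ∈ stars G c y := by simp only [hmem]; simp
  have m₄ : v₄ ∈ stars G c y := by simp only [hmem]; simp
  have m₅ : v₅ ∈ stars G c y := by simp only [hmem]; simp
  have m₆ : v₆ ∈ stars G c y := by simp only [hmem]; simp
  have mo : o ∈ stars G c y := by simp only [hmem]; simp
  have adj : ∀ {u w : V}, u ≠ w → ¬ NonAdj G u w → G.Adj u w := fun h1 h2 =>
    not_not.1 fun e => h2 ⟨h1, e⟩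
  have a₁₄ : G.Adj v₁ v₄ := adj (by grind) (by rw [hx.adj₁ _ m₄]; grind)
  have a₁₅ : G.Adj v₁ v₅ := adj (by grind) (by rw [hx.adj₁ _ m₅]; grind)
  have a₁o : G.Adj v₁ o := adj (by grind) (by rw [hx.adj₁ _ mo]; grind)
  have a₂₄ : G.Adj v₂ v₄ := adj (by grind) (by rw [hx.adj₂ _ m₄]; grind)
  have a₂₅ : G.Adj v₂ v₅ := adj (by grind) (by rw [hx.adj₂ _ m₅]; grind)
  have a₂₆ : G.Adj v₂ v₆ := adj (by grind) (by rw [hx.adj₂ _ m₆]; grind)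
  have a₂o : G.Adj v₂ o := adj (by grind) (by rw [hx.adj₂ _ mo]; grind)
  have a₃₅ : G.Adj v₃ v₅ := adj (by grind) (by rw [hx.adj₃ _ m₅]; grind)
  have a₃₆ : G.Adj v₃ v₆ := adj (by grind) (by rw [hx.adj₃ _ m₆]; grind)
  have a₃o : G.Adj v₃ o := adj (by grind) (by rw [hx.adj₃ _ mo]; grind)
  have a₄₆ : G.Adj v₄ v₆ := adj (by grind) (by rw [hx.adj₄ _ m₆]; grind)
  have a₄o : G.Adj v₄ o := adj (by grind) (by rw [hx.adj₄ _ mo]; grind)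
  have a₆o : G.Adj v₆ o := adj (by grind) (by rw [hx.adj₆ _ mo]; grind)
  have n₁₂ : NonAdj G v₁ v₂ := by rw [hx.adj₁ _ m₂]; simp
  have n₁₆ : NonAdj G v₁ v₆ := by rw [hx.adj₁ _ m₆]; simp
  have n₃₂ : NonAdj G v₃ v₂ := by rw [hx.adj₃ _ m₂]; simp
  have n₃₄ : NonAdj G v₃ v₄ := by rw [hx.adj₃ _ m₄]; simp
  rw [mem_stars] at m₁ m₂ m₃ m₄ m₅ m₆ mo
  have h2 := h.near_shift m₂
  have hC2 := h2.config hG hm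
  obtain ⟨f₁, hf₁⟩ := h.exists_fwd hG m₁ m₂ n₁₂.1 n₁₂.2
  obtain ⟨f₃, hf₃⟩ := h.exists_fwd hG m₃ m₂ n₃₂.1 n₃₂.2
  have star : ∀ u, Star G c y u → G.Adj v₂ u → u ≠ v₅ → Star G (shift c y v₂) v₂ u := by
    intro u hu h2u hne
    by_contra hn
    exact hne (h.rep_unique hG ⟨m₂, hu, h2u, hn⟩ d₂₅)
  have s₄ := star v₄ m₄ a₂₄ (by grind)
  have s₆ := star v₆ m₆ a₂₆ (by grind)
  have so := star o mo a₂o (by grind)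
  have sy := h.star_shift_self m₂
  have s₁ := h.star_fwd hG m₁ m₂ n₁₂.1 n₁₂.2 hf₁
  have s₃ := h.star_fwd hG m₃ m₂ n₃₂.1 n₃₂.2 hf₃
  have a₄f₃ : G.Adj v₄ f₃ := by
    obtain ⟨s, hs⟩ := h.exists_fwd hG m₃ m₄ n₃₄.1 n₃₄.2
    rw [← h.fwd_eq hG m₃ m₄ m₂ n₃₄.1 n₃₂.1 a₂₄.ne' n₃₄.2 n₃₂.2 s₄ hs hf₃]
    exact hs.1
  have a₆f₁ : G.Adj v₆ f₁ := by
    obtain ⟨s, hs⟩ := h.exists_fwd hG m₁ m₆ n₁₆.1 n₁₆.2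
    rw [← h.fwd_eq hG m₁ m₆ m₂ n₁₆.1 n₁₂.1 a₂₆.ne' n₁₆.2 n₁₂.2 s₆ hs hf₁]
    exact hs.1
  have a₄f₁ : G.Adj v₄ f₁ := by
    rcases h.exists_adj_fwd hG m₁ m₂ n₁₂.1 n₁₂.2 hf₁ m₄ m₅ mo (by grind) (by grind) (by grind)
      a₁₄ a₁₅ a₁o a₂₄ a₂₅ a₂o with e | e | e
    · exact e
    · exact absurd (h.rep_unique hG (rep_of_adj_fwd m₅ m₁ a₁₅.symm hf₁ e) d₅₂) n₁₂.1
    · exact absurd (rep_of_adj_fwd mo m₁ a₁o.symm hf₁ e) o₁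
  have a₆f₃ : G.Adj v₆ f₃ := by
    rcases h.exists_adj_fwd hG m₃ m₂ n₃₂.1 n₃₂.2 hf₃ m₆ m₅ mo (by grind) (by grind) (by grind)
      a₃₆ a₃₅ a₃o a₂₆ a₂₅ a₂o with e | e | e
    · exact e
    · exact absurd (h.rep_unique hG (rep_of_adj_fwd m₅ m₃ a₃₅.symm hf₃ e) d₅₂) n₃₂.1
    · exact absurd (rep_of_adj_fwd mo m₃ a₃o.symm hf₃ e) o₃
  have fne : ∀ {a u f : V}, Star G c y u → Fwd G c y a v₂ f → u ≠ f := by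
    rintro a u f hu hf rfl
    exact hf.2.1 hu.1
  have f13 : f₁ ≠ f₃ := by
    rintro rfl
    have : v₁ = v₃ := m₃.2 v₁ m₁.1 (hf₁.2.2.2.symm.trans hf₃.2.2.2)
    grind
  have hnd' : [y, v₄, v₆, o, f₁, f₃].Nodup := by
    have g1 := m₄.1.ne
    have g2 := m₆.1.ne
    have g3 := mo.1.ne
    have g4 := fne m₄ hf₁
    have g5 := fne m₆ hf₁
    have g6 := fne mo hf₁
    have g7 := fne m₄ hf₃
    have g8 := fne m₆ hf₃
    have g9 := fne mo hf₃
    have g10 := hf₁.2.2.1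
    have g11 := hf₃.2.2.1
    simp only [List.nodup_cons, List.mem_cons, List.not_mem_nil, not_or]
    split_ands <;> grind
  have hcard := Config.card_sdiff_list (N := stars G (shift c y v₂) v₂) hnd' (by
    intro z hz
    simp only [List.mem_cons, List.not_mem_nil, or_false] at hz
    rw [mem_stars]
    rcases hz with rfl | rfl | rfl | rfl | rfl | rfl <;> assumption)
  simp only [hC2.card_eq_seven, List.length_cons, List.length_nil] at hcard
  have isolated : ∀ v, Star G (shift c y v₂) v₂ v →
      (∀ u ∈ [y, v₄, v₆, o, f₁, f₃], ¬ NonAdj G v u) →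
      ∀ z ∈ stars G (shift c y v₂) v₂, ¬ NonAdj G v z := by
    intro v hv hall z hz hvz
    have h1 := hC2.card_eq_two (mem_stars.2 hv) hz hvz
    have h2 : ({t ∈ stars G (shift c y v₂) v₂ | NonAdj G v t} : Finset V) ⊆
        stars G (shift c y v₂) v₂ \ [y, v₄, v₆, o, f₁, f₃].toFinset := by
      intro t ht
      rw [mem_filter] at ht
      rw [mem_sdiff, List.mem_toFinset]
      exact ⟨ht.1, fun e => hall t e ht.2⟩
    have := card_le_card h2
    omega
  obtain ⟨z, hz, hzz⟩ := hC2.exists_adj_of_ne (mem_stars.2 s₄) (mem_stars.2 s₆) a₄₆.ne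
  rcases hzz with e | e
  · refine isolated v₄ s₄ ?_ z hz e
    intro u hu hn
    simp only [List.mem_cons, List.not_mem_nil, or_false] at hu
    rcases hu with rfl | rfl | rfl | rfl | rfl | rfl
    exacts [hn.2 m₄.1.symm, hn.1 rfl, hn.2 a₄₆, hn.2 a₄o, hn.2 a₄f₁, hn.2 a₄f₃]
  · refine isolated v₆ s₆ ?_ z hz e
    intro u hu hn
    simp only [List.mem_cons, List.not_mem_nil, or_false] at hu
    rcases hu with rfl | rfl | rfl | rfl | rfl | rfl
    exacts [hn.2 m₆.1.symm, hn.2 a₄₆.symm, hn.1 rfl, hn.2 a₆o, hn.2 a₆f₁, hn.2 a₆f₃]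

/-- A critical graph has no proper coloring of a vertex-deleted subgraph, hence no vertices. -/
lemma Critical.not_near (hG : Critical G m) (hm : 8 ≤ m) {y : V} {c : V → Fin m} :
    ¬ Near G y c := by
  intro h
  have hC := h.config hG hm
  rcases hC.hexagon_or_heptagon with ⟨v₁, v₂, v₃, v₄, v₅, v₆, o, hx⟩ |
    ⟨v₁, v₂, v₃, v₄, v₅, v₆, v₇, hmem, e₁, e₂, e₃, e₄, e₅, e₆, e₇⟩
  · obtain ⟨v₁, v₂, v₃, v₄, v₅, v₆, o, hx, -, d₅₂, -, d₂₅, o₁, o₃⟩ := hx.exists_values hC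
    exact h.not_hexagon hG hm hx d₅₂ d₂₅ o₁ o₃
  · exact h.not_heptagon hG hm hmem e₁ e₂ e₃ e₄ e₅ e₆ e₇

/-- A graph that is not `m`-colorable has a smallest vertex set on which it is not. -/
lemma exists_minimal_not_proper (h : ¬ ∃ c : V → Fin m, ∀ u w, G.Adj u w → c u ≠ c w) :
    ∃ W : Finset V, (¬ ∃ c : V → Fin m, ∀ u ∈ W, ∀ w ∈ W, G.Adj u w → c u ≠ c w) ∧
      ∀ v ∈ W, ∃ c : V → Fin m, ∀ u ∈ W, ∀ w ∈ W, u ≠ v → w ≠ v → G.Adj u w → c u ≠ c w := by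
  let bad : Finset (Finset V) :=
    {W | ¬ ∃ c : V → Fin m, ∀ u ∈ W, ∀ w ∈ W, G.Adj u w → c u ≠ c w}
  have hbad : bad.Nonempty := ⟨univ, by simpa [bad] using h⟩
  obtain ⟨W, hW, hmin⟩ := bad.exists_min_image card hbad
  refine ⟨W, (mem_filter.1 hW).2, fun v hv => ?_⟩
  by_contra hn
  have hlt : #(W.erase v) < #W := card_erase_lt_of_mem hv
  refine absurd (hmin (W.erase v) (mem_filter.2 ⟨mem_univ _, ?_⟩)) (not_le.2 hlt)
  rintro ⟨c, hc⟩
  exact hn ⟨c, fun u hu w hw hu' hw' =>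
    hc u (mem_erase.2 ⟨hu', hu⟩) w (mem_erase.2 ⟨hw', hw⟩)⟩

lemma critical_induce (hcf : ClawFree G) (hdeg : ∀ v, #{z | G.Adj v z} ≤ m + 1)
    (hω : G.CliqueFree (m + 1)) {W : Finset V} (hm : 0 < m)
    (hW : ¬ ∃ c : V → Fin m, ∀ u ∈ W, ∀ w ∈ W, G.Adj u w → c u ≠ c w)
    (hmin : ∀ v ∈ W, ∃ c : V → Fin m,
      ∀ u ∈ W, ∀ w ∈ W, u ≠ v → w ≠ v → G.Adj u w → c u ≠ c w) :
    Critical (G.induce {v | v ∈ W}) m where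
  clawFree v a b c hva hvb hvc hab hac hbc := by
    simpa only [Subtype.ext_iff] using hcf v a b c hva hvb hvc hab hac hbc
  card_le v := by
    refine (card_le_card_of_injOn Subtype.val ?_ Subtype.val_injective.injOn).trans (hdeg v)
    intro z hz
    simpa using hz
  cliqueFree := hω.comap ⟨(SimpleGraph.Embedding.induce _).toCopy⟩
  not_proper := by
    rintro ⟨c, hc⟩
    refine hW ⟨fun v => if h : v ∈ W then c ⟨v, h⟩ else ⟨0, hm⟩, fun u hu w hw huw => ?_⟩
    simpa only [hu, hw, dite_true] using hc ⟨u, hu⟩ ⟨w, hw⟩ huw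
  exists_near v := by
    obtain ⟨c, hc⟩ := hmin v v.2
    exact ⟨fun u => c u, fun u w hu hw huw =>
      hc u u.2 w w.2 (Subtype.coe_ne_coe.2 hu) (Subtype.coe_ne_coe.2 hw) huw⟩

/-- A claw-free graph of maximum degree at most `m + 1` without a clique on `m + 1` vertices is
`m`-colorable when `m ≥ 8`. -/
lemma colorable_of_clawFree (hcf : ClawFree G) (hdeg : ∀ v, #{z | G.Adj v z} ≤ m + 1)
    (hω : G.CliqueFree (m + 1)) (hm : 8 ≤ m) : G.Colorable m := by
  by_contra hcol
  have hn : ¬ ∃ c : V → Fin m, ∀ u w, G.Adj u w → c u ≠ c w := fun ⟨c, hc⟩ =>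
    hcol ⟨SimpleGraph.Coloring.mk c fun {u w} => hc u w⟩
  obtain ⟨W, hW, hmin⟩ := exists_minimal_not_proper hn
  have hG := critical_induce hcf hdeg hω (by omega) hW hmin
  obtain rfl | ⟨y, hy⟩ := W.eq_empty_or_nonempty
  · exact hW ⟨fun _ => ⟨0, by omega⟩, by simp⟩
  · obtain ⟨c, hc⟩ := hG.exists_near ⟨y, hy⟩
    exact hG.not_near hm hc

lemma card_adj_le_maxDeg (G : SimpleGraph V) (v : V) : #{z | G.Adj v z} ≤ maxDeg G := by
  have h : #{z | G.Adj v z} = deg G v := by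
    rw [deg, ← Set.ncard_coe_finset]
    congr 1
    ext z
    simp
  rw [h]
  exact le_csSup (Set.finite_range _).bddAbove ⟨v, rfl⟩

end ClawFreeColoring

/-- Every claw-free graph with `χ ≥ Δ ≥ 9` contains a `K_Δ`. -/
theorem stmt9 {V : Type*} [Fintype V] (G : SimpleGraph V)
    (hcf : ClawFree G)
    (hχ : (maxDeg G : ℕ∞) ≤ G.chromaticNumber) (hΔ : 9 ≤ maxDeg G) :
    ∃ S : Finset V, G.IsNClique (maxDeg G) S := by
  by_contra! hω
  obtain ⟨m, hm⟩ : ∃ m, maxDeg G = m + 1 := ⟨maxDeg G - 1, by omega⟩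
  rw [hm] at hω
  have hcol : G.Colorable m := ClawFreeColoring.colorable_of_clawFree hcf
    (fun v => hm ▸ ClawFreeColoring.card_adj_le_maxDeg G v) hω (by omega)
  have := hχ.trans hcol.chromaticNumber_le
  rw [hm, Nat.cast_le] at this
  omega
end
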